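/- arXiv:1403.2322 — 5 statements merged into one kernel-verified Lean document; each statement's English description precedes it below -/
import Mathlib

section
/- Let Γ be a finite connected vertex-transitive graph on vertex set V and let n be an integer with 2 ≤ n ≤ |V| − 1. Then h_n(Γ) ≥ h_{n+1}(Γ) / (10n + h_{n+1}(Γ)). -/
open scoped Pointwise

namespace Multiway

variable {V : Type*}

/-- The edge boundary `∂A`: the set of edges with one endpoint in `A` and the other in `Vᶜ∖A`. -/
def edgeBdry (G : SimpleGraph V) (A : Set V) : Set (Sym2 V) :=
  {e | e ∈ G.edgeSet ∧ ∃ u v, e = s(u, v) ∧ u ∈ A ∧ v ∉ A}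

/-- The symmetric vertex boundary `δA`: vertices incident to an edge crossing `A`. -/
def vertBdry (G : SimpleGraph V) (A : Set V) : Set V :=
  {x | ∃ y, G.Adj x y ∧ ¬ (x ∈ A ↔ y ∈ A)}

/-- A partition of the vertex set into `n` non-empty pairwise disjoint sets. -/
def IsNPartition (n : ℕ) (A : Fin n → Set V) : Prop :=
  (∀ i, (A i).Nonempty) ∧ (∀ i j, i ≠ j → Disjoint (A i) (A j)) ∧ (⋃ i, A i) = Set.univ

/-- `max_i |∂A_i| / |A_i|`. -/
noncomputable def edgeRatioMax (G : SimpleGraph V) {n : ℕ} (A : Fin n → Set V) : ℝ :=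
  ⨆ i, ((edgeBdry G (A i)).ncard : ℝ) / ((A i).ncard : ℝ)

/-- `max_i |δA_i| / |A_i|`. -/
noncomputable def vertRatioMax (G : SimpleGraph V) {n : ℕ} (A : Fin n → Set V) : ℝ :=
  ⨆ i, ((vertBdry G (A i)).ncard : ℝ) / ((A i).ncard : ℝ)

/-- The `n`-way isoperimetric constant `h_n(Γ)`. -/
noncomputable def multiH (G : SimpleGraph V) (n : ℕ) : ℝ :=
  sInf {r | ∃ A : Fin n → Set V, IsNPartition n A ∧ r = edgeRatioMax G A}

/-- The `n`-way symmetric vertex isoperimetric constant `ι_n(Γ)`. -/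
noncomputable def multiIota (G : SimpleGraph V) (n : ℕ) : ℝ :=
  sInf {r | ∃ A : Fin n → Set V, IsNPartition n A ∧ r = vertRatioMax G A}

/-- A graph is vertex-transitive if its automorphism group acts transitively on vertices. -/
def VertexTransitive (G : SimpleGraph V) : Prop :=
  ∀ u v : V, ∃ φ : G ≃g G, φ u = v


section Aux

open Finset

variable {V : Type*} [Fintype V] [DecidableEq V] {Γ : Type*} [Group Γ] [Fintype Γ] [MulAction Γ V]

lemma aux_count (htr : ∀ x y : V, ∃ g : Γ, g • x = y) (B : Finset V) (x : V) :
    Fintype.card V * #{g : Γ | g • x ∈ B} = Fintype.card Γ * #B := by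
  have h1 : ∀ y : V, #{g : Γ | g • y ∈ B} = #{g : Γ | g • x ∈ B} := by
    intro y
    obtain ⟨k, rfl⟩ := htr x y
    refine Finset.card_bij (fun g _ => g * k) ?_ ?_ ?_
    · intro g hg
      simpa [mul_smul] using hg
    · intro a _ b _ h
      exact mul_right_cancel h
    · intro b hb
      refine ⟨b * k⁻¹, ?_, by simp⟩
      simpa [mul_smul] using hb
  have h2 : ∑ y : V, #{g : Γ | g • y ∈ B} = ∑ g : Γ, #{y : V | g • y ∈ B} := by
    simp_rw [card_filter]
    exact sum_comm
  have h3 : ∀ g : Γ, #{y : V | g • y ∈ B} = #B := by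
    intro g
    refine Finset.card_bij (fun y _ => g • y) ?_ ?_ ?_
    · intro y hy
      simpa using hy
    · intro a _ b _ h
      exact MulAction.injective g h
    · intro b hb
      exact ⟨g⁻¹ • b, by simpa using hb, by simp⟩
  simp_rw [h1, h3] at h2
  simpa using h2

lemma aux_block (G : SimpleGraph V) (hconn : G.Connected)
    (htr : ∀ x y : V, ∃ g : Γ, g • x = y)
    (hadj : ∀ (g : Γ) x y, G.Adj (g • x) (g • y) ↔ G.Adj x y)
    (B : Finset V) (hB : ∀ (g : Γ) x, x ∈ B → g • x ∈ B → ∀ y, y ∈ B ↔ g • y ∈ B)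
    (x0 : V) (hx0 : x0 ∈ B) (y0 : V) (hy0 : y0 ∉ B) (A : Finset V) :
    #A ≤ 2 * #(A \ B) + (edgeBdry G (A : Set V)).ncard := by
  classical
  set t := #{y | G.Adj x0 y ∧ y ∉ B} with ht
  have hout : ∀ x ∈ B, #{y | G.Adj x y ∧ y ∉ B} = t := by
    intro x hx
    obtain ⟨g, rfl⟩ := htr x0 x
    have hg := hB g x0 hx0 hx
    symm
    refine Finset.card_bij (fun y _ => g • y) ?_ ?_ ?_
    · intro y hy
      simp only [mem_filter, mem_univ, true_and] at hy ⊢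
      exact ⟨(hadj g _ _).2 hy.1, fun h => hy.2 ((hg y).2 h)⟩
    · intro a _ b _ h
      exact MulAction.injective g h
    · intro b hb
      simp only [mem_filter, mem_univ, true_and] at hb
      refine ⟨g⁻¹ • b, ?_, by simp⟩
      simp only [mem_filter, mem_univ, true_and]
      refine ⟨(hadj g _ _).1 (by simpa using hb.1), fun h => hb.2 ?_⟩
      simpa using (hg _).1 h
  have ht1 : 1 ≤ t := by
    obtain ⟨w⟩ := hconn.preconnected x0 y0
    obtain ⟨d, -, hd1, hd2⟩ := w.exists_boundary_dart (B : Set V) (by simpa using hx0) (by simpa using hy0)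
    rw [← hout d.fst (by simpa using hd1)]
    apply Finset.card_pos.2
    exact ⟨d.snd, by simpa [d.adj] using hd2⟩
  have hin : ∀ y, y ∉ B → #{x ∈ A ∩ B | G.Adj x y} ≤ t := by
    intro y hy
    obtain ⟨g, rfl⟩ := htr x0 y
    refine Finset.card_le_card_of_injOn (fun x => g⁻¹ • x) ?_ ?_
    · intro x hx
      simp only [coe_filter, mem_inter, Set.mem_ofPred_eq, mem_univ, true_and] at hx ⊢
      refine ⟨(hadj g _ _).1 (by simpa using hx.2.symm), fun h => hy ?_⟩
      exact (hB g _ h (by simpa using hx.1.2) x0).1 hx0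
    · intro a _ b _ h
      exact MulAction.injective g⁻¹ h
  have h1 : #(A ∩ B) * t ≤ ∑ x ∈ A ∩ B, (#{y ∈ A \ B | G.Adj x y} + #{y | G.Adj x y ∧ y ∉ A}) := by
    rw [← smul_eq_mul, ← sum_const]
    apply sum_le_sum
    intro x hx
    rw [← hout x (mem_inter.1 hx).2]
    refine le_trans (card_le_card ?_) (card_union_le _ _)
    intro y hy
    simp only [mem_filter, mem_univ, true_and, mem_union, mem_sdiff] at hy ⊢
    tauto
  have h2 : ∑ x ∈ A ∩ B, #{y ∈ A \ B | G.Adj x y} ≤ #(A \ B) * t := by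
    have : ∑ x ∈ A ∩ B, #{y ∈ A \ B | G.Adj x y} = ∑ y ∈ A \ B, #{x ∈ A ∩ B | G.Adj x y} := by
      simp_rw [card_filter]
      exact sum_comm
    rw [this, ← smul_eq_mul, ← sum_const]
    exact sum_le_sum fun y hy => hin y (mem_sdiff.1 hy).2
  have h3 : ∑ x ∈ A ∩ B, #{y | G.Adj x y ∧ y ∉ A} ≤ (edgeBdry G (A : Set V)).ncard := by
    rw [← Finset.card_sigma, ← Set.ncard_coe_finset]
    refine Set.ncard_le_ncard_of_injOn (fun p => s(p.1, p.2)) ?_ ?_ (Set.toFinite _)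
    · rintro ⟨x, y⟩ hp
      simp only [coe_sigma, Set.mem_sigma_iff, coe_inter, Set.mem_inter_iff, mem_coe, mem_filter, mem_univ, true_and] at hp
      exact ⟨hp.2.1, x, y, rfl, hp.1.1, hp.2.2⟩
    · rintro ⟨x, y⟩ hp ⟨x', y'⟩ hp' h
      simp only [coe_sigma, Set.mem_sigma_iff, coe_inter, Set.mem_inter_iff, mem_coe, mem_filter, mem_univ, true_and] at hp hp'
      simp only [Sym2.eq_iff] at h
      rcases h with ⟨rfl, rfl⟩ | ⟨rfl, rfl⟩
      · rfl
      · exact absurd hp.1.1 hp'.2.2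
  rw [sum_add_distrib] at h1
  have h4 := card_inter_add_card_sdiff A B
  have h5 : #(A ∩ B) * t ≤ #(A \ B) * t + (edgeBdry G (A : Set V)).ncard := by omega
  nlinarith

/-- Core construction of the block. -/
lemma aux_core (G : SimpleGraph V) (hconn : G.Connected)
    (htr : ∀ x y : V, ∃ g : Γ, g • x = y)
    (hadj : ∀ (g : Γ) x y, G.Adj (g • x) (g • y) ↔ G.Adj x y)
    {n : ℕ} (P : Fin n → Finset V) (hdis : ∀ i j, i ≠ j → Disjoint (P i) (P j))
    (j : Fin n) (hmax : ∀ i, #(P i) ≤ #(P j)) (hpos : 0 < #(P j))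
    (hsm : 4 * #(P j) ≤ 3 * Fintype.card V)
    (β : ℝ) (hβ : 0 < β) (hβ1 : β ≤ 1 / 10)
    (hi : ∀ g : Γ, ∃ i, (#(g • P j \ P i) : ℝ) < β * #(P j)) :
    (1 - 6 * β) * #(P j) ≤ (edgeBdry G (P j : Set V)).ncard := by
  classical
  choose i hi using hi
  set A := P j with hA
  have hposR : (0 : ℝ) < #A := by exact_mod_cast hpos
  have hint : ∀ g S, (#((g : Γ) • A ∩ S) : ℝ) + #(g • A \ S) = #A := by
    intro g S
    have := card_inter_add_card_sdiff (g • A) S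
    rw [card_smul_finset] at this
    exact_mod_cast this
  have hrev : ∀ g : Γ, (#(P (i g) \ g • A) : ℝ) < β * #A := by
    intro g
    have h1 := card_inter_add_card_sdiff (P (i g)) (g • A)
    have h2 := hint g (P (i g))
    have h3 : (#(P (i g)) : ℝ) ≤ #A := by exact_mod_cast hmax _
    rw [inter_comm] at h1
    have h1' : (#(g • A ∩ P (i g)) : ℝ) + #(P (i g) \ g • A) = #(P (i g)) := by exact_mod_cast h1
    linarith [hi g]
  have hchar : ∀ g g' : Γ, i g = i g' ↔ (#A : ℝ) / 2 < #(g • A ∩ g' • A) := by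
    intro g g'
    constructor
    · intro h
      have h1 : #(g • A \ g' • A) ≤ #(g • A \ P (i g)) + #(P (i g) \ g' • A) := by
        refine le_trans (card_le_card ?_) (card_union_le _ _)
        intro x; simp only [mem_sdiff, mem_union]; tauto
      have h1' : (#(g • A \ g' • A) : ℝ) ≤ #(g • A \ P (i g)) + #(P (i g) \ g' • A) := by exact_mod_cast h1
      have h2 := hi g
      have h3 := hrev g'
      rw [← h] at h3
      have h4 := hint g (g' • A)
      nlinarith
    · intro h
      by_contra hne
      have h1 : #(g • A ∩ g' • A) ≤ #(g • A \ P (i g)) + #(g' • A \ P (i g')) := by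
        refine le_trans (card_le_card ?_) (card_union_le _ _)
        intro x
        have hd := Finset.disjoint_left.1 (hdis _ _ hne)
        have := @hd x
        simp only [mem_sdiff, mem_union, mem_inter]; tauto
      have h1' : (#(g • A ∩ g' • A) : ℝ) ≤ #(g • A \ P (i g)) + #(g' • A \ P (i g')) := by exact_mod_cast h1
      have h2 := hi g
      have h3 := hi g'
      nlinarith
  have hinv : ∀ k g g' : Γ, i (k * g) = i (k * g') ↔ i g = i g' := by
    intro k g g'
    rw [hchar, hchar, mul_smul, mul_smul, ← smul_finset_inter, card_smul_finset]
  have hij : i 1 = j := by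
    by_contra hne
    have h := hi 1
    rw [one_smul, Finset.sdiff_eq_self_of_disjoint (hdis _ _ (Ne.symm hne))] at h
    nlinarith
  set κ := #{g : Γ | i g = i 1} with hκ
  have hκpos : 0 < κ := card_pos.2 ⟨1, by simp⟩
  have hκR : (0 : ℝ) < κ := by exact_mod_cast hκpos
  have hfib : ∀ g : Γ, #{g' : Γ | i g' = i g} = κ := by
    intro g
    symm
    refine Finset.card_bij (fun y _ => g * y) ?_ ?_ ?_
    · intro y hy
      simp only [mem_filter, mem_univ, true_and] at hy ⊢
      have := (hinv g y 1).2 hy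
      simpa using this
    · intro a _ b _ h
      exact mul_left_cancel h
    · intro b hb
      simp only [mem_filter, mem_univ, true_and] at hb
      refine ⟨g⁻¹ * b, ?_, by simp⟩
      simp only [mem_filter, mem_univ, true_and]
      rw [← hinv g]
      simpa using hb
  set F : Γ → V → ℕ := fun g x => #{g' : Γ | i g' = i g ∧ x ∈ g' • A} with hF
  have hFinv : ∀ k g x, F (k * g) (k • x) = F g x := by
    intro k g x
    symm
    refine Finset.card_bij (fun y _ => k * y) ?_ ?_ ?_
    · intro y hy
      simp only [mem_filter, mem_univ, true_and] at hy ⊢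
      refine ⟨(hinv _ _ _).2 hy.1, ?_⟩
      rw [mul_smul, smul_mem_smul_finset_iff]
      exact hy.2
    · intro a _ b _ h
      exact mul_left_cancel h
    · intro b hb
      simp only [mem_filter, mem_univ, true_and] at hb
      refine ⟨k⁻¹ * b, ?_, by simp⟩
      simp only [mem_filter, mem_univ, true_and]
      refine ⟨(hinv k _ _).1 (by simpa using hb.1), ?_⟩
      rw [← smul_mem_smul_finset_iff k, ← mul_smul]
      simpa using hb.2
  have hNpos : (0 : ℝ) < Fintype.card V := by
    have : 0 < Fintype.card V := by omega
    exact_mod_cast this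
  have hbig : (Fintype.card Γ : ℝ) * ((1 - β) * #A) ≤ κ * Fintype.card V := by
    have h1 : Fintype.card Γ = ∑ l : Fin n, #{g : Γ | i g = l} := by
      rw [← Finset.card_univ]
      exact Finset.card_eq_sum_card_fiberwise (fun x _ => by simp)
    have h2 : ∀ l : Fin n, (#{g : Γ | i g = l} : ℝ) * ((1 - β) * #A) ≤ κ * #(P l) := by
      intro l
      by_cases hl : ∃ g, i g = l
      · obtain ⟨g, rfl⟩ := hl
        rw [hfib]
        apply mul_le_mul_of_nonneg_left _ hκR.le
        have h3 := hint g (P (i g))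
        have h4 : (#(g • A ∩ P (i g)) : ℝ) ≤ #(P (i g)) := by
          exact_mod_cast card_le_card inter_subset_right
        linarith [hi g]
      · have : #{g : Γ | i g = l} = 0 := by
          rw [card_eq_zero, filter_eq_empty_iff]
          intro g _ h
          exact hl ⟨g, h⟩
        rw [this]
        simp only [Nat.cast_zero, zero_mul]
        positivity
    have h3 : ∑ l : Fin n, #(P l) ≤ Fintype.card V := by
      rw [← Finset.card_biUnion (fun a _ b _ h => hdis a b h)]
      exact card_le_univ _
    have h3' : ∑ l : Fin n, (#(P l) : ℝ) ≤ Fintype.card V := by exact_mod_cast h3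
    rw [h1]
    push_cast
    rw [sum_mul]
    calc _ ≤ ∑ l : Fin n, (κ : ℝ) * #(P l) := sum_le_sum fun l _ => h2 l
      _ = κ * ∑ l : Fin n, (#(P l) : ℝ) := by rw [mul_sum]
      _ ≤ _ := by gcongr
  have huniq : ∀ g g' x, 2 * κ < 3 * F g x → 2 * κ < 3 * F g' x → i g = i g' := by
    intro g g' x h1 h2
    by_contra hne
    have h3 : F g x + F g' x ≤ #{k : Γ | k • x ∈ A} := by
      have : #{k : Γ | k • x ∈ A} = #{k : Γ | x ∈ k • A} := by
        refine Finset.card_bij (fun y _ => y⁻¹) ?_ ?_ ?_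
        · intro y hy
          simpa [Finset.mem_inv_smul_finset_iff] using hy
        · intro a _ b _ h
          exact inv_injective h
        · intro b hb
          refine ⟨b⁻¹, ?_, by simp⟩
          simpa [Finset.inv_smul_mem_iff] using hb
      rw [this]
      simp only [hF]
      rw [← card_union_of_disjoint]
      · apply card_le_card
        intro k
        simp only [mem_union, mem_filter, mem_univ, true_and]
        tauto
      · rw [Finset.disjoint_left]
        intro k hk hk'
        simp only [mem_filter, mem_univ, true_and] at hk hk'
        exact hne (hk.1.symm.trans hk'.1)
    have h4 := aux_count htr A x
    set c := #{k : Γ | k • x ∈ A}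
    have h5 : (Fintype.card V : ℝ) * c = Fintype.card Γ * #A := by exact_mod_cast h4
    have h6 : 4 * κ ≤ 3 * c := by omega
    have h7 : (4 : ℝ) * κ ≤ 3 * c := by exact_mod_cast h6
    have h8 : (Fintype.card V : ℝ) * (c * (1 - β)) ≤ Fintype.card V * κ := by
      calc _ = (Fintype.card Γ : ℝ) * ((1 - β) * #A) := by linear_combination (1 - β) * h5
        _ ≤ _ := by linarith
    have h9 := le_of_mul_le_mul_left h8 hNpos
    nlinarith
  set B : Finset V := {x | 2 * κ < 3 * F 1 x} with hBdef
  have hBblock : ∀ (g : Γ) x, x ∈ B → g • x ∈ B → ∀ y, y ∈ B ↔ g • y ∈ B := by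
    intro g x hx hgx y
    simp only [hBdef, mem_filter, mem_univ, true_and] at hx hgx ⊢
    have h1 : ∀ z, F g (g • z) = F 1 z := by
      intro z
      simpa using hFinv g 1 z
    rw [← h1 x] at hx
    have h2 := huniq _ _ _ hx hgx
    rw [← h1 y]
    simp only [hF, h2]
  have hAi : ∀ g, i g = i 1 → (#(g • A \ A) : ℝ) ≤ β * #A := by
    intro g h
    have := hi g
    rw [h, hij] at this
    exact this.le
  have hAi' : ∀ g, i g = i 1 → (#(A \ g • A) : ℝ) ≤ β * #A := by
    intro g h
    have := hrev g
    rw [h, hij] at this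
    exact this.le
  have hd1 : (#(A \ B) : ℝ) ≤ 3 * β * #A := by
    have h1 : ∑ x ∈ A, #{g ∈ ({g : Γ | i g = i 1} : Finset Γ) | x ∉ g • A}
        = ∑ g ∈ ({g : Γ | i g = i 1} : Finset Γ), #(A \ g • A) := by
      simp_rw [sdiff_eq_filter, card_filter _ A, card_filter (fun g => _ ∉ g • A) _]
      exact sum_comm
    have h2 : ∑ g ∈ ({g : Γ | i g = i 1} : Finset Γ), (#(A \ g • A) : ℝ) ≤ κ * (β * #A) := by
      rw [← nsmul_eq_mul]
      apply Finset.sum_le_card_nsmul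
      intro g hg
      exact hAi' g (by simpa using hg)
    have h3 : #(A \ B) * κ ≤ 3 * ∑ x ∈ A, #{g ∈ ({g : Γ | i g = i 1} : Finset Γ) | x ∉ g • A} := by
      rw [mul_sum]
      refine le_trans ?_ (sum_le_sum_of_subset sdiff_subset (s := A \ B))
      rw [← smul_eq_mul]
      apply Finset.card_nsmul_le_sum
      intro x hx
      have hx2 := (mem_sdiff.1 hx).2
      simp only [hBdef, mem_filter, mem_univ, true_and, not_lt] at hx2
      have h4 := Finset.card_filter_add_card_filter_not (s := ({g : Γ | i g = i 1} : Finset Γ)) (fun g => x ∈ g • A)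
      rw [filter_filter] at h4
      change F 1 x + _ = κ at h4
      omega
    rw [h1] at h3
    have h3' : (#(A \ B) : ℝ) * κ ≤ 3 * ∑ g ∈ ({g : Γ | i g = i 1} : Finset Γ), (#(A \ g • A) : ℝ) := by
      exact_mod_cast h3
    refine le_of_mul_le_mul_right ?_ hκR
    linarith
  have hd2 : (#(B \ A) : ℝ) * 2 ≤ 3 * β * #A := by
    have h1 : ∑ x ∈ B \ A, F 1 x
        = ∑ g ∈ ({g : Γ | i g = i 1} : Finset Γ), #{x ∈ B \ A | x ∈ g • A} := by
      simp only [hF]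
      simp_rw [← filter_filter]
      simp_rw [card_filter _ (B \ A), card_filter (fun g => _ ∈ g • A) _]
      exact sum_comm
    have h2 : ∑ g ∈ ({g : Γ | i g = i 1} : Finset Γ), (#{x ∈ B \ A | x ∈ g • A} : ℝ) ≤ κ * (β * #A) := by
      rw [← nsmul_eq_mul]
      apply Finset.sum_le_card_nsmul
      intro g hg
      refine le_trans ?_ (hAi g (by simpa using hg))
      norm_cast
      apply card_le_card
      intro x
      simp only [mem_filter, mem_sdiff]
      tauto
    have h3 : #(B \ A) * (2 * κ) ≤ 3 * ∑ x ∈ B \ A, F 1 x := by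
      rw [mul_sum, ← smul_eq_mul]
      apply Finset.card_nsmul_le_sum
      intro x hx
      have hx2 := (mem_sdiff.1 hx).1
      simp only [hBdef, mem_filter, mem_univ, true_and] at hx2
      exact hx2.le
    rw [h1] at h3
    have h3' : (#(B \ A) : ℝ) * (2 * κ) ≤ 3 * ∑ g ∈ ({g : Γ | i g = i 1} : Finset Γ), (#{x ∈ B \ A | x ∈ g • A} : ℝ) := by
      exact_mod_cast h3
    refine le_of_mul_le_mul_right ?_ hκR
    linarith
  have hx0 : ∃ x0, x0 ∈ B := by
    by_contra hne
    push Not at hne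
    have : A \ B = A := by
      ext x; simp [hne x]
    rw [this] at hd1
    nlinarith
  have hy0 : ∃ y0, y0 ∉ B := by
    by_contra hne
    push Not at hne
    have h1 : Fintype.card V ≤ #A + #(B \ A) := by
      rw [← Finset.card_univ]
      refine le_trans (card_le_card ?_) (card_union_le _ _)
      intro x _
      simp [hne x]
    have h1' : (Fintype.card V : ℝ) ≤ #A + #(B \ A) := by exact_mod_cast h1
    have h2 : (4 : ℝ) * #A ≤ 3 * Fintype.card V := by exact_mod_cast hsm
    nlinarith
  obtain ⟨x0, hx0⟩ := hx0
  obtain ⟨y0, hy0⟩ := hy0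
  have hfin := aux_block G hconn htr hadj B hBblock x0 hx0 y0 hy0 A
  have hfin' : (#A : ℝ) ≤ 2 * #(A \ B) + (edgeBdry G (A : Set V)).ncard := by exact_mod_cast hfin
  linarith

omit [DecidableEq V] in
lemma aux_bddBelow (G : SimpleGraph V) (n : ℕ) :
    ∀ r ∈ {r | ∃ A : Fin n → Set V, IsNPartition n A ∧ r = edgeRatioMax G A}, 0 ≤ r := by
  rintro r ⟨A, -, rfl⟩
  exact Real.iSup_nonneg fun i => by positivity

lemma aux_split (G : SimpleGraph V) {n : ℕ} (P : Fin n → Finset V)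
    (hne : ∀ i, (P i).Nonempty) (hdis : ∀ i j, i ≠ j → Disjoint (P i) (P j))
    (hcov : ∀ x, ∃ i, x ∈ P i) (j : Fin n) (S : Finset V)
    (h1 : (P j ∩ S).Nonempty) (h2 : (P j \ S).Nonempty) (R : ℝ)
    (hR : ∀ i, i ≠ j → ((edgeBdry G (P i : Set V)).ncard : ℝ) ≤ R * #(P i))
    (hR1 : ((edgeBdry G ((P j ∩ S : Finset V) : Set V)).ncard : ℝ) ≤ R * #(P j ∩ S))
    (hR2 : ((edgeBdry G ((P j \ S : Finset V) : Set V)).ncard : ℝ) ≤ R * #(P j \ S)) :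
    multiH G (n + 1) ≤ R := by
  set U : Fin n → Finset V := fun i => if i = j then P j ∩ S else P i with hU
  set Q : Fin (n + 1) → Finset V := Fin.cons (P j \ S) U with hQ
  have hUP : ∀ i, U i ⊆ P i := by
    intro i
    by_cases h : i = j
    · subst h; simp [hU]
    · simp [hU, h]
  have hUd : ∀ i, Disjoint (P j \ S) (U i) := by
    intro i
    by_cases h : i = j
    · subst h
      simp only [hU, if_true]
      rw [Finset.disjoint_left]
      intro x; simp only [mem_sdiff, mem_inter]; tauto
    · simp only [hU, h, if_false]
      exact (hdis j i (Ne.symm h)).mono_left sdiff_subset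
  have hpart : IsNPartition (n + 1) (fun i => (Q i : Set V)) := by
    refine ⟨?_, ?_, ?_⟩
    · intro i
      refine Fin.cases ?_ (fun i => ?_) i
      · simpa only [hQ, Fin.cons_zero, Finset.coe_nonempty] using h2
      · by_cases h : i = j
        · simpa only [hQ, hU, h, Fin.cons_succ, if_true, Finset.coe_nonempty] using h1
        · simpa [hQ, hU, h] using hne i
    · intro a b
      simp only [Finset.disjoint_coe]
      refine Fin.cases ?_ (fun a => ?_) a <;> refine Fin.cases ?_ (fun b => ?_) b
      · simp
      · intro _; simpa [hQ] using hUd b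
      · intro _; simpa [hQ] using (hUd a).symm
      · intro hab
        have hab : a ≠ b := fun h => hab (by rw [h])
        simpa [hQ] using (hdis a b hab).mono (hUP a) (hUP b)
    · rw [Set.eq_univ_iff_forall]
      intro x
      obtain ⟨i, hi⟩ := hcov x
      rw [Set.mem_iUnion]
      by_cases h : i = j
      · subst h
        by_cases hS : x ∈ S
        · exact ⟨i.succ, by simp [hQ, hU, hi, hS]⟩
        · exact ⟨0, by simp [hQ, hi, hS]⟩
      · exact ⟨i.succ, by simp [hQ, hU, hi, h]⟩
  refine (csInf_le ⟨0, aux_bddBelow G (n + 1)⟩ ⟨_, hpart, rfl⟩).trans ?_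
  apply ciSup_le
  intro i
  have hp : (0 : ℝ) < ((Q i : Set V)).ncard := by
    have : 0 < ((Q i : Set V)).ncard := (Set.ncard_pos (Set.toFinite _)).2 (hpart.1 i)
    exact_mod_cast this
  rw [div_le_iff₀ hp, Set.ncard_coe_finset]
  refine Fin.cases ?_ (fun i => ?_) i
  · simpa only [hQ, Fin.cons_zero] using hR2
  · by_cases h : i = j
    · simpa only [hQ, Fin.cons_succ, hU, h, if_true] using hR1
    · simpa only [hQ, Fin.cons_succ, hU, h, if_false] using hR i h

lemma aux_bdry_inter (G : SimpleGraph V) (A S : Finset V) :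
    (edgeBdry G ((A ∩ S : Finset V) : Set V)).ncard ≤
      (edgeBdry G (A : Set V)).ncard + (edgeBdry G (S : Set V)).ncard := by
  refine le_trans (Set.ncard_le_ncard ?_ (Set.toFinite _)) (Set.ncard_union_le _ _)
  rintro e ⟨he, u, v, rfl, hu, hv⟩
  simp only [coe_inter, Set.mem_inter_iff, not_and] at hu hv
  by_cases h : v ∈ (A : Set V)
  · exact Or.inr ⟨he, u, v, rfl, hu.2, hv h⟩
  · exact Or.inl ⟨he, u, v, rfl, hu.1, h⟩

lemma aux_bdry_sdiff (G : SimpleGraph V) (A S : Finset V) :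
    (edgeBdry G ((A \ S : Finset V) : Set V)).ncard ≤
      (edgeBdry G (A : Set V)).ncard + (edgeBdry G (S : Set V)).ncard := by
  refine le_trans (Set.ncard_le_ncard ?_ (Set.toFinite _)) (Set.ncard_union_le _ _)
  rintro e ⟨he, u, v, rfl, hu, hv⟩
  simp only [coe_sdiff, Set.mem_sdiff, not_and, not_not] at hu hv
  by_cases h : v ∈ (A : Set V)
  · exact Or.inr ⟨he, v, u, Sym2.eq_swap, hv h, hu.2⟩
  · exact Or.inl ⟨he, u, v, rfl, hu.1, h⟩

omit [Fintype Γ] in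
lemma aux_bdry_smul (G : SimpleGraph V)
    (hadj : ∀ (g : Γ) x y, G.Adj (g • x) (g • y) ↔ G.Adj x y) (g : Γ) (A : Finset V) :
    (edgeBdry G ((g • A : Finset V) : Set V)).ncard ≤ (edgeBdry G (A : Set V)).ncard := by
  have h : edgeBdry G ((g • A : Finset V) : Set V) ⊆
      (Sym2.map (fun x => g • x)) '' (edgeBdry G (A : Set V)) := by
    rintro e ⟨he, u, v, rfl, hu, hv⟩
    refine ⟨s(g⁻¹ • u, g⁻¹ • v), ⟨?_, _, _, rfl, ?_, ?_⟩, by simp⟩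
    · rw [SimpleGraph.mem_edgeSet] at he ⊢
      exact (hadj _ _ _).2 he
    · rw [mem_coe] at hu ⊢
      exact Finset.inv_smul_mem_iff.2 hu
    · rw [mem_coe] at hv ⊢
      exact fun h => hv (Finset.inv_smul_mem_iff.1 h)
  exact (Set.ncard_le_ncard h (Set.toFinite _)).trans (Set.ncard_image_le (Set.toFinite _))

/-- Either an (n+1)-partition with a good ratio exists, for any given n-partition with ratio
less than 1. -/
lemma aux_main (G : SimpleGraph V) (hconn : G.Connected)
    (htr : ∀ x y : V, ∃ g : Γ, g • x = y)
    (hadj : ∀ (g : Γ) x y, G.Adj (g • x) (g • y) ↔ G.Adj x y)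
    {n : ℕ} (hn : 2 ≤ n) (P : Fin n → Finset V)
    (hne : ∀ i, (P i).Nonempty) (hdis : ∀ i j, i ≠ j → Disjoint (P i) (P j))
    (hcov : ∀ x, ∃ i, x ∈ P i) (h : ℝ) (h0 : 0 ≤ h) (h1 : h < 1)
    (hP : ∀ i, ((edgeBdry G (P i : Set V)).ncard : ℝ) ≤ h * #(P i)) :
    multiH G (n + 1) ≤ 10 * n * h / (1 - h) := by
  classical
  have hnR : (2 : ℝ) ≤ n := by exact_mod_cast hn
  have h1h : 0 < 1 - h := by linarith
  have hR : ∀ c : ℝ, c ≤ 10 * n → c * h ≤ 10 * n * h / (1 - h) := by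
    intro c hc
    rw [le_div_iff₀ h1h]
    nlinarith [mul_nonneg h0 h0, mul_le_mul_of_nonneg_right hc h0, mul_nonneg (mul_nonneg h0 h0) (by linarith : (0:ℝ) ≤ n),
      mul_le_mul_of_nonneg_right (mul_le_mul_of_nonneg_right hc h0) h1h.le]
  have hR1 : ∀ i, ((edgeBdry G (P i : Set V)).ncard : ℝ) ≤ 10 * n * h / (1 - h) * #(P i) := by
    intro i
    refine (hP i).trans ?_
    gcongr
    simpa using hR 1 (by linarith)
  haveI : Nonempty (Fin n) := ⟨⟨0, by omega⟩⟩
  obtain ⟨j, hmax⟩ := Finite.exists_max (fun i => #(P i))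
  have hposj := (hne j).card_pos
  have hposR : (0 : ℝ) < #(P j) := by exact_mod_cast hposj
  have hNsum : ∑ i, #(P i) = Fintype.card V := by
    rw [← Finset.card_biUnion (fun a _ b _ h => hdis a b h), ← Finset.card_univ]
    congr 1
    ext x
    simpa using hcov x
  have hNsum' : (#(P j) : ℝ) + ∑ i ∈ univ.erase j, (#(P i) : ℝ) = Fintype.card V := by
    rw [Finset.add_sum_erase univ (fun i => (#(P i) : ℝ)) (mem_univ j)]
    exact_mod_cast hNsum
  by_cases hsm : 4 * #(P j) ≤ 3 * Fintype.card V
  · set β : ℝ := (1 - h) / (5 * n) with hβ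
    have hβpos : 0 < β := by positivity
    have hβn : β * (5 * n) = 1 - h := by rw [hβ]; field_simp
    have hβ1 : β ≤ (1 - h) / 10 := by nlinarith
    have hβR : 10 * n * h / (1 - h) * β = 2 * h := by
      rw [hβ]; field_simp; ring
    by_cases hdich : ∀ (g : Γ) i, (#(g • P j ∩ P i) : ℝ) < β * #(P j) ∨ (#(g • P j \ P i) : ℝ) < β * #(P j)
    · exfalso
      have hi : ∀ g : Γ, ∃ i, (#(g • P j \ P i) : ℝ) < β * #(P j) := by
        intro g
        by_contra hno
        push Not at hno
        have hall : ∀ i, (#(g • P j ∩ P i) : ℝ) < β * #(P j) := fun i =>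
          (hdich g i).resolve_right (not_lt.2 (hno i))
        have h3 : #(P j) ≤ ∑ i, #(g • P j ∩ P i) := by
          rw [← card_smul_finset g (P j)]
          refine le_trans (card_le_card ?_) card_biUnion_le
          intro x hx
          obtain ⟨i, hi⟩ := hcov x
          simp only [mem_biUnion, mem_univ, true_and, mem_inter]
          exact ⟨i, hx, hi⟩
        have h3' : (#(P j) : ℝ) ≤ ∑ i, (#(g • P j ∩ P i) : ℝ) := by exact_mod_cast h3
        have h4 : ∑ i, (#(g • P j ∩ P i) : ℝ) ≤ n * (β * #(P j)) := by
          have := Finset.sum_le_card_nsmul univ (fun i => (#(g • P j ∩ P i) : ℝ)) _ (fun i _ => (hall i).le)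
          simpa using this
        nlinarith
      have := aux_core G hconn htr hadj P hdis j hmax hposj hsm β hβpos (by linarith) hi
      have h5 := hP j
      nlinarith
    · push Not at hdich
      obtain ⟨g, i, hg1, hg2⟩ := hdich
      have e1 : #(P j ∩ g⁻¹ • P i) = #(g • P j ∩ P i) := by
        rw [← card_smul_finset g (P j ∩ g⁻¹ • P i), smul_finset_inter, smul_inv_smul]
      have e2 : #(P j \ g⁻¹ • P i) = #(g • P j \ P i) := by
        rw [← card_smul_finset g (P j \ g⁻¹ • P i), smul_finset_sdiff, smul_inv_smul]
      rw [← e1] at hg1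
      rw [← e2] at hg2
      have hb : ((edgeBdry G (P j : Set V)).ncard : ℝ) +
          (edgeBdry G ((g⁻¹ • P i : Finset V) : Set V)).ncard ≤ 2 * h * #(P j) := by
        have h3 : ((edgeBdry G ((g⁻¹ • P i : Finset V) : Set V)).ncard : ℝ) ≤
          (edgeBdry G (P i : Set V)).ncard := by exact_mod_cast aux_bdry_smul G hadj g⁻¹ (P i)
        have h4 : (#(P i) : ℝ) ≤ #(P j) := by exact_mod_cast hmax i
        nlinarith [hP i, hP j, mul_le_mul_of_nonneg_left h4 h0]
      have hRnn : 0 ≤ 10 * n * h / (1 - h) := by positivity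
      have hprod : 0 < β * #(P j) := by positivity
      refine aux_split G P hne hdis hcov j (g⁻¹ • P i) ?_ ?_ _ (fun i _ => hR1 i) ?_ ?_
      · apply card_pos.1
        have := hprod.trans_le hg1
        exact_mod_cast this
      · apply card_pos.1
        have := hprod.trans_le hg2
        exact_mod_cast this
      · have h3 : ((edgeBdry G ((P j ∩ g⁻¹ • P i : Finset V) : Set V)).ncard : ℝ) ≤
            (edgeBdry G (P j : Set V)).ncard + (edgeBdry G ((g⁻¹ • P i : Finset V) : Set V)).ncard := by
          exact_mod_cast aux_bdry_inter G (P j) (g⁻¹ • P i)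
        have h4 := mul_le_mul_of_nonneg_left hg1 hRnn
        rw [← mul_assoc, hβR] at h4
        exact (h3.trans hb).trans h4
      · have h3 : ((edgeBdry G ((P j \ g⁻¹ • P i : Finset V) : Set V)).ncard : ℝ) ≤
            (edgeBdry G (P j : Set V)).ncard + (edgeBdry G ((g⁻¹ • P i : Finset V) : Set V)).ncard := by
          exact_mod_cast aux_bdry_sdiff G (P j) (g⁻¹ • P i)
        have h4 := mul_le_mul_of_nonneg_left hg2 hRnn
        rw [← mul_assoc, hβR] at h4
        exact (h3.trans hb).trans h4
  · push Not at hsm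
    have hsmR : (3 : ℝ) * Fintype.card V < 4 * #(P j) := by exact_mod_cast hsm
    have hNpos : (0 : ℝ) < Fintype.card V := by
      have : 0 ≤ ∑ i ∈ univ.erase j, (#(P i) : ℝ) := Finset.sum_nonneg fun i _ => Nat.cast_nonneg _
      linarith
    have hersz : (#(univ.erase j : Finset (Fin n)) : ℝ) = n - 1 := by
      rw [card_erase_of_mem (mem_univ j), Finset.card_univ, Fintype.card_fin, Nat.cast_sub (by omega)]
      simp
    have hern : (univ.erase j : Finset (Fin n)).Nonempty := by
      rw [← card_pos]
      have : (0 : ℝ) < #(univ.erase j : Finset (Fin n)) := by rw [hersz]; linarith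
      exact_mod_cast this
    obtain ⟨k, hk, hkmax⟩ := Finset.exists_max_image (univ.erase j) (fun i => #(P i)) hern
    have hb1 : ∑ i ∈ univ.erase j, (#(P i) : ℝ) ≤ (n - 1) * #(P k) := by
      rw [← hersz, ← nsmul_eq_mul]
      apply Finset.sum_le_card_nsmul
      intro i hi
      exact_mod_cast hkmax i hi
    have hb2 : (#(P k) : ℝ) ≤ ∑ i ∈ univ.erase j, (#(P i) : ℝ) :=
      Finset.single_le_sum (f := fun i => (#(P i) : ℝ)) (fun i _ => Nat.cast_nonneg _) hk
    have hkpos : (0 : ℝ) < #(P k) := by exact_mod_cast (hne k).card_pos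
    have hbd : ((edgeBdry G (P j : Set V)).ncard : ℝ) ≤ h * ∑ i ∈ univ.erase j, (#(P i) : ℝ) := by
      have h3 : (edgeBdry G (P j : Set V)).ncard ≤
          ∑ i ∈ univ.erase j, (edgeBdry G (P i : Set V)).ncard := by
        have hsub : edgeBdry G (P j : Set V) ⊆ ((univ.erase j).biUnion fun i => (edgeBdry G (P i : Set V)).toFinset : Finset (Sym2 V)) := by
          rintro e ⟨he, u, v, rfl, hu, hv⟩
          obtain ⟨i, hi⟩ := hcov v
          have hij : i ≠ j := by rintro rfl; exact hv hi
          simp only [coe_biUnion, Set.mem_iUnion, Set.coe_toFinset]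
          refine ⟨i, by simpa using hij, he, v, u, Sym2.eq_swap, hi, ?_⟩
          exact fun hui => Finset.disjoint_left.1 (hdis i j hij) hui hu
        refine (Set.ncard_le_ncard hsub (Set.toFinite _)).trans ?_
        rw [Set.ncard_coe_finset]
        refine card_biUnion_le.trans ?_
        simp [Set.ncard_eq_toFinset_card']
      have h3' : ((edgeBdry G (P j : Set V)).ncard : ℝ) ≤
          ∑ i ∈ univ.erase j, ((edgeBdry G (P i : Set V)).ncard : ℝ) := by exact_mod_cast h3
      rw [mul_sum]
      exact h3'.trans (sum_le_sum fun i _ => hP i)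
    obtain ⟨g, hg⟩ : ∃ g : Γ, (3 : ℝ) * #(P k) ≤ 4 * #(P j ∩ g • P k) := by
      by_contra hno
      push Not at hno
      have e1 : ∑ x ∈ P k, #{g : Γ | g • x ∈ P j} = ∑ g : Γ, #(P j ∩ g • P k) := by
        have e2 : ∀ g : Γ, #(P j ∩ g • P k) = #{x ∈ P k | g • x ∈ P j} := by
          intro g
          symm
          refine Finset.card_bij (fun y _ => g • y) ?_ ?_ ?_
          · intro y hy
            simp only [mem_filter, mem_inter] at hy ⊢
            exact ⟨hy.2, smul_mem_smul_finset hy.1⟩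
          · intro a _ b _ h
            exact MulAction.injective g h
          · intro b hb
            simp only [mem_inter] at hb
            refine ⟨g⁻¹ • b, ?_, by simp⟩
            simp only [mem_filter, smul_inv_smul]
            exact ⟨inv_smul_mem_iff.2 hb.2, hb.1⟩
        simp_rw [e2, card_filter]
        exact sum_comm
      have e3 : (Fintype.card V : ℝ) * ∑ g : Γ, (#(P j ∩ g • P k) : ℝ) = #(P k) * (Fintype.card Γ * #(P j)) := by
        have : Fintype.card V * ∑ g : Γ, #(P j ∩ g • P k) = #(P k) * (Fintype.card Γ * #(P j)) := by
          rw [← e1, mul_sum]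
          simp_rw [aux_count htr (P j)]
          simp
        exact_mod_cast this
      have e4 : 4 * ∑ g : Γ, (#(P j ∩ g • P k) : ℝ) ≤ Fintype.card Γ * (3 * #(P k)) := by
        rw [mul_sum, ← Finset.card_univ, ← nsmul_eq_mul]
        exact Finset.sum_le_card_nsmul _ _ _ fun g _ => (hno g).le
      have hΓ : (0 : ℝ) < Fintype.card Γ := by exact_mod_cast Fintype.card_pos
      have e5 := mul_le_mul_of_nonneg_left e4 hNpos.le
      have e6 := mul_lt_mul_of_pos_left hsmR (mul_pos hkpos hΓ)
      nlinarith
    have hgb : ((edgeBdry G ((g • P k : Finset V) : Set V)).ncard : ℝ) ≤ h * #(P k) := by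
      refine le_trans ?_ (hP k)
      exact_mod_cast aux_bdry_smul G hadj g (P k)
    have hC : (#(P j) : ℝ) ≤ #(P j \ g • P k) + #(P k) := by
      have : #(P j) ≤ #(P j \ g • P k) + #(P k) := by
        have a1 := card_inter_add_card_sdiff (P j) (g • P k)
        have a2 : #(P j ∩ g • P k) ≤ #(g • P k) := card_le_card inter_subset_right
        rw [card_smul_finset] at a2
        omega
      exact_mod_cast this
    refine aux_split G P hne hdis hcov j (g • P k) ?_ ?_ _ (fun i _ => hR1 i) ?_ ?_
    · apply card_pos.1
      have : (0 : ℝ) < #(P j ∩ g • P k) := by linarith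
      exact_mod_cast this
    · apply card_pos.1
      have : (0 : ℝ) < #(P j \ g • P k) := by linarith
      exact_mod_cast this
    · have h3 : ((edgeBdry G ((P j ∩ g • P k : Finset V) : Set V)).ncard : ℝ) ≤
          (edgeBdry G (P j : Set V)).ncard + (edgeBdry G ((g • P k : Finset V) : Set V)).ncard := by
        exact_mod_cast aux_bdry_inter G (P j) (g • P k)
      refine le_trans ?_ (mul_le_mul_of_nonneg_right (hR (4 * n / 3) (by linarith)) (by positivity))
      have h4 := mul_le_mul_of_nonneg_left hb1 h0
      have h5 := mul_le_mul_of_nonneg_left hg (by positivity : 0 ≤ n * h)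
      linarith
    · have h3 : ((edgeBdry G ((P j \ g • P k : Finset V) : Set V)).ncard : ℝ) ≤
          (edgeBdry G (P j : Set V)).ncard + (edgeBdry G ((g • P k : Finset V) : Set V)).ncard := by
        exact_mod_cast aux_bdry_sdiff G (P j) (g • P k)
      refine le_trans ?_ (mul_le_mul_of_nonneg_right (hR 2 (by linarith)) (by positivity))
      have h4 := mul_le_mul_of_nonneg_left (by linarith : ∑ i ∈ univ.erase j, (#(P i) : ℝ) + #(P k) ≤ 2 * #(P j \ g • P k)) h0
      linarith

end Aux

theorem h_multiway_lower_bound {V : Type*} [Fintype V] (G : SimpleGraph V)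
    (hconn : G.Connected) (htrans : VertexTransitive G)
    (n : ℕ) (hn : 2 ≤ n) (hcard : n + 1 ≤ Fintype.card V) :
    multiH G n ≥ multiH G (n + 1) / (10 * n + multiH G (n + 1)) := by
  classical
  haveI : Finite (G ≃g G) := Finite.of_injective (fun φ : G ≃g G => (φ : V → V)) DFunLike.coe_injective
  haveI : Fintype (G ≃g G) := Fintype.ofFinite _
  have hH0 : 0 ≤ multiH G (n + 1) := Real.sInf_nonneg (aux_bddBelow G (n + 1))
  have hnR : (2 : ℝ) ≤ n := by exact_mod_cast hn
  have hden : 0 < 10 * (n : ℝ) + multiH G (n + 1) := by linarith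
  apply le_csInf
  · let e := Fintype.equivFin V
    refine ⟨_, fun i : Fin n => {v | min (e v : ℕ) (n - 1) = i}, ⟨?_, ?_, ?_⟩, rfl⟩
    · intro i
      refine ⟨e.symm ⟨i, by omega⟩, ?_⟩
      have := i.2
      simp
      omega
    · intro i j hij
      rw [Set.disjoint_left]
      intro x hx hy
      exact hij (Fin.ext (Eq.trans (Eq.symm hx) hy))
    · rw [Set.eq_univ_iff_forall]
      intro x
      rw [Set.mem_iUnion]
      exact ⟨⟨min (e x : ℕ) (n - 1), by omega⟩, rfl⟩
  · rintro r ⟨A, hA, rfl⟩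
    have hr0 : 0 ≤ edgeRatioMax G A := aux_bddBelow G n _ ⟨A, hA, rfl⟩
    rw [div_le_iff₀ hden]
    by_cases h1 : edgeRatioMax G A < 1
    · have key := aux_main (Γ := G ≃g G) G hconn htrans (fun g x y => g.map_rel_iff) hn
        (fun i => (A i).toFinset) (fun i => by simpa using hA.1 i)
        (fun i j hij => by simpa using hA.2.1 i j hij)
        (fun x => by
          have := Set.eq_univ_iff_forall.1 hA.2.2 x
          simpa using this)
        (edgeRatioMax G A) hr0 h1
        (fun i => by
          have hp : (0 : ℝ) < (A i).ncard := by
            have := (Set.ncard_pos (Set.toFinite _)).2 (hA.1 i)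
            exact_mod_cast this
          have h2 : ((edgeBdry G (A i)).ncard : ℝ) / ((A i).ncard : ℝ) ≤ edgeRatioMax G A :=
            le_ciSup (f := fun i => ((edgeBdry G (A i)).ncard : ℝ) / ((A i).ncard : ℝ)) (Set.finite_range _).bddAbove i
          rw [div_le_iff₀ hp] at h2
          rw [← Set.ncard_eq_toFinset_card', Set.coe_toFinset]
          exact h2)
      rw [le_div_iff₀ (by linarith)] at key
      linarith
    · push Not at h1
      nlinarith

end Multiway
end

section
/- Let Γ be a finite connected vertex-transitive graph on vertex set V and let n be an integer with 2 ≤ n ≤ |V| − 1. Then ι_n(Γ) ≥ 2·ι_{n+1}(Γ) / (20n + ι_{n+1}(Γ)). -/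
open scoped Pointwise

namespace Multiway

variable {V : Type*}

section Aux
open Classical Finset

variable {W : Type*} [Fintype W]

noncomputable def bd (G : SimpleGraph W) (S : Finset W) : Finset W :=
  Finset.univ.filter (fun x => ∃ y, G.Adj x y ∧ ¬ (x ∈ S ↔ y ∈ S))

def Good (G : SimpleGraph W) (n : ℕ) (r : ℝ) (A : Fin n → Finset W) : Prop :=
  (∀ i, (A i).Nonempty) ∧ (∀ i j, i ≠ j → Disjoint (A i) (A j)) ∧ (∀ x, ∃ i, x ∈ A i) ∧
    ∀ i, ((bd G (A i)).card : ℝ) ≤ r * (A i).card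

lemma coe_bd (G : SimpleGraph W) (S : Finset W) : vertBdry G (S : Set W) = (bd G S : Set W) := by
  ext x; simp [vertBdry, bd]

lemma bd_compl (G : SimpleGraph W) (S : Finset W) : bd G Sᶜ = bd G S := by
  ext x; simp [bd, not_iff_not]

lemma bd_union (G : SimpleGraph W) (S T : Finset W) : bd G (S ∪ T) ⊆ bd G S ∪ bd G T := by
  intro x
  simp only [bd, mem_filter, mem_univ, true_and, mem_union]
  rintro ⟨y, h, h'⟩
  by_cases hs : x ∈ S ↔ y ∈ S
  · exact Or.inr ⟨y, h, by tauto⟩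
  · exact Or.inl ⟨y, h, hs⟩

lemma bd_inter (G : SimpleGraph W) (S T : Finset W) : bd G (S ∩ T) ⊆ bd G S ∪ bd G T := by
  intro x
  simp only [bd, mem_filter, mem_univ, true_and, mem_union, mem_inter]
  rintro ⟨y, h, h'⟩
  by_cases hs : x ∈ S ↔ y ∈ S
  · exact Or.inr ⟨y, h, by tauto⟩
  · exact Or.inl ⟨y, h, hs⟩

lemma bd_sdiff (G : SimpleGraph W) (S T : Finset W) : bd G (S \ T) ⊆ bd G S ∪ bd G T := by
  intro x
  simp only [bd, mem_filter, mem_univ, true_and, mem_union, mem_sdiff]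
  rintro ⟨y, h, h'⟩
  by_cases hs : x ∈ S ↔ y ∈ S
  · exact Or.inr ⟨y, h, by tauto⟩
  · exact Or.inl ⟨y, h, hs⟩

lemma good_le (G : SimpleGraph W) (n : ℕ) (hn : 0 < n) (r : ℝ) (A : Fin n → Finset W)
    (h : Good G n r A) : multiIota G n ≤ r := by
  obtain ⟨h1, h2, h3, h4⟩ := h
  haveI : Nonempty (Fin n) := ⟨⟨0, hn⟩⟩
  have hP : IsNPartition n (fun i => (A i : Set W)) := by
    refine ⟨fun i => by simpa using h1 i, fun i j hij => by simpa using h2 i j hij, ?_⟩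
    ext x; simpa using h3 x
  have hb : BddBelow {r | ∃ A : Fin n → Set W, IsNPartition n A ∧ r = vertRatioMax G A} := by
    refine ⟨0, ?_⟩
    rintro r ⟨A, -, rfl⟩
    exact Real.iSup_nonneg (fun i => by positivity)
  refine (csInf_le hb ⟨_, hP, rfl⟩).trans ?_
  refine ciSup_le fun i => ?_
  rw [coe_bd, Set.ncard_coe_finset, Set.ncard_coe_finset]
  rw [div_le_iff₀ (by exact_mod_cast (h1 i).card_pos)]
  exact h4 i

lemma iota_nonneg (G : SimpleGraph W) (n : ℕ) : 0 ≤ multiIota G n := by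
  refine Real.sInf_nonneg ?_
  rintro r ⟨A, -, rfl⟩
  exact Real.iSup_nonneg (fun i => by positivity)

lemma exists_good (G : SimpleGraph W) (n : ℕ) (hn : 0 < n) (hc : n ≤ Fintype.card W) :
    ∃ A, Good G n (multiIota G n) A := by
  haveI : Nonempty (Fin n) := ⟨⟨0, hn⟩⟩
  have hfin : {r | ∃ A : Fin n → Set W, IsNPartition n A ∧ r = vertRatioMax G A}.Finite := by
    refine (Set.finite_range (fun A : Fin n → Set W => vertRatioMax G A)).subset ?_
    rintro r ⟨A, -, rfl⟩
    exact ⟨A, rfl⟩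
  have hne : {r | ∃ A : Fin n → Set W, IsNPartition n A ∧ r = vertRatioMax G A}.Nonempty := by
    obtain ⟨f⟩ : Nonempty (Fin n ↪ W) := Function.Embedding.nonempty_of_card_le (by simpa using hc)
    have hs : Function.Surjective (Function.invFun f) := Function.invFun_surjective f.injective
    refine ⟨_, fun i => (Function.invFun f) ⁻¹' {i}, ⟨?_, ?_, ?_⟩, rfl⟩
    · intro i; obtain ⟨x, hx⟩ := hs i; exact ⟨x, hx⟩
    · intro i j hij
      rw [Set.disjoint_left]
      rintro x hx hx'
      exact hij (hx.symm.trans hx')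
    · ext x; simp
  obtain ⟨A, ⟨h1, h2, h3⟩, h4⟩ := hne.csInf_mem hfin
  change multiIota G n = _ at h4
  refine ⟨fun i => (A i).toFinset, fun i => by simpa using h1 i,
    fun i j hij => by simpa using h2 i j hij, ?_, ?_⟩
  · intro x
    have : x ∈ ⋃ i, A i := h3 ▸ Set.mem_univ x
    simpa using this
  · intro i
    have hle : ((vertBdry G (A i)).ncard : ℝ) / ((A i).ncard : ℝ) ≤ multiIota G n := by
      rw [h4]
      exact le_ciSup (f := fun i => ((vertBdry G (A i)).ncard : ℝ) / ((A i).ncard : ℝ))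
        (Set.finite_range _).bddAbove i
    have e : A i = ((A i).toFinset : Set W) := by simp
    rw [e, coe_bd, Set.ncard_coe_finset, Set.ncard_coe_finset, div_le_iff₀] at hle
    · exact hle
    · have : ((A i).toFinset).Nonempty := by simpa using h1 i
      exact_mod_cast this.card_pos

variable {K : Type*} [Group K] [Fintype K] [MulAction K W]

lemma bd_smul (G : SimpleGraph W) (ha : ∀ (g : K) x y, G.Adj (g • x) (g • y) ↔ G.Adj x y)
    (g : K) (S : Finset W) : bd G (g • S) = g • bd G S := by
  ext x
  rw [← inv_smul_mem_iff]
  simp only [bd, mem_filter, mem_univ, true_and, ← inv_smul_mem_iff (s := S)]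
  constructor
  · rintro ⟨y, h, h'⟩
    exact ⟨g⁻¹ • y, (ha _ _ _).2 h, h'⟩
  · rintro ⟨y, h, h'⟩
    refine ⟨g • y, ?_, by simpa using h'⟩
    rw [← ha g⁻¹]; simpa using h

lemma count_pt [MulAction.IsPretransitive K W] (x y : W) :
    (univ.filter (fun g : K => g • x = y)).card * Fintype.card W = Fintype.card K := by
  have h1 : ∀ z, (univ.filter (fun g : K => g • x = z)).card
      = (univ.filter (fun g : K => g • x = y)).card := by
    intro z
    obtain ⟨k, hk⟩ := MulAction.exists_smul_eq K z y
    refine Finset.card_bij (fun g _ => k * g) ?_ ?_ ?_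
    · intro g hg; simp at hg ⊢; rw [mul_smul, hg, hk]
    · intro a _ b _ h; simpa using h
    · intro b hb
      refine ⟨k⁻¹ * b, ?_, by simp⟩
      simp at hb ⊢
      rw [mul_smul, hb, ← hk]; simp
  have h2 := Finset.card_eq_sum_card_fiberwise (f := fun g : K => g • x)
    (s := univ) (t := univ) (by intro; simp)
  rw [Finset.sum_congr rfl (fun z _ => h1 z)] at h2
  simp at h2
  rw [h2, mul_comm]

lemma count_mem [MulAction.IsPretransitive K W] (x : W) (B : Finset W) :
    (univ.filter (fun g : K => g⁻¹ • x ∈ B)).card * Fintype.card W = Fintype.card K * B.card := by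
  have h2 := Finset.card_eq_sum_card_fiberwise (f := fun g : K => g⁻¹ • x)
    (s := univ.filter (fun g : K => g⁻¹ • x ∈ B)) (t := B) (by intro g hg; simpa using hg)
  rw [h2, Finset.sum_mul, Finset.sum_congr rfl (g := fun _ => Fintype.card K)]
  · simp [mul_comm]
  · intro b hb
    rw [← count_pt (K := K) b x]
    congr 2
    ext g
    simp only [mem_filter, mem_univ, true_and]
    constructor
    · rintro ⟨-, h⟩; rw [← h]; simp
    · intro h; rw [← h]; simpa using hb

lemma avg [MulAction.IsPretransitive K W] (A B : Finset W) :
    (∑ g : K, (A ∩ g • B).card) * Fintype.card W = Fintype.card K * A.card * B.card := by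
  have : ∑ g : K, (A ∩ g • B).card = ∑ x ∈ A, (univ.filter (fun g : K => g⁻¹ • x ∈ B)).card := by
    simp only [Finset.card_filter]
    rw [Finset.sum_comm]
    refine Finset.sum_congr rfl fun g _ => ?_
    rw [← Finset.card_filter]
    congr 1
    ext x; simp [← inv_smul_mem_iff]
  rw [this, Finset.sum_mul, Finset.sum_congr rfl (fun x _ => count_mem x B)]
  simp; ring

lemma Good.mono {G : SimpleGraph W} {n : ℕ} {r r' : ℝ} {A : Fin n → Finset W}
    (h : Good G n r A) (hr : r ≤ r') : Good G n r' A :=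
  ⟨h.1, h.2.1, h.2.2.1, fun i => (h.2.2.2 i).trans (by gcongr)⟩

lemma card_bd_le {G : SimpleGraph W} {S T U : Finset W} (h : bd G U ⊆ bd G S ∪ bd G T)
    {a b : ℝ} (ha : ((bd G S).card : ℝ) ≤ a) (hb : ((bd G T).card : ℝ) ≤ b) :
    ((bd G U).card : ℝ) ≤ a + b := by
  have h1 : (bd G U).card ≤ (bd G S).card + (bd G T).card :=
    (Finset.card_le_card h).trans (Finset.card_union_le _ _)
  have h2 : ((bd G U).card : ℝ) ≤ (bd G S).card + (bd G T).card := by exact_mod_cast h1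
  linarith

lemma greedy [MulAction.IsPretransitive K W] (G : SimpleGraph W)
    (ha : ∀ (g : K) x y, G.Adj (g • x) (g • y) ↔ G.Adj x y)
    (n : ℕ) (r : ℝ) (hr : 0 ≤ r) (A : Finset W)
    (hbd : ((bd G A).card : ℝ) ≤ r * A.card) (hsm : 2 * n * A.card ≤ Fintype.card W) (k : ℕ) :
    k ≤ n → ∃ (B : Fin k → Finset W) (U : Finset W),
      (∀ i j, i ≠ j → Disjoint (B i) (B j)) ∧ (∀ x, x ∈ U ↔ ∃ i, x ∈ B i) ∧
      U.card ≤ k * A.card ∧ ((bd G U).card : ℝ) ≤ k * (r * A.card) ∧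
      (∀ i, A.card ≤ 2 * (B i).card) ∧
      (∀ i, ((bd G (B i)).card : ℝ) ≤ n * (r * A.card)) := by
  induction k with
  | zero =>
    intro _
    refine ⟨fun i => i.elim0, ∅, fun i => i.elim0, by simp, by simp, by simp [bd],
      fun i => i.elim0, fun i => i.elim0⟩
  | succ k ih =>
    intro hk
    obtain ⟨B, U, h1, h2, h3, h4, h5, h6⟩ := ih (by omega)
    obtain ⟨g, hg⟩ : ∃ g : K, 2 * (U ∩ g • A).card ≤ A.card := by
      by_contra! hcon
      have hav := avg (K := K) U A
      have hs : Fintype.card K * A.card < 2 * ∑ g : K, (U ∩ g • A).card := by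
        rw [Finset.mul_sum]
        have := Finset.sum_lt_sum_of_nonempty (s := (univ : Finset K)) (univ_nonempty)
          (fun g _ => hcon g)
        simpa using this
      have hK : 0 < Fintype.card K := Fintype.card_pos
      have hW : 2 * U.card ≤ Fintype.card W := by
        have : U.card ≤ n * A.card := h3.trans (Nat.mul_le_mul_right _ (by omega))
        nlinarith
      rcases Nat.eq_zero_or_pos (Fintype.card W) with h0 | h0
      · have : IsEmpty W := Fintype.card_eq_zero_iff.1 h0
        have := hcon 1
        simp [Finset.eq_empty_of_isEmpty] at this
      · have e1 := Nat.mul_lt_mul_of_pos_right hs h0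
        have e2 : Fintype.card K * A.card * (2 * U.card) ≤
          Fintype.card K * A.card * Fintype.card W := Nat.mul_le_mul_left _ hW
        nlinarith
    have hgb : ((bd G (g • A)).card : ℝ) ≤ r * A.card := by
      rw [bd_smul G ha]; simpa using hbd
    have hkn : ((k : ℝ) + 1) ≤ n := by exact_mod_cast hk
    have hrA : 0 ≤ r * A.card := by positivity
    refine ⟨Fin.cons (g • A \ U) B, U ∪ g • A, ?_, ?_, ?_, ?_, ?_, ?_⟩
    · have hd : ∀ i, Disjoint (g • A \ U) (B i) := by
        intro i
        rw [Finset.disjoint_left]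
        intro x hx hx'
        exact (Finset.mem_sdiff.1 hx).2 ((h2 x).2 ⟨i, hx'⟩)
      intro i j
      refine Fin.cases ?_ (fun i => ?_) i <;> refine Fin.cases ?_ (fun j => ?_) j
      · simp
      · intro _; simpa using hd j
      · intro _; simpa using (hd i).symm
      · intro hij; simpa using h1 i j (by simpa using hij)
    · intro x
      rw [Fin.exists_fin_succ]
      simp only [Fin.cons_zero, Fin.cons_succ, mem_union, mem_sdiff, ← h2]
      tauto
    · have := Finset.card_union_le U (g • A)
      rw [Finset.card_smul_finset] at this
      nlinarith
    · have := card_bd_le (bd_union G U (g • A)) h4 hgb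
      push_cast; linarith
    · intro i
      refine Fin.cases ?_ (fun i => ?_) i
      · have := Finset.card_sdiff_add_card_inter (g • A) U
        rw [Finset.inter_comm, Finset.card_smul_finset] at this
        simp only [Fin.cons_zero]; omega
      · simpa using h5 i
    · intro i
      refine Fin.cases ?_ (fun i => ?_) i
      · have := card_bd_le (bd_sdiff G (g • A) U) hgb h4
        simp only [Fin.cons_zero]; nlinarith
      · simpa using h6 i

lemma small_case [MulAction.IsPretransitive K W] (G : SimpleGraph W)
    (ha : ∀ (g : K) x y, G.Adj (g • x) (g • y) ↔ G.Adj x y)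
    (n : ℕ) (hn : 0 < n) (r : ℝ) (hr : 0 ≤ r) (A : Finset W) (hA : A.Nonempty)
    (hbd : ((bd G A).card : ℝ) ≤ r * A.card) (hsm : 2 * n * A.card ≤ Fintype.card W) :
    ∃ B, Good G (n + 1) (2 * n * r) B := by
  obtain ⟨B, U, h1, h2, h3, h4, h5, h6⟩ := greedy (K := K) G ha n r hr A hbd hsm n le_rfl
  have hApos := hA.card_pos
  have hUc : A.card ≤ Uᶜ.card := by
    rw [Finset.card_compl]
    have : A.card ≤ n * A.card := Nat.le_mul_of_pos_left _ hn
    have : 2 * n * A.card = 2 * (n * A.card) := by ring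
    omega
  refine ⟨Fin.cons Uᶜ B, ?_, ?_, ?_, ?_⟩
  · intro i
    refine Fin.cases ?_ (fun i => ?_) i
    · simp only [Fin.cons_zero]; exact Finset.card_pos.1 (by omega)
    · simp only [Fin.cons_succ]; have := h5 i; exact Finset.card_pos.1 (by omega)
  · have hd : ∀ i, Disjoint Uᶜ (B i) := by
      intro i
      rw [Finset.disjoint_left]
      intro x hx hx'
      exact (Finset.mem_compl.1 hx) ((h2 x).2 ⟨i, hx'⟩)
    intro i j
    refine Fin.cases ?_ (fun i => ?_) i <;> refine Fin.cases ?_ (fun j => ?_) j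
    · simp
    · intro _; simpa using hd j
    · intro _; simpa using (hd i).symm
    · intro hij; simpa using h1 i j (by simpa using hij)
  · intro x
    rw [Fin.exists_fin_succ]
    simp only [Fin.cons_zero, Fin.cons_succ, mem_compl, ← h2]
    tauto
  · have hnr : 0 ≤ n * r := by positivity
    intro i
    refine Fin.cases ?_ (fun i => ?_) i
    · simp only [Fin.cons_zero, bd_compl]
      have : (A.card : ℝ) ≤ Uᶜ.card := by exact_mod_cast hUc
      have h0 : (0 : ℝ) ≤ A.card := by positivity
      nlinarith
    · simp only [Fin.cons_succ]
      have : (A.card : ℝ) ≤ 2 * (B i).card := by exact_mod_cast h5 i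
      have := h6 i
      nlinarith

lemma cut_case (G : SimpleGraph W) (n : ℕ) (r s : ℝ) (hrs : r ≤ s) (A : Fin n → Finset W)
    (h : Good G n r A) (i : Fin n) (X : Finset W)
    (hS : (A i ∩ X).Nonempty) (hT : (A i \ X).Nonempty)
    (hbS : ((bd G (A i ∩ X)).card : ℝ) ≤ s * (A i ∩ X).card)
    (hbT : ((bd G (A i \ X)).card : ℝ) ≤ s * (A i \ X).card) :
    ∃ B, Good G (n + 1) s B := by
  obtain ⟨h1, h2, h3, h4⟩ := h.mono hrs
  refine ⟨Fin.cons (A i \ X) (Function.update A i (A i ∩ X)), ?_, ?_, ?_, ?_⟩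
  · intro j
    refine Fin.cases ?_ (fun j => ?_) j
    · simpa only [Fin.cons_zero]
    · simp only [Fin.cons_succ]
      rcases eq_or_ne j i with rfl | hj
      · simpa only [Function.update_self]
      · simpa only [Function.update_of_ne hj] using h1 j
  · have hd : ∀ j, Disjoint (A i \ X) (Function.update A i (A i ∩ X) j) := by
      intro j
      rcases eq_or_ne j i with rfl | hj
      · simp only [Function.update_self]; exact Finset.disjoint_sdiff_inter _ _
      · simp only [Function.update_of_ne hj]
        exact (h2 i j hj.symm).mono_left Finset.sdiff_subset
    intro j k
    refine Fin.cases ?_ (fun j => ?_) j <;> refine Fin.cases ?_ (fun k => ?_) k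
    · simp
    · intro _; simpa using hd k
    · intro _; simpa using (hd j).symm
    · intro hjk
      have hjk : j ≠ k := by simpa using hjk
      simp only [Fin.cons_succ]
      have hsub : ∀ j, Function.update A i (A i ∩ X) j ⊆ A j := by
        intro j
        rcases eq_or_ne j i with rfl | hj
        · simp
        · simp [Function.update_of_ne hj]
      exact (h2 j k hjk).mono (hsub j) (hsub k)
  · intro x
    rw [Fin.exists_fin_succ]
    simp only [Fin.cons_zero, Fin.cons_succ]
    obtain ⟨j, hj⟩ := h3 x
    rcases eq_or_ne j i with rfl | hji
    · by_cases hx : x ∈ X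
      · right; exact ⟨j, by simp [hj, hx]⟩
      · left; simp [hj, hx]
    · right; exact ⟨j, by simpa [Function.update_of_ne hji] using hj⟩
  · intro j
    refine Fin.cases ?_ (fun j => ?_) j
    · simpa only [Fin.cons_zero]
    · simp only [Fin.cons_succ]
      rcases eq_or_ne j i with rfl | hj
      · simpa only [Function.update_self]
      · simpa only [Function.update_of_ne hj] using h4 j

lemma beta_bound (G : SimpleGraph W) (n : ℕ) (r : ℝ) (A : Fin n → Finset W)
    (h : Good G n r A) (p : W → Fin n) (hp : ∀ x, x ∈ A (p x)) :
    2 * ((univ.filter (fun v => ∃ w, G.Adj v w ∧ p v ≠ p w)).card : ℝ) ≤ r * Fintype.card W := by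
  obtain ⟨h1, h2, h3, h4⟩ := h
  have hu : ∀ x i, x ∈ A i ↔ p x = i := by
    intro x i
    constructor
    · intro hx
      by_contra hne
      exact Finset.disjoint_left.1 (h2 _ _ hne) (hp x) hx
    · rintro rfl; exact hp x
  have hsum : ∑ i, (A i).card = Fintype.card W := by
    rw [← Finset.card_univ, Finset.card_eq_sum_card_fiberwise (f := p) (s := univ) (t := univ)
      (by intro; simp)]
    refine Finset.sum_congr rfl fun i _ => ?_
    congr 1; ext x; simp [hu]
  have hle : 2 * (univ.filter (fun v => ∃ w, G.Adj v w ∧ p v ≠ p w)).card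
      ≤ ∑ i, (bd G (A i)).card := by
    have e : ∑ i, (bd G (A i)).card = ∑ x, (univ.filter (fun i => x ∈ bd G (A i))).card := by
      simp only [Finset.card_filter]
      rw [Finset.sum_comm]
      refine Finset.sum_congr rfl fun i _ => ?_
      rw [← Finset.card_filter]; simp
    rw [e, Finset.card_filter, Finset.mul_sum]
    refine Finset.sum_le_sum fun x _ => ?_
    split_ifs with hx
    · obtain ⟨w, hw, hne⟩ := hx
      have : ({p x, p w} : Finset (Fin n)) ⊆ univ.filter (fun i => x ∈ bd G (A i)) := by
        intro i hi
        simp only [mem_insert, mem_singleton] at hi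
        simp only [bd, mem_filter, mem_univ, true_and, hu]
        refine ⟨w, hw, ?_⟩
        rcases hi with rfl | rfl
        · simpa using hne.symm
        · simpa using hne
      have := Finset.card_le_card this
      rwa [Finset.card_pair hne] at this
    · simp
  have hle' : 2 * ((univ.filter (fun v => ∃ w, G.Adj v w ∧ p v ≠ p w)).card : ℝ)
      ≤ ∑ i, ((bd G (A i)).card : ℝ) := by exact_mod_cast hle
  refine hle'.trans ((Finset.sum_le_sum fun i _ => h4 i).trans ?_)
  rw [← Finset.mul_sum, ← hsum]; push_cast; rfl

lemma big_case [MulAction.IsPretransitive K W] (G : SimpleGraph W) (hconn : G.Connected)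
    (n : ℕ) (hn : 2 ≤ n) (r : ℝ) (hr : 0 ≤ r) (hr2 : r < 2) (A : Fin n → Finset W)
    (ha : ∀ (g : K) x y, G.Adj (g • x) (g • y) ↔ G.Adj x y)
    (h : Good G n r A) (i : Fin n) (hmax : ∀ j, (A j).card ≤ (A i).card)
    (ε : ℝ) (hε : ε = (2 - r) / (10 * n))
    (hcut : ∀ (g : K) j, ε * (A i).card ≤ ((A i ∩ g • A j).card : ℝ) →
      ((A i \ g • A j).card : ℝ) < ε * (A i).card) :
    (1 - ε) * Fintype.card W ≤ (A i).card := by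
  have hn0 : (2 : ℝ) ≤ n := by exact_mod_cast hn
  have hεn : n * ε = (2 - r) / 10 := by rw [hε]; field_simp
  have hεpos : 0 < ε := by rw [hε]; apply div_pos <;> linarith
  have hε2 : 2 * ε ≤ (2 - r) / 10 := by rw [← hεn]; gcongr
  have hMpos : (0 : ℝ) < (A i).card := by exact_mod_cast (h.1 i).card_pos
  have hKpos : (0 : ℝ) < Fintype.card K := by exact_mod_cast Fintype.card_pos
  set M : ℝ := ((A i).card : ℝ) with hM
  have hεM : 0 < ε * M := by positivity
  choose p hp using h.2.2.1
  have hu : ∀ x i, x ∈ A i → p x = i := by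
    intro x i hx
    by_contra hne
    exact Finset.disjoint_left.1 (h.2.1 _ _ hne) (hp x) hx
  have split : ∀ S T : Finset W, ((S \ T).card : ℝ) + (S ∩ T).card = S.card := by
    intro S T; exact_mod_cast Finset.card_sdiff_add_card_inter S T
  have hj : ∀ g : K, ∃ j, ((A i \ g • A j).card : ℝ) < ε * M := by
    intro g
    by_contra! hcon
    have h1 : ∀ j, ((A i ∩ g • A j).card : ℝ) ≤ ε * M := by
      intro j
      by_contra! hc
      exact absurd (hcut g j hc.le) (not_lt.2 (hcon j))
    have h2 : (A i).card ≤ ∑ j, (A i ∩ g • A j).card := by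
      refine (Finset.card_le_card ?_).trans Finset.card_biUnion_le
      intro x hx
      simp only [mem_biUnion, mem_univ, true_and, mem_inter]
      exact ⟨p (g⁻¹ • x), hx, by rw [← inv_smul_mem_iff]; exact hp _⟩
    have h3 : M ≤ ∑ j, ((A i ∩ g • A j).card : ℝ) := by rw [hM]; exact_mod_cast h2
    have h4 := h3.trans (Finset.sum_le_sum fun j _ => h1 j)
    simp only [sum_const, card_univ, Fintype.card_fin, nsmul_eq_mul] at h4
    rw [← mul_assoc, hεn] at h4
    nlinarith
  choose j hj using hj
  obtain ⟨x0, hx0, hS⟩ : ∃ x ∈ A i, (1 - ε) * Fintype.card K ≤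
      ((univ.filter (fun g : K => x ∈ g • A (j g))).card : ℝ) := by
    by_contra! hcon
    have h1 := Finset.sum_lt_sum_of_nonempty (h.1 i) hcon
    have h2 : ∑ x ∈ A i, (univ.filter (fun g : K => x ∈ g • A (j g))).card
        = ∑ g : K, (A i ∩ g • A (j g)).card := by
      simp only [Finset.card_filter]
      rw [Finset.sum_comm]
      refine Finset.sum_congr rfl fun g _ => ?_
      rw [← Finset.card_filter, Finset.filter_mem_eq_inter]
    have h2' : ∑ x ∈ A i, ((univ.filter (fun g : K => x ∈ g • A (j g))).card : ℝ)
        = ∑ g : K, ((A i ∩ g • A (j g)).card : ℝ) := by exact_mod_cast h2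
    have h3 : ∑ g : K, ((1 - ε) * M) ≤ ∑ g : K, ((A i ∩ g • A (j g)).card : ℝ) := by
      refine Finset.sum_le_sum fun g _ => ?_
      have := split (A i) (g • A (j g))
      have := hj g
      linarith
    rw [h2'] at h1
    simp only [sum_const, card_univ, nsmul_eq_mul] at h1 h3
    nlinarith
  have cs : ∀ (g : K) (S : Finset W), ((g • S).card : ℝ) = S.card := by
    intro g S; rw [Finset.card_smul_finset]
  have L : ∀ (k k' : K) (X : Finset W), ((k • A i \ X).card : ℝ) < ε * M →
      ((k' • A i \ X).card : ℝ) < ε * M → (X.card : ℝ) ≤ M →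
      ((k • A i \ k' • A i).card : ℝ) < ε * M := by
    intro k k' X h1 h2 h3
    have e1 := split (k • A i) X
    have e2 := split (k' • A i) X
    rw [cs] at e1 e2
    have e3 : (k • A i ∩ X).card + (k' • A i ∩ X).card ≤ X.card + (k • A i ∩ k' • A i).card := by
      rw [← Finset.card_union_add_card_inter]
      refine Nat.add_le_add (Finset.card_le_card ?_) (Finset.card_le_card ?_)
      · intro x; simp only [mem_union, mem_inter]; tauto
      · intro x; simp only [mem_inter]; tauto
    have e3' : ((k • A i ∩ X).card : ℝ) + (k' • A i ∩ X).card
      ≤ X.card + (k • A i ∩ k' • A i).card := by exact_mod_cast e3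
    have e4 : k • (A i ∩ (k⁻¹ * k') • A i) = k • A i ∩ k' • A i := by
      rw [Finset.smul_finset_inter, smul_smul]; simp
    have e5 : k • (A i \ (k⁻¹ * k') • A i) = k • A i \ k' • A i := by
      rw [Finset.smul_finset_sdiff, smul_smul]; simp
    rw [← e5, cs]
    refine hcut _ _ ?_
    rw [← cs k, e4]
    nlinarith
  have E : ∀ k k' : K, (k • x0 = k' • x0 ∨ G.Adj (k • x0) (k' • x0)) →
      ((k • A i \ k' • A i).card : ℝ) < ε * M := by
    intro k k' hadj
    have hc : ∀ k : K, ((univ.filter (fun g : K => ¬ k • x0 ∈ g • A (j (k⁻¹ * g)))).card : ℝ)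
        ≤ ε * Fintype.card K := by
      intro k
      have h1 : (univ.filter (fun g : K => k • x0 ∈ g • A (j (k⁻¹ * g)))).card
          = (univ.filter (fun g : K => x0 ∈ g • A (j g))).card := by
        refine Finset.card_bij (fun g _ => k⁻¹ * g) ?_ ?_ ?_
        · intro g hg
          simp only [mem_filter, mem_univ, true_and] at hg ⊢
          rw [mul_smul, Finset.mem_inv_smul_finset_iff]; exact hg
        · intro a _ b _ hab; simpa using hab
        · intro b hb
          refine ⟨k * b, ?_, by simp⟩
          simp only [mem_filter, mem_univ, true_and] at hb ⊢
          rw [mul_smul, Finset.smul_mem_smul_finset_iff]; simpa using hb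
      have h2 := Finset.card_filter_add_card_filter_not (s := (univ : Finset K))
        (fun g : K => k • x0 ∈ g • A (j (k⁻¹ * g)))
      rw [h1, Finset.card_univ] at h2
      have h2' : ((univ.filter (fun g : K => x0 ∈ g • A (j g))).card : ℝ) +
        (univ.filter (fun g : K => ¬ k • x0 ∈ g • A (j (k⁻¹ * g)))).card = Fintype.card K := by
        exact_mod_cast h2
      linarith
    have hT : ((univ.filter (fun g : K => p (g⁻¹ • k • x0) ≠ p (g⁻¹ • k' • x0))).card : ℝ)
        ≤ r / 2 * Fintype.card K := by
      rcases hadj with heq | hadj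
      · simp only [heq, ne_eq, not_true_eq_false, filter_false, card_empty, Nat.cast_zero]
        positivity
      · have b1 := beta_bound G n r A h p hp
        have b2 := count_mem (K := K) (k • x0)
          (univ.filter (fun v => ∃ w, G.Adj v w ∧ p v ≠ p w))
        have b3 : (univ.filter (fun g : K => p (g⁻¹ • k • x0) ≠ p (g⁻¹ • k' • x0))).card ≤
            (univ.filter (fun g : K => g⁻¹ • k • x0 ∈
              (univ.filter (fun v => ∃ w, G.Adj v w ∧ p v ≠ p w)))).card := by
          refine Finset.card_le_card ?_
          intro g hg
          simp only [mem_filter, mem_univ, true_and] at hg ⊢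
          exact ⟨_, (ha _ _ _).2 hadj, hg⟩
        have hW : (0 : ℝ) < Fintype.card W := by
          exact_mod_cast Fintype.card_pos_iff.2 ⟨x0⟩
        generalize (univ.filter (fun v => ∃ w, G.Adj v w ∧ p v ≠ p w)) = Bs at b1 b2 b3
        have b2' : ((univ.filter (fun g : K => g⁻¹ • k • x0 ∈ Bs)).card : ℝ) * Fintype.card W
          = Fintype.card K * Bs.card := by exact_mod_cast b2
        have b3' : ((univ.filter (fun g : K => p (g⁻¹ • k • x0) ≠ p (g⁻¹ • k' • x0))).card : ℝ)
          ≤ (univ.filter (fun g : K => g⁻¹ • k • x0 ∈ Bs)).card := by exact_mod_cast b3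
        refine b3'.trans ?_
        refine le_of_mul_le_mul_right ?_ hW
        rw [b2']
        nlinarith
    obtain ⟨g, g1, g2, g3⟩ : ∃ g : K, k • x0 ∈ g • A (j (k⁻¹ * g)) ∧
        k' • x0 ∈ g • A (j (k'⁻¹ * g)) ∧ p (g⁻¹ • k • x0) = p (g⁻¹ • k' • x0) := by
      by_contra! hcon
      have hcov : (univ : Finset K) ⊆
          (univ.filter (fun g : K => ¬ k • x0 ∈ g • A (j (k⁻¹ * g)))) ∪
          ((univ.filter (fun g : K => ¬ k' • x0 ∈ g • A (j (k'⁻¹ * g)))) ∪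
          (univ.filter (fun g : K => p (g⁻¹ • k • x0) ≠ p (g⁻¹ • k' • x0)))) := by
        intro g _
        have := hcon g
        simp only [mem_union, mem_filter, mem_univ, true_and]
        tauto
      have c1 := (Finset.card_le_card hcov).trans ((Finset.card_union_le _ _).trans
        (Nat.add_le_add_left (Finset.card_union_le _ _) _))
      rw [Finset.card_univ] at c1
      have c2 : (Fintype.card K : ℝ) ≤
          (univ.filter (fun g : K => ¬ k • x0 ∈ g • A (j (k⁻¹ * g)))).card +
          ((univ.filter (fun g : K => ¬ k' • x0 ∈ g • A (j (k'⁻¹ * g)))).card +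
          (univ.filter (fun g : K => p (g⁻¹ • k • x0) ≠ p (g⁻¹ • k' • x0))).card) := by
        exact_mod_cast c1
      have := hc k
      have := hc k'
      nlinarith
    have q1 := hu _ _ ((inv_smul_mem_iff).2 g1)
    have q2 := hu _ _ ((inv_smul_mem_iff).2 g2)
    have q : j (k⁻¹ * g) = j (k'⁻¹ * g) := by rw [← q1, ← q2, g3]
    have key : ∀ k : K, ((k • A i \ g • A (j (k⁻¹ * g))).card : ℝ) < ε * M := by
      intro k
      have := hj (k⁻¹ * g)
      rw [← cs k, Finset.smul_finset_sdiff, smul_smul] at this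
      simpa using this
    refine L k k' (g • A (j (k⁻¹ * g))) (key k) ?_ ?_
    · rw [q]; exact key k'
    · rw [cs, hM]; exact_mod_cast hmax _
  have all : ∀ v, ∀ k : K, k • x0 = v → ((k • A i \ A i).card : ℝ) < ε * M := by
    intro v
    have hreach := (SimpleGraph.reachable_iff_reflTransGen x0 v).1 (hconn.preconnected x0 v)
    induction hreach with
    | refl =>
      intro k hk
      simpa using E k 1 (Or.inl (by simpa using hk))
    | tail _ hadj ih =>
      rename_i b c _
      intro k hk
      obtain ⟨k', hk'⟩ := MulAction.exists_smul_eq K x0 b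
      have h1 := E k' k (Or.inr (by rw [hk, hk']; exact hadj))
      have h2 := ih k' hk'
      have h3 := E k k' (Or.inr (by rw [hk, hk']; exact hadj.symm))
      have h4 : ((A i \ k' • A i).card : ℝ) < ε * M := by
        have s1 := split (A i) (k' • A i)
        have s2 := split (k' • A i) (A i)
        rw [Finset.inter_comm, cs] at s2
        linarith
      have := L k 1 (k' • A i) h3 (by simpa using h4) (by rw [cs])
      simpa using this
  have hav := avg (K := K) (A i) (A i)
  have hav' : (∑ g : K, ((A i ∩ g • A i).card : ℝ)) * Fintype.card W = Fintype.card K * M * M := by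
    rw [hM]; exact_mod_cast hav
  have hlow : ∑ g : K, ((1 - ε) * M) ≤ ∑ g : K, ((A i ∩ g • A i).card : ℝ) := by
    refine Finset.sum_le_sum fun g _ => ?_
    have s2 := split (g • A i) (A i)
    rw [Finset.inter_comm, cs] at s2
    have := all _ g rfl
    linarith
  simp only [sum_const, card_univ, nsmul_eq_mul] at hlow
  have hW : (0 : ℝ) ≤ Fintype.card W := by positivity
  have := mul_le_mul_of_nonneg_right hlow hW
  rw [hav'] at this
  have hKM : 0 < Fintype.card K * M := by positivity
  refine le_of_mul_le_mul_left ?_ hKM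
  linarith

lemma main_step [MulAction.IsPretransitive K W] (G : SimpleGraph W) (hconn : G.Connected)
    (n : ℕ) (hn : 2 ≤ n) (r : ℝ) (hr : 0 ≤ r) (hr2 : r < 2) (A : Fin n → Finset W)
    (ha : ∀ (g : K) x y, G.Adj (g • x) (g • y) ↔ G.Adj x y)
    (h : Good G n r A) : ∃ B, Good G (n + 1) (20 * n * r / (2 - r)) B := by
  have hn0 : (2 : ℝ) ≤ n := by exact_mod_cast hn
  have h2r : 0 < 2 - r := by linarith
  have hs : 2 * n * r ≤ 20 * n * r / (2 - r) := by
    rw [le_div_iff₀ h2r]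
    have : 0 ≤ n * r := by positivity
    nlinarith
  have hs1 : r ≤ 20 * n * r / (2 - r) := by nlinarith
  by_cases hsm : ∃ j, 2 * n * (A j).card ≤ Fintype.card W
  · obtain ⟨j, hj⟩ := hsm
    obtain ⟨B, hB⟩ := small_case (K := K) G ha n (by omega) r hr (A j) (h.1 j) (h.2.2.2 j) hj
    exact ⟨B, hB.mono hs⟩
  have : Nonempty (Fin n) := ⟨⟨0, by omega⟩⟩
  obtain ⟨i, hi⟩ := Finite.exists_max (fun j => (A j).card)
  have hMpos : (0 : ℝ) < (A i).card := by exact_mod_cast (h.1 i).card_pos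
  obtain ⟨ε, hε⟩ : ∃ ε : ℝ, ε = (2 - r) / (10 * n) := ⟨_, rfl⟩
  have hεpos : 0 < ε := by rw [hε]; apply div_pos <;> linarith
  have hεs : 20 * n * r / (2 - r) * ε = 2 * r := by 
    have hne := h2r.ne'
    rw [hε]; field_simp; ring
  have hspos : 0 ≤ 20 * n * r / (2 - r) := by positivity
  by_cases hcut : ∀ (g : K) j, ε * (A i).card ≤ ((A i ∩ g • A j).card : ℝ) →
      ((A i \ g • A j).card : ℝ) < ε * (A i).card
  · exfalso
    have hb := big_case (K := K) G hconn n hn r hr hr2 A ha h i hi ε hε hcut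
    apply hsm
    have : Nontrivial (Fin n) := Fin.nontrivial_iff_two_le.2 hn
    obtain ⟨j, hj⟩ := exists_ne i
    refine ⟨j, ?_⟩
    have hd := Finset.card_union_of_disjoint (h.2.1 j i hj)
    have hle := Finset.card_le_univ (A j ∪ A i)
    rw [hd] at hle
    have hle' : ((A j).card : ℝ) + (A i).card ≤ Fintype.card W := by exact_mod_cast hle
    have h3 : ((A j).card : ℝ) ≤ ε * Fintype.card W := by linarith
    have h4 : 2 * n * ε ≤ 1 := by
      have : n * ε = (2 - r) / 10 := by rw [hε]; field_simp
      linarith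
    have h5 : (2 * n * (A j).card : ℝ) ≤ Fintype.card W := by
      have hW : (0 : ℝ) ≤ Fintype.card W := by positivity
      calc (2 * n * (A j).card : ℝ) ≤ 2 * n * (ε * Fintype.card W) := by gcongr
        _ = (2 * n * ε) * Fintype.card W := by ring
        _ ≤ 1 * Fintype.card W := by gcongr
        _ = _ := one_mul _
    exact_mod_cast h5
  · push Not at hcut
    obtain ⟨g, j, h1, h2⟩ := hcut
    have hεM : 0 < ε * (A i).card := by positivity
    have hbj : ((bd G (g • A j)).card : ℝ) ≤ r * (A i).card := by
      rw [bd_smul G ha, Finset.card_smul_finset]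
      refine (h.2.2.2 j).trans ?_
      have : ((A j).card : ℝ) ≤ (A i).card := by exact_mod_cast hi j
      gcongr
    have fin : ∀ c : ℝ, ε * (A i).card ≤ c →
        r * (A i).card + r * (A i).card ≤ 20 * n * r / (2 - r) * c := by
      intro c hc
      have := mul_le_mul_of_nonneg_left hc hspos
      rw [← mul_assoc, hεs] at this
      linarith
    refine cut_case G n r _ hs1 A h i (g • A j) ?_ ?_ ?_ ?_
    · rw [← Finset.card_pos]; exact_mod_cast hεM.trans_le h1
    · rw [← Finset.card_pos]; exact_mod_cast hεM.trans_le h2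
    · exact (card_bd_le (bd_inter G _ _) (h.2.2.2 i) hbj).trans (fin _ h1)
    · exact (card_bd_le (bd_sdiff G _ _) (h.2.2.2 i) hbj).trans (fin _ h2)

end Aux

theorem iota_multiway_lower_bound {V : Type*} [Fintype V] (G : SimpleGraph V)
    (hconn : G.Connected) (htrans : VertexTransitive G)
    (n : ℕ) (hn : 2 ≤ n) (hcard : n + 1 ≤ Fintype.card V) :
    multiIota G n ≥ 2 * multiIota G (n + 1) / (20 * n + multiIota G (n + 1)) := by
  have hy := iota_nonneg G (n + 1)
  have hx := iota_nonneg G n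
  have hn0 : (2 : ℝ) ≤ n := by exact_mod_cast hn
  rw [ge_iff_le, div_le_iff₀ (by linarith)]
  rcases le_or_gt 2 (multiIota G n) with h2 | h2
  · nlinarith
  · have hf : Finite (G ≃g G) := DFunLike.finite (G ≃g G)
    have : Fintype (G ≃g G) := Fintype.ofFinite _
    letI : MulAction (G ≃g G) V :=
      { smul := fun g x => g x
        one_smul := fun _ => rfl
        mul_smul := fun _ _ _ => rfl }
    have hpt : MulAction.IsPretransitive (G ≃g G) V := ⟨fun x y => htrans x y⟩
    obtain ⟨A, hA⟩ := exists_good G n (by omega) (by omega)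
    obtain ⟨B, hB⟩ := main_step (K := G ≃g G) G hconn n hn _ hx h2 A
      (fun g x y => g.map_rel_iff) hA
    have := good_le G (n + 1) (by omega) _ B hB
    rw [le_div_iff₀ (by linarith)] at this
    linarith

end Multiway
end

section
/- Let Γ be a finite connected vertex-transitive graph on vertex set V and let n be an integer with 2 ≤ n ≤ |V| − 1. Then ι_{n+1}(Γ) ≤ (11n + 1)·ι_n(Γ). -/
open scoped Pointwise

namespace Multiway

variable {V : Type*}

section act
variable {V M : Type*} [Fintype V] [DecidableEq V] [Group M] [Fintype M] [MulAction M V] [MulAction.IsPretransitive M V]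

open Finset in
theorem exists_c [Nonempty V] : ∃ c : ℕ, 0 < c ∧ (∀ x y : V, #{g : M | g • x = y} = c) := by
  classical
  obtain ⟨x0⟩ := ‹Nonempty V›
  refine ⟨#{g : M | g • x0 = x0}, card_pos.2 ⟨1, by simp⟩, fun x y => ?_⟩
  obtain ⟨a, ha⟩ := MulAction.exists_smul_eq M x0 x
  obtain ⟨b, hb⟩ := MulAction.exists_smul_eq M y x0
  refine card_bij' (fun g _ => b * g * a) (fun g _ => b⁻¹ * g * a⁻¹) ?_ ?_ ?_ ?_
  · intro g hg
    simp only [mem_filter, mem_univ, true_and] at hg ⊢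
    rw [mul_smul, mul_smul, ha, hg, hb]
  · intro g hg
    simp only [mem_filter, mem_univ, true_and] at hg ⊢
    rw [mul_smul, mul_smul, ← ha, inv_smul_smul, hg, inv_smul_eq_iff, hb]
  · intro g _; group
  · intro g _; group

open Finset in
theorem count_mem_s2 {c : ℕ} (hc : ∀ x y : V, #{g : M | g • x = y} = c) (x : V) (X : Finset V) :
    #{g : M | g • x ∈ X} = c * #X := by
  classical
  rw [card_eq_sum_card_fiberwise (f := fun g : M => g • x) (t := X)]
  · rw [sum_congr rfl (g := fun _ => c), sum_const, smul_eq_mul, mul_comm]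
    intro y hy
    rw [← hc x y, filter_filter]
    congr 1
    ext g
    simp only [mem_filter, mem_univ, true_and]
    constructor
    · exact fun h => h.2
    · rintro rfl; exact ⟨hy, rfl⟩
  · intro g hg; simpa using hg

open Finset in
theorem card_M {c : ℕ} [Nonempty V] (hc : ∀ x y : V, #{g : M | g • x = y} = c) :
    Fintype.card M = c * Fintype.card V := by
  have := count_mem_s2 hc (Classical.arbitrary V) univ
  simpa using this

open Finset in
theorem card_trans (g : M) (X : Finset V) : #{x : V | g • x ∈ X} = #X := by
  refine card_bij' (fun x _ => g • x) (fun x _ => g⁻¹ • x) ?_ ?_ ?_ ?_ <;> simp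

open Finset in
theorem sum_inter {c : ℕ} (hc : ∀ x y : V, #{g : M | g • x = y} = c) (A B : Finset V) :
    ∑ g : M, #{x ∈ B | g • x ∈ A} = c * #A * #B := by
  simp_rw [card_filter]
  rw [sum_comm]
  simp_rw [← card_filter, count_mem_s2 hc]
  rw [sum_const, smul_eq_mul, mul_comm]

open Finset in
/-- number of close-to-disjoint pairs at a vertex -/
theorem pair_bound {c : ℕ} [Nonempty V] (hc0 : 0 < c) (hc : ∀ x y : V, #{g : M | g • x = y} = c) (A : Finset V)
    (τ : ℝ) (hτ : 0 ≤ τ) (x : V) :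
    (#{p : M × M | (p.1 • x ∈ A ∧ p.2 • x ∈ A) ∧ (#{v : V | p.1 • v ∈ A ∧ p.2 • v ∈ A} : ℝ) ≤ τ} : ℝ)
      ≤ c ^ 2 * Fintype.card V * τ := by
  classical
  set Nn : Finset (M × M) := {p : M × M | (#{v : V | p.1 • v ∈ A ∧ p.2 • v ∈ A} : ℝ) ≤ τ} with hN
  have h1 : ∀ y : V, #{p ∈ Nn | p.1 • y ∈ A ∧ p.2 • y ∈ A} = #{p ∈ Nn | p.1 • x ∈ A ∧ p.2 • x ∈ A} := by
    intro y
    obtain ⟨a, ha⟩ := MulAction.exists_smul_eq M x y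
    have key : ∀ (p q k : M), #{v : V | (p * k) • v ∈ A ∧ (q * k) • v ∈ A} = #{v : V | p • v ∈ A ∧ q • v ∈ A} := by
      intro p q k
      have := card_trans k ({v : V | p • v ∈ A ∧ q • v ∈ A} : Finset V)
      rw [← this]
      congr 1
      ext v
      simp [mul_smul]
    refine card_bij' (fun p _ => (p.1 * a, p.2 * a)) (fun p _ => (p.1 * a⁻¹, p.2 * a⁻¹)) ?_ ?_ ?_ ?_
    · rintro ⟨p, q⟩ h
      simp only [hN, mem_filter, mem_univ, true_and] at h ⊢
      rw [key, mul_smul, mul_smul, ha]; exact h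
    · rintro ⟨p, q⟩ h
      simp only [hN, mem_filter, mem_univ, true_and] at h ⊢
      rw [key, mul_smul, mul_smul, ← ha, inv_smul_smul]; exact h
    · rintro ⟨p, q⟩ h; simp
    · rintro ⟨p, q⟩ h; simp
  have h2 : ∑ y : V, #{p ∈ Nn | p.1 • y ∈ A ∧ p.2 • y ∈ A} = ∑ p ∈ Nn, #{v : V | p.1 • v ∈ A ∧ p.2 • v ∈ A} := by
    simp_rw [card_filter]; rw [sum_comm]
  rw [sum_congr rfl (fun y _ => h1 y), sum_const, smul_eq_mul, card_univ] at h2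
  have h3 : (∑ p ∈ Nn, (#{v : V | p.1 • v ∈ A ∧ p.2 • v ∈ A} : ℝ)) ≤ #Nn * τ := by
    rw [← nsmul_eq_mul]
    apply sum_le_card_nsmul
    intro p hp
    simpa [hN] using hp
  have h4 : (#Nn : ℝ) ≤ (c * Fintype.card V) ^ 2 := by
    have : #Nn ≤ Fintype.card (M × M) := card_le_univ _
    rw [Fintype.card_prod, card_M hc] at this
    rw [pow_two]; exact_mod_cast this
  have h5 : (Fintype.card V : ℝ) * #{p ∈ Nn | p.1 • x ∈ A ∧ p.2 • x ∈ A} ≤ (c * Fintype.card V) ^ 2 * τ := by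
    have : (Fintype.card V : ℝ) * #{p ∈ Nn | p.1 • x ∈ A ∧ p.2 • x ∈ A} = (∑ p ∈ Nn, (#{v : V | p.1 • v ∈ A ∧ p.2 • v ∈ A} : ℝ)) := by exact_mod_cast h2
    rw [this]
    exact h3.trans (mul_le_mul_of_nonneg_right h4 hτ)
  have h6 : ({p : M × M | (p.1 • x ∈ A ∧ p.2 • x ∈ A) ∧ (#{v : V | p.1 • v ∈ A ∧ p.2 • v ∈ A} : ℝ) ≤ τ} : Finset (M × M)) = {p ∈ Nn | p.1 • x ∈ A ∧ p.2 • x ∈ A} := by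
    ext p; simp only [hN, mem_filter, mem_univ, true_and]; tauto
  rw [h6]
  have hV : (0 : ℝ) < Fintype.card V := by exact_mod_cast Fintype.card_pos
  refine le_of_mul_le_mul_left (h5.trans (le_of_eq ?_)) hV
  ring

theorem const_of_adj {W : Type*} {G : SimpleGraph W} (hG : G.Connected) (P : W → Prop) (h : ∀ x y, G.Adj x y → P x → P y)
    (x y : W) (hx : P x) : P y := by
  obtain ⟨w⟩ := hG.preconnected x y
  induction w with
  | nil => exact hx
  | cons hadj _ ih => exact ih (h _ _ hadj hx)

set_option maxHeartbeats 2000000 in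
open Finset in
theorem key_false (G : SimpleGraph V) (hG : G.Connected)
    (hadj : ∀ (g : M) (x y : V), G.Adj x y → G.Adj (g • x) (g • y))
    (A B D : Finset V) (n : ℕ) (hn : 2 ≤ n) (t : ℝ) (ht : t = 2 / (11 * n + 1))
    (hdich : ∀ g : M, (#{x ∈ B | g • x ∈ A} : ℝ) < t * #B ∨ (1 - t) * #B < (#{x ∈ B | g • x ∈ A} : ℝ))
    (hab : #A ≤ #B) (hba : #B < 2 * #A) (hNb : Fintype.card V ≤ n * #B) (hNa : n * #A ≤ Fintype.card V)
    (hD : ∀ x y, G.Adj x y → x ∈ A → y ∉ A → x ∈ D ∧ y ∈ D) (hDc : (#D : ℝ) ≤ 5 / 23 * #A) : False := by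
  classical
  have : Nonempty V := hG.nonempty
  obtain ⟨c, hc0, hc⟩ := exists_c (V := V) (M := M)
  set m : M → ℕ := fun g => #{x ∈ B | g • x ∈ A} with hm
  set H : Finset M := {g : M | (1 - t) * #B < (m g : ℝ)} with hH
  set s : V → ℕ := fun x => #{g ∈ H | g • x ∈ A} with hs
  have hn' : (2 : ℝ) ≤ n := by exact_mod_cast hn
  have hden : (0 : ℝ) < 11 * n + 1 := by linarith
  have ht0 : 0 < t := by rw [ht]; positivity
  have ht1 : t ≤ 2 / 23 := by
    rw [ht, div_le_div_iff₀ hden (by norm_num)]; linarith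
  have htn : t * n ≤ 2 / 11 := by
    rw [ht, div_mul_eq_mul_div, div_le_div_iff₀ hden (by norm_num)]; linarith
  have hc0' : (0 : ℝ) < c := by exact_mod_cast hc0
  have hapos : (0 : ℝ) < #A := by
    have : 0 < #A := by omega
    exact_mod_cast this
  have hab' : (#A : ℝ) ≤ #B := by exact_mod_cast hab
  have hba' : (#B : ℝ) < 2 * #A := by exact_mod_cast hba
  have hNb' : (Fintype.card V : ℝ) ≤ n * #B := by exact_mod_cast hNb
  have hNa' : (n : ℝ) * #A ≤ Fintype.card V := by exact_mod_cast hNa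
  have e1 : ∑ g : M, (m g : ℝ) = c * #A * #B := by exact_mod_cast sum_inter hc A B
  have hMc : (Fintype.card M : ℝ) = c * Fintype.card V := by exact_mod_cast card_M (M := M) hc
  have e2 : ∑ x : V, (s x : ℝ) = #H * #A := by
    have : ∑ x : V, s x = #H * #A := by
      simp only [hs]
      simp_rw [card_filter]; rw [sum_comm]
      simp_rw [← card_filter, card_trans]
      simp
    exact_mod_cast this
  have e3 : ∑ x ∈ B, (s x : ℝ) = ∑ g ∈ H, (m g : ℝ) := by
    have : ∑ x ∈ B, s x = ∑ g ∈ H, m g := by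
      simp only [hs, hm]
      simp_rw [card_filter]; rw [sum_comm]
    exact_mod_cast this
  have e4 : (#H : ℝ) * ((1 - t) * #B) ≤ ∑ g ∈ H, (m g : ℝ) := by
    rw [← nsmul_eq_mul]
    apply card_nsmul_le_sum
    intro g hg
    simp only [hH, mem_filter, mem_univ, true_and] at hg
    exact hg.le
  have hma : ∀ g, (m g : ℝ) ≤ #A := by
    intro g
    have : m g ≤ #A := by
      rw [← card_trans g A]
      exact card_le_card (filter_subset_filter _ (subset_univ _))
    exact_mod_cast this
  -- upper bound for total
  have e5 : (c * #A * #B : ℝ) ≤ #H * #A + c * Fintype.card V * (t * #B) := by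
    rw [← e1, ← sum_add_sum_compl H]
    have i1 : ∑ g ∈ H, (m g : ℝ) ≤ #H * #A := by
      rw [← nsmul_eq_mul]
      exact sum_le_card_nsmul _ _ _ (fun g _ => hma g)
    have i2 : ∑ g ∈ Hᶜ, (m g : ℝ) ≤ #Hᶜ * (t * #B) := by
      rw [← nsmul_eq_mul]
      refine sum_le_card_nsmul _ _ _ (fun g hg => ?_)
      simp only [hH, mem_compl, mem_filter, mem_univ, true_and] at hg
      exact ((hdich g).resolve_right hg).le
    have i3 : (#Hᶜ : ℝ) ≤ c * Fintype.card V := by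
      rw [← hMc]; exact_mod_cast card_le_univ _
    have i4 := mul_le_mul_of_nonneg_right i3 (show 0 ≤ t * #B by positivity)
    linarith
  have e6 : (c * #A : ℝ) * #B ≤ #H * #A + c * (2 / 11 * #B) * #B := by
    have : (c * Fintype.card V * (t * #B) : ℝ) ≤ c * (2 / 11 * #B) * #B := by
      have : (Fintype.card V * t : ℝ) ≤ 2 / 11 * #B := by nlinarith
      calc (c * Fintype.card V * (t * #B) : ℝ) = c * (Fintype.card V * t) * #B := by ring
        _ ≤ _ := by gcongr
    linarith
  have hbpos : (0 : ℝ) < #B := by linarith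
  have hHne : H.Nonempty := by
    rw [nonempty_iff_ne_empty]
    intro h
    rw [h] at e6
    simp only [card_empty, Nat.cast_zero, zero_mul, zero_add] at e6
    have := le_of_mul_le_mul_right e6 hbpos
    have := le_of_mul_le_mul_left this hc0'
    linarith
  have hA1 : (1 - t) * #B ≤ (#A : ℝ) := by
    obtain ⟨g, hg⟩ := hHne
    simp only [hH, mem_filter, mem_univ, true_and] at hg
    exact hg.le.trans (hma g)
  have hA2 : 21 / 23 * (#B : ℝ) ≤ #A := by nlinarith
  -- pair estimate
  have e7 : ∀ x, (s x : ℝ) * (c * #A - s x) ≤ c ^ 2 * Fintype.card V * (t * #B) := by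
    intro x
    have hp := pair_bound hc0 hc A (2 * t * #B) (by positivity) x
    set P : Finset (M × M) := {p : M × M | (p.1 • x ∈ A ∧ p.2 • x ∈ A) ∧ (#{v : V | p.1 • v ∈ A ∧ p.2 • v ∈ A} : ℝ) ≤ 2 * t * #B} with hP
    set S1 : Finset M := {g ∈ H | g • x ∈ A} with hS1
    set S2 : Finset M := {g ∈ Hᶜ | g • x ∈ A} with hS2
    have hS : #S1 + #S2 = c * #A := by
      rw [← count_mem_s2 hc x A, hS1, hS2, ← card_union_of_disjoint, ← filter_union, union_compl]
      exact disjoint_filter_filter (disjoint_compl_right)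
    have small : ∀ g ∈ S1, ∀ h ∈ S2, (#{v : V | g • v ∈ A ∧ h • v ∈ A} : ℝ) ≤ 2 * t * #B := by
      intro g hg h hh
      simp only [hS1, hS2, hH, mem_filter, mem_compl, mem_univ, true_and] at hg hh
      have h1 := (hdich h).resolve_right hh.1
      have hsub : ({v : V | g • v ∈ A ∧ h • v ∈ A} : Finset V) ⊆ ({v ∈ B | h • v ∈ A} : Finset V) ∪ (({v : V | g • v ∈ A} : Finset V) \ ({v ∈ B | g • v ∈ A} : Finset V)) := by
        intro v hv
        simp only [mem_filter, mem_univ, true_and, mem_union, mem_sdiff] at hv ⊢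
        tauto
      have h2 := (card_le_card hsub).trans (card_union_le _ _)
      have h3 : #(({v : V | g • v ∈ A} : Finset V) \ ({v ∈ B | g • v ∈ A} : Finset V)) + m g = #A := by
        rw [← card_trans g A]
        exact card_sdiff_add_card_eq_card (filter_subset_filter _ (subset_univ _))
      have h2' : (#{v : V | g • v ∈ A ∧ h • v ∈ A} : ℝ) ≤ #{v ∈ B | h • v ∈ A} + #(({v : V | g • v ∈ A} : Finset V) \ ({v ∈ B | g • v ∈ A} : Finset V)) := by exact_mod_cast h2
      have h3' : (#(({v : V | g • v ∈ A} : Finset V) \ ({v ∈ B | g • v ∈ A} : Finset V)) : ℝ) + m g = #A := by exact_mod_cast h3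
      linarith [hg.1]
    have hsubP : (S1 ×ˢ S2) ∪ (S2 ×ˢ S1) ⊆ P := by
      intro p hp
      simp only [mem_union, mem_product] at hp
      simp only [hP, mem_filter, mem_univ, true_and]
      rcases hp with ⟨h1, h2⟩ | ⟨h2, h1⟩
      · exact ⟨⟨(mem_filter.1 h1).2, (mem_filter.1 h2).2⟩, small _ h1 _ h2⟩
      · refine ⟨⟨(mem_filter.1 h2).2, (mem_filter.1 h1).2⟩, ?_⟩
        have := small _ h1 _ h2
        simp_rw [and_comm] at this ⊢
        exact this
    have hdisj : Disjoint S1 S2 := disjoint_filter_filter (disjoint_compl_right)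
    have hcardP : #S1 * #S2 + #S2 * #S1 ≤ #P := by
      rw [← card_product, ← card_product, ← card_union_of_disjoint]
      · exact card_le_card hsubP
      · rw [disjoint_product]; left; exact hdisj
    have hcardP' : (#S1 : ℝ) * #S2 + #S2 * #S1 ≤ #P := by exact_mod_cast hcardP
    have hS' : (#S1 : ℝ) + #S2 = c * #A := by exact_mod_cast hS
    have : (s x : ℝ) = #S1 := rfl
    rw [this, ← hS']
    nlinarith
  have e8 : ∀ x, (s x : ℝ) * (c * #A - s x) ≤ 0.2182 * (c * #A) ^ 2 := by
    intro x
    refine (e7 x).trans ?_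
    have h1 : (Fintype.card V * t : ℝ) ≤ 2 / 11 * #B := by nlinarith
    have h2 : (#B : ℝ) * #B ≤ (23 / 21 * #A) * (23 / 21 * #A) := by
      apply mul_self_le_mul_self hbpos.le; linarith
    calc (c ^ 2 * Fintype.card V * (t * #B) : ℝ) = c ^ 2 * ((Fintype.card V * t) * #B) := by ring
      _ ≤ c ^ 2 * ((2 / 11 * #B) * #B) := by gcongr
      _ = c ^ 2 * (2 / 11 * (#B * #B)) := by ring
      _ ≤ c ^ 2 * (2 / 11 * ((23 / 21 * #A) * (23 / 21 * #A))) := by gcongr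
      _ ≤ _ := by
        have : (0 : ℝ) ≤ c ^ 2 * #A ^ 2 := by positivity
        nlinarith
  have hQ : (0 : ℝ) < c * #A := by positivity
  have e9 : ∀ x, (s x : ℝ) < 0.33 * (c * #A) ∨ 0.67 * (c * #A) < (s x : ℝ) := by
    intro x
    by_contra hcon
    push Not at hcon
    have := e8 x
    nlinarith [mul_nonneg (sub_nonneg.2 hcon.1) (sub_nonneg.2 hcon.2), mul_pos hQ hQ]
  have e10 : ∀ x y, G.Adj x y → (s x : ℝ) ≤ s y + 5 / 23 * (c * #A) := by
    intro x y hxy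
    have hsub : ({g ∈ H | g • x ∈ A} : Finset M) ⊆ ({g ∈ H | g • y ∈ A} : Finset M) ∪ ({g : M | g • x ∈ D} : Finset M) := by
      intro g hg
      simp only [mem_filter, mem_univ, true_and, mem_union] at hg ⊢
      by_cases h : g • y ∈ A
      · exact Or.inl ⟨hg.1, h⟩
      · exact Or.inr (hD _ _ (hadj g x y hxy) hg.2 h).1
    have h2 := (card_le_card hsub).trans (card_union_le _ _)
    rw [count_mem_s2 hc] at h2
    have h3 : (s x : ℝ) ≤ s y + c * #D := by exact_mod_cast h2
    have := mul_le_mul_of_nonneg_left hDc hc0'.le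
    linarith
  have hcases : (∀ x, 0.67 * (c * #A) < (s x : ℝ)) ∨ (∀ x, (s x : ℝ) < 0.33 * (c * #A)) := by
    by_cases h : ∃ x, 0.67 * (c * #A) < (s x : ℝ)
    · obtain ⟨x, hx⟩ := h
      left
      intro y
      refine const_of_adj hG (fun x => 0.67 * (c * #A) < (s x : ℝ)) ?_ x y hx
      intro u v huv hu
      have := e10 u v huv
      rcases e9 v with h | h
      · exfalso; linarith
      · exact h
    · right
      push Not at h
      intro x
      exact (e9 x).resolve_right (not_lt.2 (h x))
  have e4' : (#H : ℝ) * (21 / 23) * #B ≤ ∑ g ∈ H, (m g : ℝ) := by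
    refine le_trans ?_ e4
    rw [mul_assoc]
    gcongr
    linarith
  rcases hcases with h | h
  · have h1 : (Fintype.card V : ℝ) * (0.67 * (c * #A)) ≤ ∑ x : V, (s x : ℝ) := by
      rw [← nsmul_eq_mul, ← card_univ]
      exact card_nsmul_le_sum _ _ _ (fun x _ => (h x).le)
    rw [e2] at h1
    have h2 : (0.67 * c * Fintype.card V : ℝ) ≤ #H := by
      refine le_of_mul_le_mul_right ?_ hapos
      linarith
    have h3 : ∑ g ∈ H, (m g : ℝ) ≤ c * #A * #B := by
      rw [← e1]
      exact sum_le_sum_of_subset_of_nonneg (subset_univ _) (fun _ _ _ => by positivity)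
    have h4 := le_of_mul_le_mul_right (e4'.trans h3) hbpos
    have h5 : (c * #A : ℝ) * 2 ≤ c * Fintype.card V := by
      rw [mul_assoc]; gcongr; nlinarith
    nlinarith
  · have h1 : ∑ x ∈ B, (s x : ℝ) ≤ #B * (0.33 * (c * #A)) := by
      rw [← nsmul_eq_mul]
      exact sum_le_card_nsmul _ _ _ (fun x _ => (h x).le)
    rw [e3] at h1
    have h2 : (#H : ℝ) * (21 / 23) ≤ 0.33 * (c * #A) := by
      refine le_of_mul_le_mul_right ?_ hbpos
      linarith
    have h3 : (#H * #A : ℝ) ≤ #H * #B := by gcongr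
    have h4 : (c * #A : ℝ) ≤ #H + c * (2 / 11 * #B) := by
      refine le_of_mul_le_mul_right ?_ hbpos
      linarith
    have h5 : (c * (21 / 23 * #B) : ℝ) ≤ c * #A := by gcongr
    linarith

open Finset in
/-- averaging for the unbalanced case -/
theorem exists_good_s2 [Nonempty V] (A B D : Finset V) (n : ℕ) (e : ℝ) (he : 0 < e) (hA : A.Nonempty)
    (hNb : Fintype.card V ≤ n * #B) (hD : (#D : ℝ) ≤ e * #B) :
    ∃ g : M, e * #A + #{x ∈ D | g • x ∈ A} ≤ (11 * n + 1) * e * #{x ∈ B | g • x ∈ A} := by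
  obtain ⟨c, hc0, hc⟩ := exists_c (V := V) (M := M)
  by_contra! hcon
  have h1 : ∑ g : M, (11 * n + 1) * e * (#{x ∈ B | g • x ∈ A} : ℝ) < ∑ g : M, (e * #A + (#{x ∈ D | g • x ∈ A} : ℝ)) :=
    sum_lt_sum_of_nonempty univ_nonempty (fun g _ => hcon g)
  have e1 : ∑ g : M, (#{x ∈ B | g • x ∈ A} : ℝ) = c * #A * #B := by exact_mod_cast sum_inter hc A B
  have e2 : ∑ g : M, (#{x ∈ D | g • x ∈ A} : ℝ) = c * #A * #D := by exact_mod_cast sum_inter hc A D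
  have hMc : (Fintype.card M : ℝ) = c * Fintype.card V := by exact_mod_cast card_M (M := M) hc
  rw [← mul_sum, sum_add_distrib, e1, e2, sum_const, card_univ, nsmul_eq_mul, hMc] at h1
  have hNb' : (Fintype.card V : ℝ) ≤ n * #B := by exact_mod_cast hNb
  have i1 : (c * Fintype.card V * (e * #A) : ℝ) ≤ c * (n * #B) * (e * #A) := by gcongr
  have i2 : (c * #A * #D : ℝ) ≤ c * #A * (e * #B) := by gcongr
  have i3 : (0 : ℝ) ≤ c * #A * #B * e * n := by positivity
  nlinarith

end act

theorem iota_le {G : SimpleGraph V} {n : ℕ} (A : Fin (n + 1) → Set V) (hA : IsNPartition (n + 1) A) (K : ℝ)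
    (h : ∀ i, ((vertBdry G (A i)).ncard : ℝ) ≤ K * (A i).ncard) [Finite V] : multiIota G (n + 1) ≤ K := by
  have h1 : multiIota G (n + 1) ≤ vertRatioMax G A := by
    refine csInf_le ⟨0, ?_⟩ ⟨A, hA, rfl⟩
    rintro r ⟨B, _, rfl⟩
    exact Real.iSup_nonneg (fun i => by positivity)
  refine h1.trans (ciSup_le fun i => ?_)
  have : 0 < (A i).ncard := (Set.ncard_pos).2 (hA.1 i)
  rw [div_le_iff₀ (by exact_mod_cast this)]
  exact h i

theorem ratio_le {G : SimpleGraph V} {n : ℕ} (A : Fin n → Set V) (hA : IsNPartition n A) [Finite V] (i : Fin n) :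
    ((vertBdry G (A i)).ncard : ℝ) ≤ vertRatioMax G A * (A i).ncard := by
  have : 0 < (A i).ncard := (Set.ncard_pos).2 (hA.1 i)
  rw [← div_le_iff₀ (by exact_mod_cast this)]
  exact le_ciSup (f := fun i => ((vertBdry G (A i)).ncard : ℝ) / ((A i).ncard : ℝ)) (Set.finite_range _).bddAbove i

theorem exists_balanced [Fintype V] (n : ℕ) (hn : 0 < n) (hcard : n ≤ Fintype.card V) :
    ∃ A : Fin n → Set V, IsNPartition n A ∧ ∀ i, Fintype.card V / n ≤ (A i).ncard := by
  classical
  let e := Fintype.equivFin V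
  have hq : 0 < Fintype.card V / n := Nat.div_pos hcard hn
  have hc : ∀ i : Fin n, Fintype.card V / n ≤ ({v | (e v : ℕ) % n = i} : Set V).ncard := by
    intro i
    have hlt : ∀ j : Fin (Fintype.card V / n), (j : ℕ) * n + i < Fintype.card V := by
      intro j
      have h1 : ((j : ℕ) + 1) * n ≤ Fintype.card V / n * n := Nat.mul_le_mul_right _ j.2
      have h2 := Nat.div_mul_le_self (Fintype.card V) n
      have h3 := i.2
      have h4 : ((j : ℕ) + 1) * n = j * n + n := by ring
      omega
    let f : Fin (Fintype.card V / n) → V := fun j => e.symm ⟨j * n + i, hlt j⟩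
    have hf : Function.Injective f := by
      intro a b hab
      have := e.symm.injective hab
      simp only [Fin.mk.injEq, add_left_inj] at this
      exact Fin.ext (Nat.eq_of_mul_eq_mul_right hn this)
    have h1 : (Set.range f).ncard = Fintype.card V / n := by
      rw [← Set.image_univ, Set.ncard_image_of_injective _ hf, Set.ncard_univ, Nat.card_fin]
    rw [← h1]
    refine Set.ncard_le_ncard ?_
    rintro _ ⟨j, rfl⟩
    simp [f, Nat.mod_eq_of_lt i.2]
  refine ⟨fun i => {v | (e v : ℕ) % n = i}, ⟨fun i => ?_, fun i j hij => ?_, ?_⟩, hc⟩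
  · exact (Set.ncard_pos).1 (hq.trans_le (hc i))
  · rw [Set.disjoint_left]
    intro v h1 h2
    exact hij (Fin.ext (h1.symm.trans h2))
  · ext v
    simp only [Set.mem_iUnion, Set.mem_setOf_eq, Set.mem_univ, iff_true]
    exact ⟨⟨(e v : ℕ) % n, Nat.mod_lt _ hn⟩, rfl⟩

theorem split_le {G : SimpleGraph V} [Finite V] {n : ℕ} (A : Fin n → Set V) (hA : IsNPartition n A) (i0 : Fin n) (X : Set V)
    (K : ℝ) (hK : ∀ i, ((vertBdry G (A i)).ncard : ℝ) ≤ K * (A i).ncard)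
    (hC : (A i0 ∩ X).Nonempty) (hD : (A i0 \ X).Nonempty)
    (hC' : ((vertBdry G (A i0 ∩ X)).ncard : ℝ) ≤ K * (A i0 ∩ X).ncard)
    (hD' : ((vertBdry G (A i0 \ X)).ncard : ℝ) ≤ K * (A i0 \ X).ncard) : multiIota G (n + 1) ≤ K := by
  classical
  obtain ⟨h1, h2, h3⟩ := hA
  have hsub : ∀ i, Function.update A i0 (A i0 \ X) i ⊆ A i := by
    intro i
    by_cases h : i = i0
    · subst h; simp [Set.diff_subset]
    · simp [h]
  have hCD : ∀ i, Disjoint (A i0 ∩ X) (Function.update A i0 (A i0 \ X) i) := by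
    intro i
    by_cases h : i = i0
    · subst h
      simp only [Function.update_self]
      exact Set.disjoint_left.2 (fun v hv hv' => hv'.2 hv.2)
    · exact ((h2 i0 i (Ne.symm h)).mono_left Set.inter_subset_left).mono_right (hsub i)
  refine iota_le (Fin.cons (A i0 ∩ X) (Function.update A i0 (A i0 \ X))) ⟨?_, ?_, ?_⟩ K ?_
  · intro i
    refine Fin.cases (by simpa using hC) (fun j => ?_) i
    by_cases h : j = i0
    · subst h; simpa using hD
    · simpa [h] using h1 j
  · intro i j
    refine Fin.cases ?_ (fun i => ?_) i <;> refine Fin.cases ?_ (fun j => ?_) j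
    · simp
    · intro _; simpa using hCD j
    · intro _; simpa using (hCD i).symm
    · intro hij
      simp only [Fin.cons_succ]
      exact ((h2 i j (fun h => hij (by rw [h]))).mono_left (hsub i)).mono_right (hsub j)
  · rw [Set.eq_univ_iff_forall] at h3 ⊢
    intro v
    obtain ⟨i, hi⟩ := Set.mem_iUnion.1 (h3 v)
    rw [Set.mem_iUnion]
    by_cases h : i = i0
    · subst h
      by_cases hx : v ∈ X
      · exact ⟨0, by simpa using ⟨hi, hx⟩⟩
      · exact ⟨i.succ, by simpa using ⟨hi, hx⟩⟩
    · exact ⟨i.succ, by simpa [h] using hi⟩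
  · intro i
    refine Fin.cases (by simpa using hC') (fun j => ?_) i
    by_cases h : j = i0
    · subst h; simpa using hD'
    · simpa [h] using hK j

theorem bdry_inter (G : SimpleGraph V) (B X : Set V) :
    vertBdry G (B ∩ X) ⊆ (vertBdry G B ∩ X) ∪ vertBdry G X := by
  rintro x ⟨y, hxy, h⟩
  by_cases hX : x ∈ X ↔ y ∈ X
  · left
    simp only [Set.mem_inter_iff] at h
    refine ⟨⟨y, hxy, ?_⟩, ?_⟩ <;> tauto
  · exact Or.inr ⟨y, hxy, hX⟩

theorem bdry_diff (G : SimpleGraph V) (B X : Set V) :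
    vertBdry G (B \ X) ⊆ vertBdry G B ∪ vertBdry G X := by
  rintro x ⟨y, hxy, h⟩
  by_cases hX : x ∈ X ↔ y ∈ X
  · left
    simp only [Set.mem_diff] at h
    refine ⟨y, hxy, ?_⟩
    tauto
  · exact Or.inr ⟨y, hxy, hX⟩

theorem bdry_pre (G : SimpleGraph V) (g : G ≃g G) (A : Set V) :
    vertBdry G {x | g x ∈ A} = {x | g x ∈ vertBdry G A} := by
  ext x
  constructor
  · rintro ⟨y, hxy, h⟩
    exact ⟨g y, g.map_rel_iff.2 hxy, h⟩
  · rintro ⟨y, hxy, h⟩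
    refine ⟨g.symm y, ?_, by simpa using h⟩
    rw [← g.map_rel_iff]
    simpa using hxy

theorem bdry_nonempty (G : SimpleGraph V) (hG : G.Connected) (A : Set V) (h1 : A.Nonempty) (h2 : A ≠ Set.univ) :
    (vertBdry G A).Nonempty := by
  by_contra hcon
  rw [Set.not_nonempty_iff_eq_empty] at hcon
  obtain ⟨a, ha⟩ := h1
  apply h2
  rw [Set.eq_univ_iff_forall]
  intro y
  refine const_of_adj hG (fun v => v ∈ A) ?_ a y ha
  intro u v huv hu
  by_contra hv
  have : u ∈ vertBdry G A := ⟨v, huv, fun h => hv (h.1 hu)⟩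
  rw [hcon] at this
  exact this

set_option maxHeartbeats 1000000 in
theorem main_step_s2 [Fintype V] (G : SimpleGraph V)
    (hconn : G.Connected) (htrans : VertexTransitive G)
    (n : ℕ) (hn : 2 ≤ n) (hcard : n + 1 ≤ Fintype.card V) (A : Fin n → Set V) (hA : IsNPartition n A) :
    multiIota G (n + 1) ≤ (11 * n + 1) * vertRatioMax G A := by
  classical
  have : Nonempty V := hconn.nonempty
  have hn' : (2 : ℝ) ≤ n := by exact_mod_cast hn
  set e := vertRatioMax G A with he
  have hr := fun i => ratio_le (G := G) A hA i
  rw [← he] at hr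
  by_cases hbig : 5 / 23 ≤ e
  · obtain ⟨C, hC, hCc⟩ := exists_balanced (V := V) (n + 1) (by omega) hcard
    refine (iota_le (G := G) C hC (2 * n + 1) fun i => ?_).trans (by nlinarith)
    have h1 : (vertBdry G (C i)).ncard ≤ Fintype.card V := by
      rw [← Nat.card_eq_fintype_card, ← Set.ncard_univ]
      exact Set.ncard_le_ncard (Set.subset_univ _)
    have h2 : Fintype.card V ≤ (2 * n + 1) * (C i).ncard := by
      refine le_trans ?_ (Nat.mul_le_mul_left _ (hCc i))
      have hq : 0 < Fintype.card V / (n + 1) := Nat.div_pos hcard (by omega)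
      have h3 := Nat.div_add_mod (Fintype.card V) (n + 1)
      have h4 := Nat.mod_lt (Fintype.card V) (show 0 < n + 1 by omega)
      nlinarith
    exact_mod_cast h1.trans h2
  push Not at hbig
  have : Nonempty (Fin n) := ⟨⟨0, by omega⟩⟩
  obtain ⟨i1, hi1⟩ := Finite.exists_min (fun i => (A i).ncard)
  obtain ⟨i0, hi0⟩ := Finite.exists_max (fun i => (A i).ncard)
  have hsum : ∑ i, (A i).ncard = Fintype.card V := by
    have h1 := Set.ncard_iUnion_of_finite (s := A) (fun i => Set.toFinite _) (fun i j hij => hA.2.1 i j hij)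
    rw [hA.2.2, Set.ncard_univ, Nat.card_eq_fintype_card, finsum_eq_sum_of_fintype] at h1
    exact h1.symm
  have hNa : n * (A i1).ncard ≤ Fintype.card V := by
    rw [← hsum]
    simpa using Finset.card_nsmul_le_sum Finset.univ (fun i => (A i).ncard) _ (fun i _ => hi1 i)
  have hNb : Fintype.card V ≤ n * (A i0).ncard := by
    rw [← hsum]
    simpa using Finset.sum_le_card_nsmul Finset.univ (fun i => (A i).ncard) _ (fun i _ => hi0 i)
  have hab := hi1 i0
  have hapos : 0 < (A i1).ncard := (Set.ncard_pos).2 (hA.1 i1)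
  have hne : A i1 ≠ Set.univ := by
    intro h
    rw [h, Set.ncard_univ, Nat.card_eq_fintype_card] at hNa
    nlinarith
  have hdpos : 0 < (vertBdry G (A i1)).ncard := (Set.ncard_pos).2 (bdry_nonempty G hconn _ (hA.1 i1) hne)
  have hrA := hr i1
  have hrB := hr i0
  have hapos' : (0 : ℝ) < (A i1).ncard := by exact_mod_cast hapos
  have hdpos' : (0 : ℝ) < (vertBdry G (A i1)).ncard := by exact_mod_cast hdpos
  have he0 : 0 < e := by
    by_contra hcon
    push Not at hcon
    nlinarith
  have hab' : ((A i1).ncard : ℝ) ≤ (A i0).ncard := by exact_mod_cast hab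
  have hK : ∀ i, ((vertBdry G (A i)).ncard : ℝ) ≤ (11 * n + 1) * e * (A i).ncard := by
    intro i
    refine (hr i).trans ?_
    gcongr
    nlinarith
  have hMfin : Finite (G ≃g G) := DFunLike.finite _
  let _ : Fintype (G ≃g G) := Fintype.ofFinite _
  have hpre : MulAction.IsPretransitive (G ≃g G) V := ⟨fun x y => htrans x y⟩
  -- boundary of a translate
  have hpc : ∀ (g : G ≃g G) (X : Set V), ({x | g x ∈ X} : Set V).ncard = X.ncard := by
    intro g X
    have : ({x | g x ∈ X} : Set V) = g.symm '' X := by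
      ext x
      simp only [Set.mem_setOf_eq, Set.mem_image]
      constructor
      · intro h; exact ⟨g x, h, by simp⟩
      · rintro ⟨y, hy, rfl⟩; simpa using hy
    rw [this, Set.ncard_image_of_injective _ g.symm.injective]
  have hpb : ∀ g : G ≃g G, ((vertBdry G {x | g x ∈ A i1}).ncard : ℝ) ≤ e * (A i1).ncard := by
    intro g
    rw [bdry_pre, hpc]; exact hrA
  have hCb : ∀ g : G ≃g G, ((vertBdry G (A i0 ∩ {x | g x ∈ A i1})).ncard : ℝ) ≤
      (vertBdry G (A i0) ∩ {x | g x ∈ A i1}).ncard + e * (A i1).ncard := by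
    intro g
    have h1 := (Set.ncard_le_ncard (bdry_inter G (A i0) {x | g x ∈ A i1})).trans (Set.ncard_union_le _ _)
    have h2 : ((vertBdry G (A i0 ∩ {x | g x ∈ A i1})).ncard : ℝ) ≤ (vertBdry G (A i0) ∩ {x | g x ∈ A i1}).ncard + (vertBdry G {x | g x ∈ A i1}).ncard := by exact_mod_cast h1
    linarith [hpb g]
  have hCb2 : ∀ g : G ≃g G, ((vertBdry G (A i0 ∩ {x | g x ∈ A i1})).ncard : ℝ) ≤
      e * (A i0).ncard + e * (A i1).ncard := by
    intro g
    have h1 : (vertBdry G (A i0) ∩ {x | g x ∈ A i1}).ncard ≤ (vertBdry G (A i0)).ncard :=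
      Set.ncard_le_ncard Set.inter_subset_left
    have h2 : ((vertBdry G (A i0) ∩ {x | g x ∈ A i1}).ncard : ℝ) ≤ (vertBdry G (A i0)).ncard := by exact_mod_cast h1
    linarith [hCb g]
  have hDb : ∀ g : G ≃g G, ((vertBdry G (A i0 \ {x | g x ∈ A i1})).ncard : ℝ) ≤
      e * (A i0).ncard + e * (A i1).ncard := by
    intro g
    have h1 := (Set.ncard_le_ncard (bdry_diff G (A i0) {x | g x ∈ A i1})).trans (Set.ncard_union_le _ _)
    have h2 : ((vertBdry G (A i0 \ {x | g x ∈ A i1})).ncard : ℝ) ≤ (vertBdry G (A i0)).ncard + (vertBdry G {x | g x ∈ A i1}).ncard := by exact_mod_cast h1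
    linarith [hpb g]
  have hCD : ∀ g : G ≃g G, ((A i0 ∩ {x | g x ∈ A i1}).ncard : ℝ) + (A i0 \ {x | g x ∈ A i1}).ncard = (A i0).ncard := by
    intro g
    exact_mod_cast Set.ncard_inter_add_ncard_diff_eq_ncard (A i0) {x | g x ∈ A i1}
  have hCa : ∀ g : G ≃g G, ((A i0 ∩ {x | g x ∈ A i1}).ncard : ℝ) ≤ (A i1).ncard := by
    intro g
    rw [← hpc g (A i1)]
    exact_mod_cast Set.ncard_le_ncard Set.inter_subset_right
  have conv : ∀ (g : G ≃g G) (X : Set V), (Finset.card {x ∈ X.toFinset | g • x ∈ (A i1).toFinset}) = (X ∩ {x | g x ∈ A i1}).ncard := by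
    intro g X
    rw [← Set.ncard_coe_finset]
    congr 1
    ext x
    simp
  have conv' : ∀ (X : Set V), X.toFinset.card = X.ncard := fun X => (Set.ncard_eq_toFinset_card' X).symm
  have ne_of_pos : ∀ X : Set V, (0 : ℝ) < X.ncard → X.Nonempty := by
    intro X hX
    exact (Set.ncard_pos).1 (by exact_mod_cast hX)
  by_cases hhalf : 2 * (A i1).ncard ≤ (A i0).ncard
  · have hhalf' : 2 * ((A i1).ncard : ℝ) ≤ (A i0).ncard := by exact_mod_cast hhalf
    obtain ⟨g, hg⟩ := exists_good_s2 (M := G ≃g G) (A i1).toFinset (A i0).toFinset (vertBdry G (A i0)).toFinset n e he0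
      (by simpa using hA.1 i1) (by rw [conv']; exact hNb) (by rw [conv', conv']; exact hrB)
    rw [conv, conv, conv'] at hg
    have hDp : ((A i1).ncard : ℝ) ≤ (A i0 \ {x | g x ∈ A i1}).ncard := by
      linarith [hCD g, hCa g]
    have hDp2 : ((A i0).ncard : ℝ) ≤ 2 * (A i0 \ {x | g x ∈ A i1}).ncard := by
      linarith [hCD g, hCa g]
    have hK0 : 0 < (11 * n + 1) * e := by positivity
    refine split_le A hA i0 {x | g x ∈ A i1} _ hK (ne_of_pos _ ?_) (ne_of_pos _ (hapos'.trans_le hDp)) ?_ ?_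
    · by_contra hcon
      have h0 : ((A i0 ∩ {x | g x ∈ A i1}).ncard : ℝ) ≤ 0 := not_lt.1 hcon
      have h1 : (0 : ℝ) < e * (A i1).ncard := by positivity
      have h2 : (0 : ℝ) ≤ (vertBdry G (A i0) ∩ {x | g x ∈ A i1}).ncard := by positivity
      nlinarith
    · linarith [hCb g]
    · refine (hDb g).trans ?_
      have h1 : e * ((A i0).ncard + (A i1).ncard) ≤ e * (3 * (A i0 \ {x | g x ∈ A i1}).ncard) := by
        gcongr; linarith
      have h2 : e * (A i0 \ {x | g x ∈ A i1}).ncard * 3 ≤ e * (A i0 \ {x | g x ∈ A i1}).ncard * (11 * n + 1) := by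
        gcongr; linarith
      linarith
  push Not at hhalf
  have hden : (0 : ℝ) < 11 * n + 1 := by linarith
  set t : ℝ := 2 / (11 * n + 1) with ht
  have ht0 : 0 < t := by positivity
  have htm : (11 * n + 1) * t = 2 := by rw [ht]; field_simp
  have hbpos' : (0 : ℝ) < (A i0).ncard := by linarith
  by_cases hex : ∃ g : G ≃g G, t * (A i0).ncard ≤ (A i0 ∩ {x | g x ∈ A i1}).ncard ∧
      ((A i0 ∩ {x | g x ∈ A i1}).ncard : ℝ) ≤ (1 - t) * (A i0).ncard
  · obtain ⟨g, hg1, hg2⟩ := hex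
    have hg3 : t * (A i0).ncard ≤ (A i0 \ {x | g x ∈ A i1}).ncard := by linarith [hCD g]
    have htb : 0 < t * (A i0).ncard := by positivity
    have hfin : ∀ z : ℝ, t * (A i0).ncard ≤ z → e * (A i0).ncard + e * (A i1).ncard ≤ (11 * n + 1) * e * z := by
      intro z hz
      have h1 : (11 * n + 1) * e * (t * (A i0).ncard) ≤ (11 * n + 1) * e * z := by gcongr
      have h2 : (11 * n + 1) * e * (t * (A i0).ncard) = 2 * (e * (A i0).ncard) := by
        rw [← htm]; ring
      have h3 : e * (A i1).ncard ≤ e * (A i0).ncard := by gcongr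
      linarith
    exact split_le A hA i0 {x | g x ∈ A i1} _ hK (ne_of_pos _ (htb.trans_le hg1)) (ne_of_pos _ (htb.trans_le hg3))
      ((hCb2 g).trans (hfin _ hg1)) ((hDb g).trans (hfin _ hg3))
  · exfalso
    push Not at hex
    refine key_false (M := G ≃g G) G hconn (fun g x y h => g.map_rel_iff.2 h) (A i1).toFinset (A i0).toFinset
      (vertBdry G (A i1)).toFinset n hn t ht ?_ (by rw [conv', conv']; exact hab) (by rw [conv', conv']; exact hhalf)
      (by rw [conv']; exact hNb) (by rw [conv']; exact hNa) ?_ ?_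
    · intro g
      rw [conv, conv']
      by_cases h : t * (A i0).ncard ≤ (A i0 ∩ {x | g x ∈ A i1}).ncard
      · exact Or.inr (hex g h)
      · exact Or.inl (not_le.1 h)
    · intro x y hxy hx hy
      simp only [Set.mem_toFinset] at hx hy ⊢
      exact ⟨⟨y, hxy, fun h => hy (h.1 hx)⟩, ⟨x, hxy.symm, fun h => hy (h.2 hx)⟩⟩
    · rw [conv', conv']
      refine hrA.trans ?_
      gcongr

theorem iota_succ_le {V : Type*} [Fintype V] (G : SimpleGraph V)
    (hconn : G.Connected) (htrans : VertexTransitive G)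
    (n : ℕ) (hn : 2 ≤ n) (hcard : n + 1 ≤ Fintype.card V) :
    multiIota G (n + 1) ≤ (11 * n + 1) * multiIota G n := by
  have hpos : (0 : ℝ) < 11 * n + 1 := by positivity
  rw [← div_le_iff₀' hpos]
  obtain ⟨A, hA, _⟩ := exists_balanced (V := V) n (by omega) (by omega)
  refine le_csInf ⟨_, A, hA, rfl⟩ ?_
  rintro r ⟨B, hB, rfl⟩
  rw [div_le_iff₀' hpos]
  exact main_step_s2 G hconn htrans n hn hcard B hB

end Multiway
end

section
/- Let {Γ_m}_{m∈ℕ} be a sequence of finite connected vertex-transitive graphs with vertex sets V_m such that |V_m| → ∞ as m → ∞ (no uniform bound on the degrees is assumed), and let n ≥ 2. If inf_m h_{n+1}(Γ_m) > 0 (where each Γ_m has at least n+1 vertices), then inf_m h_n(Γ_m) > 0. -/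
open scoped Pointwise

namespace Multiway

variable {V : Type*}

section helpers
open Finset

theorem mem_edgeBdry {W : Type*} (G : SimpleGraph W) (A : Set W) (u v : W) :
    s(u, v) ∈ edgeBdry G A ↔ G.Adj u v ∧ ¬ (u ∈ A ↔ v ∈ A) := by
  constructor
  · rintro ⟨h, a, b, hab, ha, hb⟩
    refine ⟨h, ?_⟩
    rcases Sym2.eq_iff.1 hab with ⟨rfl, rfl⟩ | ⟨rfl, rfl⟩ <;> tauto
  · rintro ⟨h, h2⟩
    refine ⟨h, ?_⟩
    by_cases hu : u ∈ A
    · exact ⟨u, v, rfl, hu, by tauto⟩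
    · exact ⟨v, u, Sym2.eq_swap, by tauto, hu⟩

theorem edgeBdry_smul {W Gr : Type*} [Group Gr] [MulAction Gr W] (G : SimpleGraph W)
    (hadj : ∀ (g : Gr) u v, G.Adj (g • u) (g • v) ↔ G.Adj u v) (g : Gr) (A : Set W) :
    (edgeBdry G (g • A)).ncard = (edgeBdry G A).ncard := by
  have : edgeBdry G (g • A) = Sym2.map (g • ·) '' edgeBdry G A := by
    ext e
    induction e using Sym2.ind with
    | _ u v =>
    constructor
    · intro h
      rw [mem_edgeBdry] at h
      refine ⟨s(g⁻¹ • u, g⁻¹ • v), ?_, by simp⟩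
      rw [mem_edgeBdry, hadj]
      simpa [Set.mem_smul_set_iff_inv_smul_mem] using h
    · rintro ⟨e, he, h⟩
      induction e using Sym2.ind with
      | _ a b =>
      rw [← h, Sym2.map_mk, mem_edgeBdry]
      rw [mem_edgeBdry] at he
      simpa [Set.mem_smul_set_iff_inv_smul_mem, hadj] using he
  rw [this, Set.ncard_image_of_injective]
  exact Sym2.map.injective (MulAction.injective g)

theorem ratio_nonneg {W : Type*} (G : SimpleGraph W) {n : ℕ} (A : Fin n → Set W) :
    0 ≤ edgeRatioMax G A := by
  unfold edgeRatioMax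
  exact Real.iSup_nonneg fun i => by positivity

theorem multiH_nonneg {W : Type*} (G : SimpleGraph W) (n : ℕ) : 0 ≤ multiH G n := by
  apply Real.sInf_nonneg
  rintro r ⟨A, -, rfl⟩
  exact ratio_nonneg G A

theorem multiH_le {W : Type*} (G : SimpleGraph W) (n : ℕ) (A : Fin n → Set W)
    (hA : IsNPartition n A) : multiH G n ≤ edgeRatioMax G A := by
  apply csInf_le
  · refine ⟨0, ?_⟩
    rintro r ⟨A, -, rfl⟩
    exact ratio_nonneg G A
  · exact ⟨A, hA, rfl⟩

theorem leftover {W : Type*} [Fintype W] (G : SimpleGraph W) (n : ℕ) (c : ℝ)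
    (hc : 0 < c) (h : c ≤ multiH G (n + 1)) (B : Fin (n + 1) → Set W)
    (hne : ∀ i, (B i).Nonempty) (hd : ∀ i j, i ≠ j → Disjoint (B i) (B j)) :
    ∃ i, c / (n + 1) * ((B i).ncard : ℝ) ≤ ((edgeBdry G (B i)).ncard : ℝ) := by
  classical
  by_contra! hcon
  obtain ⟨k, -, hk⟩ := Finset.exists_max_image (Finset.univ : Finset (Fin (n + 1)))
    (fun i => (B i).ncard) ⟨0, Finset.mem_univ _⟩
  set A : Fin (n + 1) → Set W := fun i => if i = k then {x | ∀ j, j ≠ k → x ∉ B j} else B i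
    with hAdef
  have hsub : ∀ i, B i ⊆ A i := by
    intro i x hx
    by_cases hi : i = k
    · subst hi
      simp only [hAdef, if_true, Set.mem_ofPred_eq]
      intro j hj hxj
      exact Set.disjoint_left.1 (hd j i hj) hxj hx
    · simp only [hAdef, if_neg hi]; exact hx
  have hpart : IsNPartition (n + 1) A := by
    refine ⟨fun i => (hne i).mono (hsub i), ?_, ?_⟩
    · intro i j hij
      by_cases hi : i = k
      · subst hi
        simp only [hAdef, if_true, if_neg hij.symm]
        rw [Set.disjoint_left]
        intro x hx; exact hx j hij.symm
      · by_cases hj : j = k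
        · subst hj
          simp only [hAdef, if_true, if_neg hi]
          rw [Set.disjoint_right]
          intro x hx; exact hx i hi
        · simp only [hAdef, if_neg hi, if_neg hj]; exact hd i j hij
    · rw [Set.eq_univ_iff_forall]
      intro x
      by_cases hx : ∃ j, j ≠ k ∧ x ∈ B j
      · obtain ⟨j, hj, hx⟩ := hx
        exact Set.mem_iUnion.2 ⟨j, hsub j hx⟩
      · refine Set.mem_iUnion.2 ⟨k, ?_⟩
        simp only [hAdef, if_true, Set.mem_ofPred_eq]
        intro j hj hxj; exact hx ⟨j, hj, hxj⟩
  have hApos : ∀ i, (0 : ℝ) < (A i).ncard := by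
    intro i
    exact_mod_cast (Set.ncard_pos).2 (hpart.1 i)
  have hbd : ∀ i, ((edgeBdry G (A i)).ncard : ℝ) < c * (A i).ncard := by
    intro i
    have hn : (0 : ℝ) < n + 1 := by positivity
    by_cases hi : i = k
    · subst hi
      have h1 : edgeBdry G (A i) ⊆ ⋃ j ∈ (Finset.univ : Finset (Fin (n+1))), edgeBdry G (B j) := by
        intro e
        induction e using Sym2.ind with
        | _ u v =>
        rw [mem_edgeBdry]
        rintro ⟨ha, hx⟩
        simp only [hAdef, if_true, Set.mem_ofPred_eq] at hx
        simp only [Set.mem_iUnion, mem_edgeBdry]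
        by_contra! hcc
        apply hx
        refine forall_congr' fun j => forall_congr' fun hj => not_congr ?_
        exact hcc j (Finset.mem_univ _) ha
      have h2 : (edgeBdry G (A i)).ncard ≤ ∑ j, (edgeBdry G (B j)).ncard :=
        (Set.ncard_le_ncard h1 (Set.toFinite _)).trans (Finset.set_ncard_biUnion_le _ _)
      have h3 : ∑ j, ((edgeBdry G (B j)).ncard : ℝ) < ∑ j : Fin (n+1), c / (n + 1) * ((B i).ncard : ℝ) := by
        apply Finset.sum_lt_sum_of_nonempty ⟨0, Finset.mem_univ _⟩
        intro j _
        refine (hcon j).trans_le ?_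
        have : ((B j).ncard : ℝ) ≤ (B i).ncard := by exact_mod_cast hk j (Finset.mem_univ _)
        gcongr
      have h4 : ∑ j : Fin (n+1), c / (n + 1) * ((B i).ncard : ℝ) = c * (B i).ncard := by
        simp; field_simp
      have h5 : ((B i).ncard : ℝ) ≤ (A i).ncard := by
        exact_mod_cast Set.ncard_le_ncard (hsub i) (Set.toFinite _)
      have h6 : ((edgeBdry G (A i)).ncard : ℝ) ≤ ∑ j, ((edgeBdry G (B j)).ncard : ℝ) := by
        exact_mod_cast h2
      nlinarith
    · have hAi : A i = B i := by simp only [hAdef, if_neg hi]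
      have := hApos i
      rw [hAi] at this ⊢
      refine (hcon i).trans_le ?_
      have : c / (n + 1) ≤ c := div_le_self hc.le (by linarith [(Nat.cast_nonneg n : (0:ℝ) ≤ n)])
      gcongr
  have hle := h.trans (multiH_le G (n+1) A hpart)
  obtain ⟨i, hi⟩ := exists_eq_ciSup_of_finite
    (f := fun i => ((edgeBdry G (A i)).ncard : ℝ) / ((A i).ncard : ℝ))
  unfold edgeRatioMax at hle
  rw [← hi, le_div_iff₀ (hApos i)] at hle
  linarith [hbd i]

theorem block_exists {V Gr : Type*} [Fintype V] [DecidableEq V] [Group Gr] [Fintype Gr]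
    [MulAction Gr V] [MulAction.IsPretransitive Gr V] (n : ℕ) (hn : 2 ≤ n) (A : Finset V)
    (hA : A.Nonempty) (hAV : n * A.card ≤ Fintype.card V) (δ : ℝ)
    (hδ : δ ≤ 1 / 24) (hdich : ∀ g : Gr, ((A ∩ g • A).card : ℝ) ≤ δ * A.card ∨
      ((A \ g • A).card : ℝ) ≤ δ * A.card)
    (hidx : ¬ ∃ g : Fin (n + 1) → Gr, ∀ i j, i ≠ j →
      (((g i • A) ∩ (g j • A)).card : ℝ) ≤ δ * A.card) :
    ∃ C : Finset V, C ≠ univ ∧ ((A \ C).card : ℝ) ≤ 2 * δ * A.card ∧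
      ((C \ A).card : ℝ) ≤ 2 * δ * A.card ∧ ∀ g : Gr, g • C = C ∨ Disjoint C (g • C) := by
  classical
  have hA0 : (0 : ℝ) < A.card := by exact_mod_cast hA.card_pos
  have hsymm : ∀ g : Gr, ((g • A) \ A).card = (A \ g • A).card := by
    intro g
    have h1 := Finset.card_sdiff_add_card_inter A (g • A)
    have h2 := Finset.card_sdiff_add_card_inter (g • A) A
    rw [Finset.inter_comm, Finset.card_smul_finset] at h2
    omega
  have hsum : ∀ g : Gr, ((A \ g • A).card : ℝ) + (A ∩ g • A).card = A.card := by
    intro g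
    exact_mod_cast Finset.card_sdiff_add_card_inter A (g • A)
  let H : Subgroup Gr :=
    { carrier := {g | ((A \ g • A).card : ℝ) ≤ δ * A.card}
      one_mem' := by
        rcases hdich 1 with h | h
        · simp at h; nlinarith
        · exact h
      mul_mem' := by
        intro a b ha hb
        simp only [Set.mem_ofPred_eq] at ha hb ⊢
        have h1 : A \ ((a * b) • A) ⊆ (A \ a • A) ∪ a • (A \ b • A) := by
          rw [Finset.smul_finset_sdiff, mul_smul]
          intro x; simp only [mem_sdiff, mem_union]; tauto
        have h2 : (A \ ((a * b) • A)).card ≤ (A \ a • A).card + (A \ b • A).card := by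
          refine (card_le_card h1).trans ((card_union_le _ _).trans ?_)
          rw [Finset.card_smul_finset]
        have h3 : ((A \ ((a * b) • A)).card : ℝ) ≤ (A \ a • A).card + (A \ b • A).card := by
          exact_mod_cast h2
        rcases hdich (a * b) with h | h
        · have := hsum (a * b)
          nlinarith
        · exact h
      inv_mem' := by
        intro a ha
        simp only [Set.mem_ofPred_eq] at ha ⊢
        have : (A \ a⁻¹ • A).card = (A \ a • A).card := by
          rw [← hsymm a, ← Finset.card_smul_finset a (A \ a⁻¹ • A), Finset.smul_finset_sdiff,
            smul_inv_smul]
        rw [this]; exact ha }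
  have hHmem : ∀ g, g ∈ H ↔ ((A \ g • A).card : ℝ) ≤ δ * A.card := fun g => Iff.rfl
  have hnH : ∀ g, g ∉ H → ((A ∩ g • A).card : ℝ) ≤ δ * A.card := by
    intro g hg
    rcases hdich g with h | h
    · exact h
    · exact absurd h hg
  set HF : Finset Gr := univ.filter (· ∈ H) with hHF
  have hHFc : HF.card = Nat.card H := by
    rw [hHF, Nat.card_eq_fintype_card, Fintype.card_subtype]
  have hHpos : 0 < HF.card := by rw [hHFc]; exact Nat.card_pos
  have hGn : Fintype.card Gr ≤ n * HF.card := by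
    rw [hHFc, ← Nat.card_eq_fintype_card, ← Subgroup.index_mul_card H]
    apply Nat.mul_le_mul_right
    by_contra! hlt
    apply hidx
    have hfin : Fintype (Gr ⧸ H) := Fintype.ofFinite _
    have : Fintype.card (Fin (n+1)) ≤ Fintype.card (Gr ⧸ H) := by
      rw [Fintype.card_fin, ← Nat.card_eq_fintype_card]
      exact hlt
    obtain ⟨f⟩ := Function.Embedding.nonempty_of_card_le this
    refine ⟨fun i => (f i).out, fun i j hij => ?_⟩
    have h1 : (f i).out⁻¹ * (f j).out ∉ H := by
      rw [← QuotientGroup.eq]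
      simp [hij]
    have h2 := hnH _ h1
    rwa [← Finset.card_smul_finset (f i).out, Finset.smul_finset_inter, mul_smul,
      smul_inv_smul] at h2
  let N : V → ℕ := fun v => (HF.filter (fun h => v ∈ h • A)).card
  set C : Finset V := univ.filter (fun v => HF.card < 2 * N v) with hC
  have hHR : (0 : ℝ) < HF.card := by exact_mod_cast hHpos
  have hAC : ((A \ C).card : ℝ) ≤ 2 * δ * A.card := by
    have h1 : ∑ v ∈ A \ C, (HF.filter (fun h => v ∉ h • A)).card
        = ∑ h ∈ HF, ((A \ C).filter (fun v => v ∉ h • A)).card :=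
      Finset.sum_card_bipartiteAbove_eq_sum_card_bipartiteBelow (fun v h => v ∉ h • A)
    have h2 : ∑ h ∈ HF, (((A \ C).filter (fun v => v ∉ h • A)).card : ℝ) ≤ ∑ h ∈ HF, δ * A.card := by
      apply Finset.sum_le_sum
      intro h hh
      have hh' : h ∈ H := by simpa [hHF] using hh
      refine le_trans ?_ ((hHmem h).1 hh')
      norm_cast
      apply card_le_card
      intro x; simp only [mem_filter, mem_sdiff]; tauto
    have h3 : ∑ v ∈ A \ C, (HF.card / 2 : ℝ) ≤
        ∑ v ∈ A \ C, ((HF.filter (fun h => v ∉ h • A)).card : ℝ) := by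
      apply Finset.sum_le_sum
      intro v hv
      have hv' : 2 * N v ≤ HF.card := by
        simp only [hC, mem_sdiff, mem_filter, mem_univ, true_and, not_lt] at hv
        exact hv.2
      have := Finset.card_filter_add_card_filter_not (s := HF) (fun h => v ∈ h • A)
      have h4 : HF.card ≤ 2 * (HF.filter (fun h => v ∉ h • A)).card := by
        simp only [N] at hv'; omega
      have h5 : (HF.card : ℝ) ≤ 2 * (HF.filter (fun h => v ∉ h • A)).card := by exact_mod_cast h4
      linarith
    have h1' : ∑ v ∈ A \ C, ((HF.filter (fun h => v ∉ h • A)).card : ℝ)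
        = ∑ h ∈ HF, (((A \ C).filter (fun v => v ∉ h • A)).card : ℝ) := by exact_mod_cast h1
    rw [h1'] at h3
    have h6 := h3.trans h2
    simp only [sum_const, nsmul_eq_mul] at h6
    have : (HF.card : ℝ) * ((A \ C).card) ≤ HF.card * (2 * δ * A.card) := by linarith
    exact le_of_mul_le_mul_left this hHR
  have hCA : ((C \ A).card : ℝ) ≤ 2 * δ * A.card := by
    have h1 : ∑ v ∈ C \ A, (HF.filter (fun h => v ∈ h • A)).card
        = ∑ h ∈ HF, ((C \ A).filter (fun v => v ∈ h • A)).card :=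
      Finset.sum_card_bipartiteAbove_eq_sum_card_bipartiteBelow (fun v h => v ∈ h • A)
    have h2 : ∑ h ∈ HF, (((C \ A).filter (fun v => v ∈ h • A)).card : ℝ) ≤ ∑ h ∈ HF, δ * A.card := by
      apply Finset.sum_le_sum
      intro h hh
      have hh' : h ∈ H := by simpa [hHF] using hh
      refine le_trans ?_ ((hHmem h).1 hh')
      rw [← hsymm]
      norm_cast
      apply card_le_card
      intro x; simp only [mem_filter, mem_sdiff]; tauto
    have h3 : ∑ v ∈ C \ A, (HF.card / 2 : ℝ) ≤
        ∑ v ∈ C \ A, ((HF.filter (fun h => v ∈ h • A)).card : ℝ) := by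
      apply Finset.sum_le_sum
      intro v hv
      have hv' : HF.card < 2 * N v := by
        simp only [hC, mem_sdiff, mem_filter, mem_univ, true_and] at hv
        exact hv.1
      have h5 : (HF.card : ℝ) < 2 * (HF.filter (fun h => v ∈ h • A)).card := by exact_mod_cast hv'
      linarith
    have h1' : ∑ v ∈ C \ A, ((HF.filter (fun h => v ∈ h • A)).card : ℝ)
        = ∑ h ∈ HF, (((C \ A).filter (fun v => v ∈ h • A)).card : ℝ) := by exact_mod_cast h1
    rw [h1'] at h3
    have h6 := h3.trans h2
    simp only [sum_const, nsmul_eq_mul] at h6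
    have : (HF.card : ℝ) * ((C \ A).card) ≤ HF.card * (2 * δ * A.card) := by linarith
    exact le_of_mul_le_mul_left this hHR
  have hCcard : (C.card : ℝ) ≤ (1 + 2 * δ) * A.card := by
    have h1 : C ⊆ A ∪ (C \ A) := by intro x; simp only [mem_union, mem_sdiff]; tauto
    have h2 : (C.card : ℝ) ≤ A.card + (C \ A).card := by
      exact_mod_cast (card_le_card h1).trans (card_union_le _ _)
    linarith
  have hnR : (2 : ℝ) ≤ n := by exact_mod_cast hn
  have hAVR : (n : ℝ) * A.card ≤ Fintype.card V := by exact_mod_cast hAV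
  have hCinv : ∀ g ∈ H, ∀ v, g • v ∈ C ↔ v ∈ C := by
    intro g hg v
    have : N (g • v) = N v := by
      apply Finset.card_bij' (fun h _ => g⁻¹ * h) (fun h _ => g * h)
      · intro h hh
        simp only [hHF, mem_filter, mem_univ, true_and] at hh ⊢
        refine ⟨H.mul_mem (H.inv_mem hg) hh.1, ?_⟩
        rw [mul_smul, ← Finset.inv_smul_mem_iff, inv_inv]; exact hh.2
      · intro h hh
        simp only [hHF, mem_filter, mem_univ, true_and] at hh ⊢
        refine ⟨H.mul_mem hg hh.1, ?_⟩
        rw [mul_smul, Finset.smul_mem_smul_finset_iff]; exact hh.2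
      · simp
      · simp
    simp only [hC, mem_filter, mem_univ, true_and, this]
  refine ⟨C, ?_, hAC, hCA, ?_⟩
  · intro hCu
    rw [hCu, card_univ] at hCcard
    nlinarith
  · intro g
    by_cases hg : g ∈ H
    · left
      ext x
      rw [← Finset.inv_smul_mem_iff]
      exact hCinv _ (H.inv_mem hg) x
    · right
      rw [Finset.disjoint_left]
      intro v hv hvg
      let M : V → ℕ := fun v => (univ.filter (fun k : Gr => v ∈ k • C)).card
      have hM : ∀ u, M u = M v := by
        intro u
        obtain ⟨a, ha⟩ := MulAction.exists_smul_eq Gr v u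
        subst ha
        apply Finset.card_bij' (fun h _ => a⁻¹ * h) (fun h _ => a * h)
        · intro h hh
          simp only [mem_filter, mem_univ, true_and] at hh ⊢
          rw [mul_smul, ← Finset.inv_smul_mem_iff, inv_inv]; exact hh
        · intro h hh
          simp only [mem_filter, mem_univ, true_and] at hh ⊢
          rw [mul_smul, Finset.smul_mem_smul_finset_iff]; exact hh
        · simp
        · simp
      have h1 : ∑ u : V, M u = ∑ k : Gr, ((univ : Finset V).filter (fun u => u ∈ k • C)).card :=
        Finset.sum_card_bipartiteAbove_eq_sum_card_bipartiteBelow (fun u (k : Gr) => u ∈ k • C)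
      have h2 : Fintype.card V * M v = Fintype.card Gr * C.card := by
        simpa [hM, Finset.filter_mem_eq_inter, Finset.card_smul_finset] using h1
      have h3 : 2 * HF.card ≤ M v := by
        have hdis : Disjoint HF (HF.image (fun h => g * h)) := by
          rw [Finset.disjoint_left]
          intro x hx hx2
          simp only [hHF, mem_filter, mem_univ, true_and, mem_image] at hx hx2
          obtain ⟨y, hy, rfl⟩ := hx2
          exact hg ((Subgroup.mul_mem_cancel_right H hy).1 hx)
        have hc : (HF ∪ HF.image (fun h => g * h)).card = 2 * HF.card := by
          rw [card_union_of_disjoint hdis, card_image_of_injective _ (mul_right_injective g)]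
          ring
        rw [← hc]
        apply card_le_card
        intro x hx
        simp only [mem_filter, mem_univ, true_and]
        rcases mem_union.1 hx with hx | hx
        · rw [← Finset.inv_smul_mem_iff]
          have hx' : x ∈ H := by simpa [hHF] using hx
          exact (hCinv _ (H.inv_mem hx') v).2 hv
        · obtain ⟨y, hy, rfl⟩ := mem_image.1 hx
          have hy' : y ∈ H := by simpa [hHF] using hy
          rw [mul_smul, ← Finset.inv_smul_mem_iff, ← Finset.inv_smul_mem_iff]
          rw [← Finset.inv_smul_mem_iff] at hvg
          exact (hCinv _ (H.inv_mem hy') _).2 hvg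
      have h4 : Fintype.card V * (2 * HF.card) ≤ n * HF.card * C.card := by
        calc _ ≤ Fintype.card V * M v := Nat.mul_le_mul_left _ h3
          _ = _ := h2
          _ ≤ _ := Nat.mul_le_mul_right _ hGn
      have h5 : Fintype.card V * 2 ≤ n * C.card := by
        apply Nat.le_of_mul_le_mul_left _ hHpos
        calc _ = Fintype.card V * (2 * HF.card) := by ring
          _ ≤ _ := h4
          _ = _ := by ring
      have h6 : (Fintype.card V : ℝ) * 2 ≤ n * C.card := by exact_mod_cast h5
      have h7 : (n : ℝ) * C.card ≤ n * ((1 + 2 * δ) * A.card) := by gcongr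
      have h8 : (0 : ℝ) < n * A.card := by positivity
      nlinarith

theorem block_bdry {V Gr : Type*} [Fintype V] [DecidableEq V] [Group Gr]
    [MulAction Gr V] [MulAction.IsPretransitive Gr V] (G : SimpleGraph V) (hconn : G.Connected)
    (hadj : ∀ (g : Gr) u v, G.Adj (g • u) (g • v) ↔ G.Adj u v)
    (A C : Finset V) (hC0 : C.Nonempty) (hC1 : C ≠ univ)
    (hblock : ∀ g : Gr, g • C = C ∨ Disjoint C (g • C)) :
    (A ∩ C).card ≤ (A \ C).card + (edgeBdry G (A : Set V)).ncard := by
  classical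
  obtain ⟨x, hx⟩ := hC0
  obtain ⟨y, hy⟩ : ∃ y, y ∉ C := by
    by_contra! h; exact hC1 (eq_univ_iff_forall.2 h)
  obtain ⟨p⟩ := hconn.preconnected x y
  obtain ⟨d, -, hd1, hd2⟩ := p.exists_boundary_dart (C : Set V) (by exact_mod_cast hx)
    (by exact_mod_cast hy)
  set u := d.fst with hu
  set b := (univ.filter (fun w => G.Adj u w ∧ w ∉ C)).card with hb
  have hb1 : 1 ≤ b := card_pos.2 ⟨d.snd, by
    simp only [mem_filter, mem_univ, true_and]; exact ⟨d.adj, by exact_mod_cast hd2⟩⟩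
  have huC : u ∈ C := by exact_mod_cast hd1
  have hgen : ∀ g : Gr, (univ.filter (fun w => G.Adj (g • u) w ∧ w ∉ g • C)).card = b := by
    intro g
    rw [hb, ← Finset.card_smul_finset g (univ.filter (fun w => G.Adj u w ∧ w ∉ C))]
    congr 1
    ext w
    rw [← Finset.inv_smul_mem_iff]
    simp only [mem_filter, mem_univ, true_and]
    rw [← hadj g u, smul_inv_smul, Finset.inv_smul_mem_iff]
  have hin : ∀ v ∈ C, (univ.filter (fun w => G.Adj v w ∧ w ∉ C)).card = b := by
    intro v hv
    obtain ⟨g, rfl⟩ := MulAction.exists_smul_eq Gr u v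
    have : g • C = C := by
      rcases hblock g with h | h
      · exact h
      · exact absurd (Finset.smul_mem_smul_finset huC) (Finset.disjoint_left.1 h hv)
    rw [← hgen g, this]
  have hout : ∀ v, v ∉ C → (univ.filter (fun w => G.Adj v w ∧ w ∈ C)).card ≤ b := by
    intro v hv
    obtain ⟨g, rfl⟩ := MulAction.exists_smul_eq Gr u v
    rcases hblock g with h | h
    · exact absurd (by rw [← h]; exact Finset.smul_mem_smul_finset huC) hv
    · rw [← hgen g]
      apply card_le_card
      intro w
      simp only [mem_filter, mem_univ, true_and]
      rintro ⟨h1, h2⟩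
      exact ⟨h1, Finset.disjoint_left.1 h h2⟩
  -- pairs
  set P := ((A ∩ C) ×ˢ (univ : Finset V)).filter (fun p => G.Adj p.1 p.2 ∧ p.2 ∉ C) with hP
  set Q := ((A ∩ C) ×ˢ (A \ C)).filter (fun p => G.Adj p.1 p.2) with hQ
  set R := ((A ∩ C) ×ˢ (univ : Finset V)).filter (fun p => G.Adj p.1 p.2 ∧ p.2 ∉ C ∧ p.2 ∉ A) with hR
  have hPc : P.card = (A ∩ C).card * b := by
    rw [hP, Finset.card_filter, Finset.sum_product]
    simp only [← Finset.card_filter]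
    rw [Finset.sum_congr rfl (fun v hv => hin v (mem_inter.1 hv).2)]
    simp
  have hQc : Q.card ≤ (A \ C).card * b := by
    rw [hQ, Finset.card_filter, Finset.sum_product_right]
    simp only [← Finset.card_filter]
    refine (Finset.sum_le_card_nsmul _ _ b ?_).trans (by simp)
    intro v hv
    refine le_trans (card_le_card ?_) (hout v (mem_sdiff.1 hv).2)
    intro w
    simp only [mem_filter, mem_univ, true_and, mem_inter]
    rintro ⟨h1, h2⟩
    exact ⟨h2.symm, h1.2⟩
  have hPQ : P.card ≤ Q.card + R.card := by
    refine le_trans (card_le_card ?_) (card_union_le _ _)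
    intro p
    simp only [hP, hQ, hR, mem_filter, mem_union, mem_product, mem_univ, mem_inter, mem_sdiff]
    tauto
  have hRc : R.card ≤ (edgeBdry G (A : Set V)).ncard := by
    rw [← Set.ncard_coe_finset R]
    apply Set.ncard_le_ncard_of_injOn (fun p => s(p.1, p.2))
    · rintro ⟨a, c⟩ h
      simp only [hR, mem_coe, mem_filter, mem_product, mem_inter] at h
      rw [mem_edgeBdry]
      simp only [mem_coe]
      tauto
    · rintro ⟨a, c⟩ h ⟨a', c'⟩ h' he
      simp only [hR, mem_coe, mem_filter, mem_product, mem_inter] at h h'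
      rcases Sym2.eq_iff.1 he with ⟨h1, h2⟩ | ⟨h1, h2⟩
      · simp only at h1 h2; rw [h1, h2]
      · simp only at h1 h2; rw [h2] at h; tauto
  rw [hPc] at hPQ
  by_contra! hcon
  obtain ⟨k, hk⟩ := Nat.exists_eq_add_of_lt hcon
  rw [hk] at hPQ
  nlinarith

set_option maxHeartbeats 2000000 in
theorem core {V Gr : Type*} [Fintype V] [DecidableEq V] [Group Gr] [Fintype Gr]
    [MulAction Gr V] [MulAction.IsPretransitive Gr V] (G : SimpleGraph V) (hconn : G.Connected)
    (hadj : ∀ (g : Gr) u v, G.Adj (g • u) (g • v) ↔ G.Adj u v)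
    (n : ℕ) (hn : 2 ≤ n) (c ε : ℝ) (hc : 0 < c) (h : c ≤ multiH G (n + 1))
    (hε0 : 0 < ε)
    (hε : ε ≤ c / (n + 1) * (1 / (16 * (n + 1)))) (hε' : ε ≤ 1 / 4)
    (B : Fin n → Set V) (hB : IsNPartition n B)
    (hsmall : ∀ i, ((edgeBdry G (B i)).ncard : ℝ) ≤ ε * (B i).ncard) : False := by
  classical
  obtain ⟨hBne, hBd, hBU⟩ := hB
  have hnR : (2 : ℝ) ≤ n := by exact_mod_cast hn
  obtain ⟨k, -, hk⟩ := Finset.exists_min_image (Finset.univ : Finset (Fin n))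
    (fun i => (B i).ncard) ⟨⟨0, by omega⟩, Finset.mem_univ _⟩
  set A : Finset V := (B k).toFinset with hAdef
  have hAB : (A : Set V) = B k := by simp [hAdef]
  have hAc : (B k).ncard = A.card := by rw [← hAB, Set.ncard_coe_finset]
  have hA : A.Nonempty := by rw [← Finset.coe_nonempty, hAB]; exact hBne k
  have hA0 : (0 : ℝ) < A.card := by exact_mod_cast hA.card_pos
  have hAV : n * A.card ≤ Fintype.card V := by
    have h1 : ∑ i : Fin n, (B i).toFinset.card ≤ Fintype.card V := by
      rw [← Finset.card_biUnion]
      · exact Finset.card_le_univ _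
      · intro i _ j _ hij
        simpa using hBd i j hij
    refine le_trans ?_ h1
    have := Finset.card_nsmul_le_sum (Finset.univ : Finset (Fin n))
      (fun i => (B i).toFinset.card) A.card ?_
    · simpa using this
    · intro i _
      have := hk i (Finset.mem_univ _)
      rw [hAc, Set.ncard_eq_toFinset_card'] at this
      exact this
  set c' := c / (n + 1) with hc'
  have hc'0 : 0 < c' := by positivity
  set t : ℝ := 1 / (16 * (n + 1)) with ht
  have ht0 : 0 < t := by positivity
  have htn : (n + 1) * t = 1 / 16 := by rw [ht]; field_simp
  have ht48 : t ≤ 1 / 48 := by nlinarith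
  have hbA : ((edgeBdry G (A : Set V)).ncard : ℝ) ≤ ε * A.card := by
    have := hsmall k
    rwa [← hAB, Set.ncard_coe_finset] at this
  have hbg : ∀ g : Gr, ((edgeBdry G ((g • A : Finset V) : Set V)).ncard : ℝ) ≤ ε * A.card := by
    intro g
    rw [Finset.coe_smul_finset, edgeBdry_smul G hadj]; exact hbA
  have hlo := leftover G n c hc h
  have hdich : ∀ g : Gr, ((A ∩ g • A).card : ℝ) ≤ (2 * t) * A.card ∨
      ((A \ g • A).card : ℝ) ≤ (2 * t) * A.card := by
    intro g
    by_contra! hcon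
    obtain ⟨hc1, hc2⟩ := hcon
    have hp : 0 < 2 * t * A.card := by positivity
    have hX : (A ∩ g • A).Nonempty := by
      rw [← Finset.card_pos]; exact_mod_cast hp.trans hc1
    have hY : (A \ g • A).Nonempty := by
      rw [← Finset.card_pos]; exact_mod_cast hp.trans hc2
    have hbb : ∀ X : Finset V, (X = A ∩ g • A ∨ X = A \ g • A) →
        ((edgeBdry G (X : Set V)).ncard : ℝ) ≤ 2 * ε * A.card := by
      intro X hX
      have h1 : edgeBdry G (X : Set V) ⊆ edgeBdry G (A : Set V) ∪
          edgeBdry G ((g • A : Finset V) : Set V) := by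
        intro e
        induction e using Sym2.ind with
        | _ u v =>
        simp only [Set.mem_union, mem_edgeBdry, Finset.mem_coe]
        rcases hX with rfl | rfl
        · simp only [mem_inter]; tauto
        · simp only [mem_sdiff]; tauto
      have h2 : ((edgeBdry G (X : Set V)).ncard : ℝ) ≤ (edgeBdry G (A : Set V)).ncard +
          (edgeBdry G ((g • A : Finset V) : Set V)).ncard := by
        exact_mod_cast (Set.ncard_le_ncard h1 (Set.toFinite _)).trans (Set.ncard_union_le _ _)
      have := hbg g
      linarith
    let D : Fin (n + 1) → Set V := Fin.cons ((A ∩ g • A : Finset V) : Set V)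
      (fun i => if i = k then ((A \ g • A : Finset V) : Set V) else B i)
    have hsubk : ∀ i, (if i = k then ((A \ g • A : Finset V) : Set V) else B i) ⊆ B i := by
      intro i
      split_ifs with hi
      · rw [hi, ← hAB]; exact_mod_cast Finset.sdiff_subset
      · exact subset_rfl
    have h0 : ∀ i, Disjoint ((A ∩ g • A : Finset V) : Set V)
        (if i = k then ((A \ g • A : Finset V) : Set V) else B i) := by
      intro i
      split_ifs with hi
      · rw [Finset.disjoint_coe, Finset.disjoint_left]
        intro x; simp only [mem_inter, mem_sdiff]; tauto
      · refine (hBd k i (Ne.symm hi)).mono_left ?_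
        rw [← hAB]; exact_mod_cast Finset.inter_subset_left
    obtain ⟨i, hi⟩ := hlo D (by
      intro i
      refine Fin.cases ?_ (fun j => ?_) i
      · exact_mod_cast hX
      · simp only [D, Fin.cons_succ]
        split_ifs
        · exact_mod_cast hY
        · exact hBne j) (by
      intro i j
      refine Fin.cases ?_ (fun i => ?_) i <;> refine Fin.cases ?_ (fun j => ?_) j
      · simp
      · intro _; exact h0 j
      · intro _; exact (h0 i).symm
      · intro hij
        have hij' : i ≠ j := fun h => hij (by rw [h])
        exact (hBd i j hij').mono (hsubk i) (hsubk j))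
    revert hi
    have hkey : ∀ X : Finset V, (X = A ∩ g • A ∨ X = A \ g • A) →
        ¬ (c' * ((X : Set V).ncard : ℝ) ≤ (edgeBdry G (X : Set V)).ncard) := by
      intro X hX hle
      have h1 := hbb X hX
      rw [Set.ncard_coe_finset] at hle
      have h2 : 2 * t * A.card < (X.card : ℝ) := by rcases hX with rfl | rfl <;> assumption
      have h3 : c' * (2 * t * A.card) < c' * X.card := by gcongr
      have h4 : 2 * ε * A.card ≤ 2 * (c' * t) * A.card := by gcongr
      linarith
    refine Fin.cases ?_ (fun j => ?_) i
    · exact hkey _ (Or.inl rfl)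
    · simp only [D, Fin.cons_succ]
      split_ifs
      · exact hkey _ (Or.inr rfl)
      · intro hle
        have h1 := hsmall j
        have h2 : (0 : ℝ) < (B j).ncard := by exact_mod_cast (Set.ncard_pos).2 (hBne j)
        have h3 : c' ≤ ε := le_of_mul_le_mul_right (hle.trans h1) h2
        nlinarith
  have hidx : ¬ ∃ g : Fin (n + 1) → Gr, ∀ i j, i ≠ j →
      (((g i • A) ∩ (g j • A)).card : ℝ) ≤ (2 * t) * A.card := by
    rintro ⟨g, hg⟩
    let D : Fin (n + 1) → Finset V := fun i =>
      (g i • A) \ ((univ.erase i).biUnion fun j => g j • A)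
    have hmem : ∀ i x, x ∈ D i ↔ x ∈ g i • A ∧ ∀ j, j ≠ i → x ∉ g j • A := by
      intro i x; simp [D]
    have hDc : ∀ i, (7 / 8 : ℝ) * A.card ≤ (D i).card := by
      intro i
      have h1 : g i • A ⊆ D i ∪ (univ.erase i).biUnion (fun j => (g i • A) ∩ (g j • A)) := by
        intro x hx
        simp only [mem_union, hmem, mem_biUnion, mem_erase, mem_univ, mem_inter]
        by_cases hj : ∃ j, j ≠ i ∧ x ∈ g j • A
        · obtain ⟨j, hj1, hj2⟩ := hj
          exact Or.inr ⟨j, ⟨hj1, trivial⟩, hx, hj2⟩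
        · exact Or.inl ⟨hx, fun j hj1 hj2 => hj ⟨j, hj1, hj2⟩⟩
      have h2 : A.card ≤ (D i).card + ∑ j ∈ univ.erase i, ((g i • A) ∩ (g j • A)).card := by
        rw [← Finset.card_smul_finset (g i) A]
        refine (card_le_card h1).trans ((card_union_le _ _).trans ?_)
        exact Nat.add_le_add_left card_biUnion_le _
      have h3 : ∑ j ∈ univ.erase i, (((g i • A) ∩ (g j • A)).card : ℝ) ≤
          ∑ j ∈ univ.erase i, (2 * t) * A.card :=
        Finset.sum_le_sum fun j hj => hg i j (Finset.ne_of_mem_erase hj).symm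
      have h4 : (A.card : ℝ) ≤ (D i).card + ∑ j ∈ univ.erase i, (((g i • A) ∩ (g j • A)).card : ℝ) := by
        exact_mod_cast h2
      rw [Finset.sum_const, Finset.card_erase_of_mem (mem_univ _), Finset.card_univ,
        Fintype.card_fin, nsmul_eq_mul, Nat.add_sub_cancel] at h3
      have h5 : (n : ℝ) * t ≤ 1 / 16 := by linarith
      nlinarith
    obtain ⟨i, hi⟩ := hlo (fun i => (D i : Set V)) (by
      intro i
      rw [Finset.coe_nonempty, ← Finset.card_pos]
      have : (0 : ℝ) < (D i).card := by linarith [hDc i]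
      exact_mod_cast this) (by
      intro i j hij
      rw [Finset.disjoint_coe, Finset.disjoint_left]
      intro x hx hx'
      rw [hmem] at hx hx'
      exact hx.2 j hij.symm hx'.1)
    rw [Set.ncard_coe_finset] at hi
    have h1 : edgeBdry G (D i : Set V) ⊆
        ⋃ j ∈ (Finset.univ : Finset (Fin (n+1))), edgeBdry G ((g j • A : Finset V) : Set V) := by
      intro e
      induction e using Sym2.ind with
      | _ u v =>
      rw [mem_edgeBdry]
      rintro ⟨ha, hx⟩
      simp only [Set.mem_iUnion, mem_edgeBdry, Finset.mem_coe]
      by_contra! hcc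
      apply hx
      have hcc' : ∀ j, (u ∈ g j • A ↔ v ∈ g j • A) := fun j => hcc j (Finset.mem_univ _) ha
      simp only [Finset.mem_coe, hmem, hcc']
    have h2 : (edgeBdry G (D i : Set V)).ncard ≤
        ∑ j, (edgeBdry G ((g j • A : Finset V) : Set V)).ncard :=
      (Set.ncard_le_ncard h1 (Set.toFinite _)).trans (Finset.set_ncard_biUnion_le _ _)
    have h3 : ((edgeBdry G (D i : Set V)).ncard : ℝ) ≤
        ∑ j, ((edgeBdry G ((g j • A : Finset V) : Set V)).ncard : ℝ) := by exact_mod_cast h2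
    have h4 := h3.trans (Finset.sum_le_sum fun j _ => hbg (g j))
    simp only [sum_const, card_univ, Fintype.card_fin, nsmul_eq_mul] at h4
    push_cast at h4
    have h5 : c' * (7 / 8 * A.card) ≤ c' * (D i).card := by have := hDc i; gcongr
    have h6 : ((n : ℝ) + 1) * (ε * A.card) ≤ (n + 1) * (c' * t * A.card) := by gcongr
    have h7 : ((n : ℝ) + 1) * (c' * t * A.card) = c' * A.card * (1 / 16) := by
      rw [← htn]; ring
    have h8 : 0 < c' * A.card := by positivity
    linarith
  obtain ⟨C, hC1, hAC, hCA, hbl⟩ := block_exists n hn A hA hAV (2 * t) (by linarith) hdich hidx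
  have hs : ((A \ C).card : ℝ) + (A ∩ C).card = A.card := by
    exact_mod_cast Finset.card_sdiff_add_card_inter A C
  have hAC' : ((A \ C).card : ℝ) ≤ 1 / 12 * A.card := by
    refine hAC.trans ?_
    gcongr
    linarith
  have hC0 : C.Nonempty := by
    have : (0 : ℝ) < (A ∩ C).card := by linarith
    have : (A ∩ C).Nonempty := by rw [← Finset.card_pos]; exact_mod_cast this
    exact this.mono Finset.inter_subset_right
  have hfin := block_bdry G hconn hadj A C hC0 hC1 hbl
  have hfinR : ((A ∩ C).card : ℝ) ≤ (A \ C).card + (edgeBdry G (A : Set V)).ncard := by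
    exact_mod_cast hfin
  have : ε * A.card ≤ 1 / 4 * A.card := by gcongr
  linarith

theorem single {V : Type*} [Fintype V] (G : SimpleGraph V) (hconn : G.Connected)
    (htrans : VertexTransitive G) (n : ℕ) (hn : 2 ≤ n) (hcard : n + 1 ≤ Fintype.card V)
    (c : ℝ) (hc : 0 < c) (h : c ≤ multiH G (n + 1)) :
    min (c / (n + 1) * (1 / (16 * (n + 1)))) (1 / 4) ≤ multiH G n := by
  classical
  set ε := min (c / (n + 1) * (1 / (16 * (n + 1)))) (1 / 4) with hε
  have hε0 : 0 < ε := lt_min (by positivity) (by norm_num)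
  apply le_csInf
  · have : Fintype.card (Fin n) ≤ Fintype.card V := by rw [Fintype.card_fin]; omega
    obtain ⟨f⟩ := Function.Embedding.nonempty_of_card_le this
    haveI : Nonempty (Fin n) := ⟨⟨0, by omega⟩⟩
    refine ⟨_, fun i => {x | Function.invFun f x = i}, ⟨fun i => ⟨f i, ?_⟩, ?_, ?_⟩, rfl⟩
    · exact Function.leftInverse_invFun f.injective i
    · intro i j hij
      rw [Set.disjoint_left]
      intro x hx hx'
      exact hij (hx.symm.trans hx')
    · rw [Set.eq_univ_iff_forall]
      intro x; simp
  · rintro r ⟨B, hB, rfl⟩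
    by_contra! hlt
    let act : MulAction (G ≃g G) V :=
      { smul := fun g v => g v
        one_smul := fun _ => rfl
        mul_smul := fun _ _ _ => rfl }
    have htr : MulAction.IsPretransitive (G ≃g G) V := ⟨fun u v => htrans u v⟩
    haveI : Finite (G ≃g G) := Finite.of_injective (fun g : G ≃g G => (g : V → V)) DFunLike.coe_injective
    haveI : Fintype (G ≃g G) := Fintype.ofFinite _
    refine core (Gr := G ≃g G) G hconn (fun g u v => g.map_rel_iff) n hn c ε hc h hε0
      (min_le_left _ _) (min_le_right _ _) B hB ?_
    intro i
    have hpos : (0 : ℝ) < (B i).ncard := by exact_mod_cast (Set.ncard_pos).2 (hB.1 i)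
    rw [← div_le_iff₀ hpos]
    refine le_trans ?_ hlt.le
    exact le_ciSup (f := fun i => ((edgeBdry G (B i)).ncard : ℝ) / ((B i).ncard : ℝ))
      (Set.finite_range _).bddAbove i

end helpers

theorem h_multiway_expanders {V : ℕ → Type*} [∀ m, Fintype (V m)]
    (Γ : ∀ m, SimpleGraph (V m))
    (hconn : ∀ m, (Γ m).Connected) (htrans : ∀ m, VertexTransitive (Γ m))
    (hgrow : Filter.Tendsto (fun m => Fintype.card (V m)) Filter.atTop Filter.atTop)
    (n : ℕ) (hn : 2 ≤ n) (hcard : ∀ m, n + 1 ≤ Fintype.card (V m))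
    (hpos : 0 < ⨅ m, multiH (Γ m) (n + 1)) :
    0 < ⨅ m, multiH (Γ m) n := by
  set c := ⨅ m, multiH (Γ m) (n + 1) with hc
  have hle : ∀ m, c ≤ multiH (Γ m) (n + 1) := fun m =>
    ciInf_le ⟨0, by rintro r ⟨m, rfl⟩; exact multiH_nonneg _ _⟩ m
  have hε0 : 0 < min (c / (n + 1) * (1 / (16 * (n + 1)))) (1 / 4) :=
    lt_min (by positivity) (by norm_num)
  exact hε0.trans_le (le_ciInf fun m =>
    single (Γ m) (hconn m) (htrans m) n hn (hcard m) c hpos (hle m))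

end Multiway
end

section
/- Let {Γ_m}_{m∈ℕ} be a sequence of finite connected vertex-transitive graphs with vertex sets V_m such that |V_m| → ∞ as m → ∞ (no uniform bound on the degrees is assumed), and let n ≥ 2. If inf_m ι_{n+1}(Γ_m) > 0 (where each Γ_m has at least n+1 vertices), then inf_m ι_n(Γ_m) > 0. -/
open scoped Pointwise

namespace Multiway

variable {V : Type*}

section Core

open Finset

theorem group_aux {T : Type*} [DecidableEq T] (w : T → ℝ) (q : ℝ) (hq : 0 < q)
    (hw0 : ∀ t, 0 ≤ w t) (hw : ∀ t, w t ≤ q) (S : Finset T) (hS : q ≤ ∑ t ∈ S, w t) :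
    ∃ U ⊆ S, q ≤ ∑ t ∈ U, w t ∧ ∑ t ∈ U, w t ≤ 2 * q := by
  induction S using Finset.induction_on with
  | empty => simp at hS; linarith
  | insert a S ha ih =>
    by_cases h : q ≤ ∑ t ∈ S, w t
    · obtain ⟨U, hU, h1⟩ := ih h
      exact ⟨U, hU.trans (Finset.subset_insert _ _), h1⟩
    · refine ⟨insert a S, subset_rfl, hS, ?_⟩
      rw [Finset.sum_insert ha]
      have := hw a
      push Not at h
      linarith

theorem group_aux2 {T : Type*} [DecidableEq T] (w : T → ℝ) (q : ℝ) (hq : 0 < q)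
    (hw0 : ∀ t, 0 ≤ w t) (hw : ∀ t, w t ≤ q) (N : ℕ) :
    ∀ (S : Finset T), 2 * q * N ≤ ∑ t ∈ S, w t →
    ∃ f : T → ℕ, ∀ i < N, q ≤ ∑ t ∈ S with f t = i, w t := by
  induction N with
  | zero => intro S _; exact ⟨fun _ => 0, by simp⟩
  | succ N ih =>
    intro S hS
    push_cast at hS
    have h0 : 0 ≤ q * N := by positivity
    obtain ⟨U, hU, h1, h2⟩ := group_aux w q hq hw0 hw S (by nlinarith)
    have hsd := Finset.sum_sdiff (f := w) hU
    obtain ⟨f, hf⟩ := ih (S \ U) (by nlinarith)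
    refine ⟨fun t => if t ∈ U then N else if f t < N then f t else N + 1, ?_⟩
    intro i hi
    rcases Nat.lt_succ_iff_lt_or_eq.mp hi with hi | rfl
    · refine (hf i hi).trans (Finset.sum_le_sum_of_subset_of_nonneg ?_ (fun _ _ _ => hw0 _))
      intro t ht
      simp only [Finset.mem_filter, Finset.mem_sdiff] at ht ⊢
      obtain ⟨⟨h3, h4⟩, h5⟩ := ht
      refine ⟨h3, ?_⟩
      rw [if_neg h4, if_pos (by omega), h5]
    · refine h1.trans (Finset.sum_le_sum_of_subset_of_nonneg ?_ (fun _ _ _ => hw0 _))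
      intro t ht
      simp [ht, hU ht]

variable {V : Type*} [Fintype V] [DecidableEq V] (G : SimpleGraph V) [Fintype (G ≃g G)]

theorem count_aux [Nonempty V] (ht : VertexTransitive G) :
    ∃ c : ℝ, 0 < c ∧ (Fintype.card (G ≃g G) : ℝ) = c * Fintype.card V ∧
      ∀ (x : V) (S : Finset V), (#{g : G ≃g G | g x ∈ S} : ℝ) = c * #S := by
  have hV : (0 : ℝ) < Fintype.card V := by exact_mod_cast Fintype.card_pos
  have hP : (0 : ℝ) < Fintype.card (G ≃g G) := by
    haveI : Nonempty (G ≃g G) := ⟨1⟩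
    exact_mod_cast Fintype.card_pos
  have key : ∀ x v w : V, #{g : G ≃g G | g x = v} = #{g : G ≃g G | g x = w} := by
    intro x v w
    obtain ⟨h, hh⟩ := ht v w
    refine Finset.card_bij (fun g _ => h * g) ?_ ?_ ?_
    · intro g hg
      simp only [mem_filter, mem_univ, true_and] at hg ⊢
      rw [RelIso.mul_apply, hg, hh]
    · intro a _ b _ hab
      exact mul_left_cancel hab
    · intro b hb
      simp only [mem_filter, mem_univ, true_and] at hb
      refine ⟨h⁻¹ * b, ?_, by simp⟩
      simp only [mem_filter, mem_univ, true_and]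
      rw [RelIso.mul_apply, hb, ← hh, ← RelIso.mul_apply, inv_mul_cancel, RelIso.one_apply]
  have key2 : ∀ (x : V) (S : Finset V), #{g : G ≃g G | g x ∈ S} = #{g : G ≃g G | g x = x} * #S := by
    intro x S
    rw [Finset.card_eq_sum_card_fiberwise (f := fun g : G ≃g G => g x) (t := S)
      (by intro g hg; simpa using hg)]
    rw [mul_comm, ← smul_eq_mul, ← Finset.sum_const]
    refine Finset.sum_congr rfl fun v hv => ?_
    rw [← key x v x]
    congr 1
    ext g
    simp only [mem_filter, mem_univ, true_and]
    constructor
    · exact fun h => h.2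
    · exact fun h => ⟨h ▸ hv, h⟩
  refine ⟨Fintype.card (G ≃g G) / Fintype.card V, by positivity, by field_simp, ?_⟩
  intro x S
  have h1 := key2 x univ
  simp only [mem_univ, filter_true, Finset.card_univ] at h1
  rw [key2 x S, h1]
  push_cast
  field_simp

/-- separation count -/
noncomputable def sepD (A : Finset V) (x y : V) : ℝ :=
  (#{g : G ≃g G | ¬ (g x ∈ A ↔ g y ∈ A)} : ℝ)

theorem sepD_symm (A : Finset V) (x y : V) : sepD G A x y = sepD G A y x := by
  unfold sepD
  simp only [iff_comm]

theorem sepD_self (A : Finset V) (x : V) : sepD G A x x = 0 := by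
  simp [sepD]

theorem sepD_tri (A : Finset V) (x y z : V) : sepD G A x z ≤ sepD G A x y + sepD G A y z := by
  unfold sepD
  rw [← Nat.cast_add, Nat.cast_le]
  refine le_trans (Finset.card_le_card ?_) (Finset.card_union_le _ _)
  intro g
  simp only [mem_filter, mem_univ, true_and, mem_union]
  tauto

theorem sepD_inv (A : Finset V) (x y : V) (h : G ≃g G) :
    sepD G A (h x) (h y) = sepD G A x y := by
  unfold sepD
  rw [Nat.cast_inj]
  refine Finset.card_bij (fun g _ => g * h) ?_ ?_ ?_
  · intro g hg
    simpa [RelIso.mul_apply] using hg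
  · intro a _ b _ hab
    exact mul_right_cancel hab
  · intro b hb
    refine ⟨b * h⁻¹, ?_, by simp⟩
    simp only [mem_filter, mem_univ, true_and] at hb ⊢
    simpa only [← RelIso.mul_apply, inv_mul_cancel_right] using hb

theorem sepD_adj (A B : Finset V) (hB : ∀ x y, G.Adj x y → ¬ (x ∈ A ↔ y ∈ A) → x ∈ B)
    (c : ℝ) (hc : ∀ (x : V) (S : Finset V), (#{g : G ≃g G | g x ∈ S} : ℝ) = c * #S)
    (x y : V) (hxy : G.Adj x y) : sepD G A x y ≤ c * #B := by
  unfold sepD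
  rw [← hc x B, Nat.cast_le]
  refine Finset.card_le_card ?_
  intro g
  simp only [mem_filter, mem_univ, true_and]
  exact hB _ _ (g.map_rel_iff.mpr hxy)

theorem sepD_far (A : Finset V) [Nonempty V] (hA : 2 * #A ≤ Fintype.card V)
    (c : ℝ) (hc0 : 0 < c)
    (hc : ∀ (x : V) (S : Finset V), (#{g : G ≃g G | g x ∈ S} : ℝ) = c * #S)
    (x : V) : ∃ y, c * #A ≤ sepD G A x y := by
  by_contra! hcon
  have h1 : ∑ y, sepD G A x y < ∑ y : V, c * #A :=
    Finset.sum_lt_sum_of_nonempty univ_nonempty (fun y _ => hcon y)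
  have hcomp : ((#Aᶜ : ℕ) : ℝ) = Fintype.card V - #A := by
    rw [Finset.card_compl, Nat.cast_sub (Finset.card_le_univ A)]
  have h2 : ∑ y, sepD G A x y = ∑ g : G ≃g G, if g x ∈ A then (#Aᶜ : ℝ) else (#A : ℝ) := by
    unfold sepD
    simp only [Finset.card_filter, Nat.cast_sum]
    rw [Finset.sum_comm]
    refine Finset.sum_congr rfl fun g _ => ?_
    have h3 : ∀ p : V → Prop, ∀ [DecidablePred p],
        (∑ y : V, ((if p (g y) then 1 else 0 : ℕ) : ℝ)) = (#{y | p y} : ℝ) := by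
      intro p _
      rw [Finset.card_filter, Nat.cast_sum]
      exact Equiv.sum_comp g.toEquiv (fun y => ((if p y then 1 else 0 : ℕ) : ℝ))
    rw [h3 (fun y => ¬ (g x ∈ A ↔ y ∈ A))]
    split_ifs with hx
    · congr 2
      ext y; simp [hx]
    · congr 2
      ext y; simp [hx]
  have h4 := hc x A
  have h5 := hc x Aᶜ
  have h6 : (∑ g : G ≃g G, if g x ∈ A then (#Aᶜ : ℝ) else (#A : ℝ)) = 2 * (c * #A * #Aᶜ) := by
    rw [Finset.sum_ite, Finset.sum_const, Finset.sum_const, nsmul_eq_mul, nsmul_eq_mul, h4]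
    simp only [mem_compl] at h5
    rw [h5]; ring
  rw [h2, h6, hcomp, Finset.sum_const, nsmul_eq_mul, Finset.card_univ] at h1
  have hA' : (2 : ℝ) * #A ≤ Fintype.card V := by exact_mod_cast hA
  have h7 : 0 ≤ c * #A := by positivity
  nlinarith

theorem sepD_ivt (hG : G.Connected) (A : Finset V) (τ : ℝ) (hτ : 0 ≤ τ)
    (hadj : ∀ x y, G.Adj x y → sepD G A x y ≤ τ) (x y : V) (t : ℝ) (ht0 : 0 ≤ t)
    (ht : t ≤ sepD G A x y) : ∃ v, t ≤ sepD G A x v ∧ sepD G A x v ≤ t + τ := by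
  obtain ⟨p⟩ := hG.preconnected y x
  have : ∀ (u w : V) (p : G.Walk u w), t ≤ sepD G A x u → sepD G A x w ≤ t + τ →
      ∃ v, t ≤ sepD G A x v ∧ sepD G A x v ≤ t + τ := by
    intro u w p
    induction p with
    | nil => intro h1 h2; exact ⟨_, h1, h2⟩
    | @cons u v w h p ih =>
      intro h1 h2
      by_cases h3 : t ≤ sepD G A x v
      · exact ih h3 h2
      · refine ⟨u, h1, ?_⟩
        have h4 := sepD_tri G A x v u
        have h5 := hadj v u h.symm
        linarith
  exact this y x p ht (by rw [sepD_self]; linarith)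

theorem ball_card (ht : VertexTransitive G) (A : Finset V) (s : ℝ) (x y : V) :
    #{z | sepD G A x z ≤ s} = #{z | sepD G A y z ≤ s} := by
  obtain ⟨h, rfl⟩ := ht x y
  refine Finset.card_bij (fun z _ => h z) ?_ ?_ ?_
  · intro z hz
    simp only [mem_filter, mem_univ, true_and] at hz ⊢
    rwa [sepD_inv]
  · intro a _ b _ hab
    exact h.injective hab
  · intro b hb
    obtain ⟨z, rfl⟩ := h.surjective b
    refine ⟨z, ?_, rfl⟩
    simp only [mem_filter, mem_univ, true_and] at hb ⊢
    rwa [sepD_inv] at hb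

theorem ball_small (hG : G.Connected) (ht : VertexTransitive G) (A : Finset V) (τ a : ℝ)
    (hτ : 0 ≤ τ) (ha : 0 < a) (M : ℕ) (hM : 0 < M) (hτa : τ ≤ a / (2 * M))
    (hadj : ∀ x y, G.Adj x y → sepD G A x y ≤ τ)
    (hfar : ∀ x, ∃ y, a ≤ sepD G A x y) (x : V) :
    (M : ℝ) * #{z | sepD G A x z ≤ a / (5 * M)} ≤ Fintype.card V := by
  have hM' : (0 : ℝ) < M := by exact_mod_cast hM
  obtain ⟨y, hy⟩ := hfar x
  set u : ℝ := a / (10 * M) with hu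
  have hu0 : 0 < u := by positivity
  have ha' : a = 10 * M * u := by rw [hu]; field_simp
  have hs : a / (5 * M) = 2 * u := by rw [ha']; field_simp; norm_num
  have hτu : τ ≤ 5 * u := by
    refine hτa.trans (le_of_eq ?_); rw [ha']; field_simp; norm_num
  have hp : ∀ j : Fin M, ∃ v, 10 * u * (j : ℕ) ≤ sepD G A x v ∧
      sepD G A x v ≤ 10 * u * (j : ℕ) + τ := by
    intro j
    refine sepD_ivt G hG A τ hτ hadj x y _ (by positivity) ?_
    have : ((j : ℕ) : ℝ) ≤ M := by exact_mod_cast j.2.le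
    nlinarith
  choose p hp1 hp2 using hp
  have hlt : ∀ j k : Fin M, j < k → ∀ z, sepD G A (p j) z ≤ 2 * u → sepD G A (p k) z ≤ 2 * u →
      False := by
    intro j k hjk z h1 h2
    have h3 : ((j : ℕ) : ℝ) + 1 ≤ (k : ℕ) := by exact_mod_cast hjk
    have h4 := sepD_tri G A x (p j) (p k)
    have h5 := sepD_tri G A (p j) z (p k)
    rw [sepD_symm G A z] at h5
    have h6 := hp1 k
    have h7 := hp2 j
    nlinarith
  rw [hs]
  have hdis : #((univ : Finset (Fin M)).biUnion fun j => {z | sepD G A (p j) z ≤ 2 * u}) =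
      ∑ j : Fin M, #{z | sepD G A (p j) z ≤ 2 * u} := by
    refine Finset.card_biUnion ?_
    intro j _ k _ hjk
    rw [Function.onFun, Finset.disjoint_left]
    intro z h1 h2
    simp only [mem_filter, mem_univ, true_and] at h1 h2
    rcases lt_or_gt_of_ne hjk with h | h
    · exact hlt j k h z h1 h2
    · exact hlt k j h z h2 h1
  have h8 := Finset.card_le_univ
    ((univ : Finset (Fin M)).biUnion fun j => {z | sepD G A (p j) z ≤ 2 * u})
  rw [hdis] at h8
  rw [Finset.sum_congr rfl (fun j _ => ball_card G ht A (2 * u) (p j) x)] at h8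
  simp only [Finset.sum_const, Finset.card_univ, Fintype.card_fin, smul_eq_mul] at h8
  exact_mod_cast h8

theorem greedy_s4 (A : Finset V) (s ρ : ℝ) (hρ : ρ ≤ 1)
    (hs : s = ρ * Fintype.card (G ≃g G)) (F : Finset (V × V))
    (hF : ∀ q ∈ F, s ≤ sepD G A q.1 q.2) (K : ℕ) :
    ∃ g : Fin K → (G ≃g G),
      (#{q ∈ F | ∀ i, (g i q.1 ∈ A ↔ g i q.2 ∈ A)} : ℝ) ≤ (1 - ρ) ^ K * #F := by
  induction K with
  | zero => exact ⟨Fin.elim0, by simp⟩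
  | succ K ih =>
    obtain ⟨g, hg⟩ := ih
    set F' := {q ∈ F | ∀ i, (g i q.1 ∈ A ↔ g i q.2 ∈ A)} with hF'
    have : ∃ h : G ≃g G, (#{q ∈ F' | (h q.1 ∈ A ↔ h q.2 ∈ A)} : ℝ) ≤ (1 - ρ) * #F' := by
      by_contra! hcon
      haveI : Nonempty (G ≃g G) := ⟨1⟩
      have h1 : ∑ h : G ≃g G, (1 - ρ) * #F' <
          ∑ h : G ≃g G, (#{q ∈ F' | (h q.1 ∈ A ↔ h q.2 ∈ A)} : ℝ) :=
        Finset.sum_lt_sum_of_nonempty univ_nonempty (fun y _ => hcon y)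
      have h2 : ∑ h : G ≃g G, (#{q ∈ F' | (h q.1 ∈ A ↔ h q.2 ∈ A)} : ℝ) ≤
          ∑ q ∈ F', (Fintype.card (G ≃g G) - s) := by
        simp only [Finset.card_filter, Nat.cast_sum]
        rw [Finset.sum_comm]
        refine Finset.sum_le_sum fun q hq => ?_
        have h3 := hF q (Finset.mem_filter.mp hq).1
        unfold sepD at h3
        rw [← Nat.cast_sum, ← Finset.card_filter]
        have h4 := Finset.card_filter_add_card_filter_not (s := (univ : Finset (G ≃g G)))
          (fun g => (g q.1 ∈ A ↔ g q.2 ∈ A))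
        rw [Finset.card_univ] at h4
        have h5 : ((#{g : G ≃g G | (g q.1 ∈ A ↔ g q.2 ∈ A)} : ℕ) : ℝ) +
          (#{g : G ≃g G | ¬ (g q.1 ∈ A ↔ g q.2 ∈ A)} : ℕ) = Fintype.card (G ≃g G) := by
          exact_mod_cast h4
        linarith
      rw [Finset.sum_const, nsmul_eq_mul, Finset.card_univ] at h1
      rw [Finset.sum_const, nsmul_eq_mul, hs] at h2
      nlinarith
    obtain ⟨h, hh⟩ := this
    refine ⟨Fin.cons h g, ?_⟩
    have h6 : {q ∈ F | ∀ i : Fin (K + 1), ((Fin.cons h g : Fin (K + 1) → (G ≃g G)) i q.1 ∈ A ↔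
        (Fin.cons h g : Fin (K + 1) → (G ≃g G)) i q.2 ∈ A)} =
        {q ∈ F' | (h q.1 ∈ A ↔ h q.2 ∈ A)} := by
      ext q
      simp only [hF', mem_filter, Fin.forall_fin_succ, Fin.cons_zero, Fin.cons_succ]
      tauto
    rw [h6, pow_succ]
    refine hh.trans ?_
    have : 0 ≤ 1 - ρ := by linarith
    nlinarith

end Core

section Core2

open Finset

theorem core_partition {V : Type*} [Fintype V] [DecidableEq V] (G : SimpleGraph V)
    [Fintype (G ≃g G)] [Nonempty V]
    (hG : G.Connected) (ht : VertexTransitive G) (A B : Finset V) (hAne : A.Nonempty)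
    (hA : 2 * #A ≤ Fintype.card V)
    (hB : ∀ x y, G.Adj x y → ¬ (x ∈ A ↔ y ∈ A) → x ∈ B) (ε : ℝ)
    (hBA : (#B : ℝ) ≤ ε * #A) (N M : ℕ) (hN : 0 < N) (hM : M = 8 * N ^ 2)
    (hεM : ε ≤ 1 / (2 * M)) :
    ∃ F : V → Fin N, (∀ i, (Fintype.card V : ℝ) / (2 * N) ≤ #{x | F x = i}) ∧
      ∃ C : Finset V, (#C : ℝ) ≤ 10 * M ^ 2 * ε * Fintype.card V ∧
        ∀ x y, G.Adj x y → F x ≠ F y → x ∈ C := by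
  obtain ⟨c, hc0, hcP, hc⟩ := count_aux G ht
  have hM1 : 1 ≤ M := by
    have : 1 ≤ N ^ 2 := Nat.one_le_pow _ _ hN
    omega
  have hM1' : (1 : ℝ) ≤ M := by exact_mod_cast hM1
  have hN' : (0 : ℝ) < N := by exact_mod_cast hN
  have hV : (0 : ℝ) < Fintype.card V := by exact_mod_cast Fintype.card_pos
  have hA0 : (0 : ℝ) < #A := by exact_mod_cast hAne.card_pos
  have hAV : (#A : ℝ) ≤ Fintype.card V := by exact_mod_cast Finset.card_le_univ A
  have hε0 : 0 ≤ ε := by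
    have h0 : (0 : ℝ) ≤ ε * #A := le_trans (by positivity) hBA
    exact nonneg_of_mul_nonneg_left h0 hA0
  have hball := ball_small G hG ht A (c * #B) (c * #A) (by positivity) (by positivity) M hM1
    (by
      have h1 : c * (#B : ℝ) ≤ c * (ε * #A) := by gcongr
      have h2 : c * (ε * #A) ≤ c * (1 / (2 * M) * #A) := by gcongr
      refine h1.trans (h2.trans (le_of_eq ?_))
      field_simp)
    (sepD_adj G A B hB c hc) (sepD_far G A hA c hc0 hc)
  set s : ℝ := c * #A / (5 * M) with hs
  set ρ : ℝ := #A / (5 * M * Fintype.card V) with hρ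
  have hρ0 : 0 < ρ := by positivity
  have hρ1 : ρ ≤ 1 := by
    rw [hρ, div_le_one (by positivity)]
    nlinarith
  set K : ℕ := ⌈(M : ℝ) / ρ⌉₊ with hK
  have hK1 : (M : ℝ) / ρ ≤ K := Nat.le_ceil _
  have hK2 : (K : ℝ) ≤ 2 * (M / ρ) := by
    have h1 : (K : ℝ) < M / ρ + 1 := Nat.ceil_lt_add_one (by positivity)
    have h2 : 1 ≤ (M : ℝ) / ρ := by rw [le_div_iff₀ hρ0]; linarith
    linarith
  have hpow : (1 - ρ) ^ K ≤ 1 / M := by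
    have h1 : (1 - ρ) ^ K ≤ (Real.exp (-ρ)) ^ K :=
      pow_le_pow_left₀ (by linarith) (Real.one_sub_le_exp_neg ρ) K
    rw [← Real.exp_nat_mul] at h1
    have h2 : (K : ℝ) * -ρ ≤ -M := by
      rw [div_le_iff₀ hρ0] at hK1
      linarith
    have h3 : Real.exp (-M : ℝ) ≤ 1 / M := by
      rw [Real.exp_neg, ← one_div]
      have := Real.add_one_le_exp (M : ℝ)
      gcongr
      linarith
    exact h1.trans ((Real.exp_le_exp.mpr h2).trans h3)
  obtain ⟨g, hg⟩ := greedy_s4 G A s ρ hρ1 (by rw [hs, hρ, hcP]; field_simp)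
    {q : V × V | ¬ sepD G A q.1 q.2 ≤ s}
    (by intro q hq; simp only [mem_filter, mem_univ, true_and, not_le] at hq; exact hq.le) K
  let κ : V → (Fin K → Bool) := fun x i => decide (g i x ∈ A)
  have hκ : ∀ x y, κ x = κ y ↔ ∀ i, (g i x ∈ A ↔ g i y ∈ A) := by
    intro x y
    simp [κ, funext_iff]
  have hnear : (#{q : V × V | sepD G A q.1 q.2 ≤ s} : ℝ) ≤ (Fintype.card V : ℝ) ^ 2 / M := by
    have h1 : #{q : V × V | sepD G A q.1 q.2 ≤ s} = ∑ x : V, #{z | sepD G A x z ≤ s} := by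
      simp only [Finset.card_filter]
      rw [Fintype.sum_prod_type]
    rw [h1, Nat.cast_sum]
    refine (Finset.sum_le_sum (g := fun _ => (Fintype.card V : ℝ) / M) ?_).trans ?_
    · intro x _
      rw [le_div_iff₀ (by linarith), mul_comm]
      exact hball x
    · rw [Finset.sum_const, nsmul_eq_mul, Finset.card_univ]
      apply le_of_eq; ring
  have hfar : (#{q ∈ ({q : V × V | ¬ sepD G A q.1 q.2 ≤ s} : Finset (V × V)) |
      ∀ i, (g i q.1 ∈ A ↔ g i q.2 ∈ A)} : ℝ) ≤ (Fintype.card V : ℝ) ^ 2 / M := by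
    refine hg.trans ?_
    have h1 : (#{q : V × V | ¬ sepD G A q.1 q.2 ≤ s} : ℝ) ≤ (Fintype.card V : ℝ) ^ 2 := by
      have := Finset.card_le_univ ({q : V × V | ¬ sepD G A q.1 q.2 ≤ s} : Finset (V × V))
      rw [Fintype.card_prod, ← sq] at this
      exact_mod_cast this
    calc _ ≤ (1 / M : ℝ) * (Fintype.card V : ℝ) ^ 2 := by gcongr
      _ = _ := by ring
  have hw : ∀ t, (#{x | κ x = t} : ℝ) ≤ (Fintype.card V : ℝ) / (2 * N) := by
    intro t
    have h1 : #(({x | κ x = t} : Finset V) ×ˢ ({x | κ x = t} : Finset V)) ≤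
        #({q : V × V | sepD G A q.1 q.2 ≤ s} : Finset (V × V)) +
        #{q ∈ ({q : V × V | ¬ sepD G A q.1 q.2 ≤ s} : Finset (V × V)) |
          ∀ i, (g i q.1 ∈ A ↔ g i q.2 ∈ A)} := by
      refine le_trans (Finset.card_le_card ?_) (Finset.card_union_le _ _)
      intro q hq
      simp only [mem_product, mem_filter, mem_univ, true_and, mem_union] at hq ⊢
      have := (hκ q.1 q.2).mp (hq.1.trans hq.2.symm)
      by_cases h : sepD G A q.1 q.2 ≤ s
      · exact Or.inl h
      · exact Or.inr ⟨h, this⟩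
    rw [Finset.card_product] at h1
    have h2 : (#{x | κ x = t} : ℝ) * #{x | κ x = t} ≤
        (Fintype.card V : ℝ) ^ 2 / M + (Fintype.card V : ℝ) ^ 2 / M :=
      le_trans (by exact_mod_cast h1) (add_le_add hnear hfar)
    refine le_of_sq_le_sq ?_ (by positivity)
    rw [sq]
    refine h2.trans (le_of_eq ?_)
    rw [hM]
    push_cast
    field_simp
    norm_num
  have hsum : ∀ (p : (Fin K → Bool) → Prop) [DecidablePred p],
      ∑ t with p t, (#{x | κ x = t} : ℝ) = #{x | p (κ x)} := by
    intro p _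
    rw [← Nat.cast_sum, Nat.cast_inj]
    rw [Finset.card_eq_sum_card_fiberwise (f := κ) (s := {x | p (κ x)})
      (t := ({t | p t} : Finset (Fin K → Bool))) (by intro x hx; simpa using hx)]
    refine Finset.sum_congr rfl fun t hpt => ?_
    congr 1
    ext x
    simp only [mem_filter, mem_univ, true_and] at hpt ⊢
    constructor
    · rintro rfl; exact ⟨hpt, rfl⟩
    · exact fun h => h.2
  obtain ⟨f, hf⟩ := group_aux2 (fun t => (#{x | κ x = t} : ℝ)) ((Fintype.card V : ℝ) / (2 * N))
    (by positivity) (fun t => by positivity) hw N univ (by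
      have := hsum (fun _ => True)
      simp only [filter_true] at this
      rw [this, Finset.card_univ]
      apply le_of_eq; field_simp)
  refine ⟨fun x => ⟨f (κ x) % N, Nat.mod_lt _ hN⟩, ?_, ?_⟩
  · intro i
    refine (hf i i.2).trans ?_
    rw [hsum (fun t => f t = i), Nat.cast_le]
    refine Finset.card_le_card ?_
    intro x hx
    simp only [mem_filter, mem_univ, true_and] at hx ⊢
    ext
    simp [hx, Nat.mod_eq_of_lt i.2]
  · refine ⟨univ.biUnion fun i => {x | g i x ∈ B}, ?_, ?_⟩
    · have h1 : #(univ.biUnion fun i => ({x | g i x ∈ B} : Finset V)) ≤ K * #B := by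
        refine Finset.card_biUnion_le.trans ?_
        refine (Finset.sum_le_sum (g := fun _ => #B) ?_).trans (by simp)
        intro i _
        refine Finset.card_le_card_of_injOn (g i) ?_ (g i).injective.injOn
        intro x hx
        simpa using hx
      have h2 : (#(univ.biUnion fun i => ({x | g i x ∈ B} : Finset V)) : ℝ) ≤ K * #B := by
        exact_mod_cast h1
      calc _ ≤ (K : ℝ) * #B := h2
        _ ≤ (2 * (M / ρ)) * (ε * #A) := by gcongr
        _ = _ := by rw [hρ]; field_simp; ring
    · intro x y hxy hne
      have h3 : κ x ≠ κ y := by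
        intro h; apply hne; simp only [h]
      rw [Ne, hκ] at h3
      push Not at h3
      simp only [mem_biUnion, mem_univ, true_and, mem_filter]
      obtain ⟨i, hi⟩ := h3
      refine ⟨i, hB _ _ ((g i).map_rel_iff.mpr hxy) ?_⟩
      tauto

theorem vertRatioMax_nonneg {V : Type*} (G : SimpleGraph V) {n : ℕ} (A : Fin n → Set V) :
    0 ≤ vertRatioMax G A := Real.iSup_nonneg fun i => by positivity

theorem multiIota_nonneg {V : Type*} (G : SimpleGraph V) (n : ℕ) : 0 ≤ multiIota G n := by
  refine Real.sInf_nonneg ?_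
  rintro r ⟨A, -, rfl⟩
  exact vertRatioMax_nonneg G A

theorem multiIota_le {V : Type*} [Fintype V] (G : SimpleGraph V)
    (hG : G.Connected) (ht : VertexTransitive G) (A : Set V) (hAne : A.Nonempty)
    (hA : 2 * A.ncard ≤ Fintype.card V) (ε : ℝ)
    (hBA : ((vertBdry G A).ncard : ℝ) ≤ ε * A.ncard) (N M : ℕ) (hN : 0 < N) (hM : M = 8 * N ^ 2)
    (hεM : ε ≤ 1 / (2 * M)) : multiIota G N ≤ 20 * N * M ^ 2 * ε := by
  classical
  have : Nonempty V := ⟨hAne.some⟩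
  have : Finite (G ≃g G) := Finite.of_injective (fun g => (g : V → V)) DFunLike.coe_injective
  have := Fintype.ofFinite (G ≃g G)
  have hV : (0 : ℝ) < Fintype.card V := by exact_mod_cast Fintype.card_pos
  have hN' : (0 : ℝ) < N := by exact_mod_cast hN
  rw [Set.ncard_eq_toFinset_card'] at hA
  rw [Set.ncard_eq_toFinset_card', Set.ncard_eq_toFinset_card' A] at hBA
  obtain ⟨F, hF, C, hC, hFC⟩ := core_partition G hG ht A.toFinset (vertBdry G A).toFinset
    (by simpa using hAne) hA (by
      intro x y hxy h
      simp only [Set.mem_toFinset] at h ⊢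
      exact ⟨y, hxy, h⟩) ε hBA N M hN hM hεM
  have hpos : ∀ i, (0 : ℝ) < #{x | F x = i} := fun i => lt_of_lt_of_le (by positivity) (hF i)
  have hnc : ∀ i, {x | F x = i}.ncard = #{x | F x = i} := by
    intro i
    rw [Set.ncard_eq_toFinset_card']
    congr 1
    ext; simp
  have hle : multiIota G N ≤ vertRatioMax G (fun i => {x | F x = i}) := by
    refine csInf_le ⟨0, ?_⟩ ⟨_, ⟨?_, ?_, ?_⟩, rfl⟩
    · rintro r ⟨A, -, rfl⟩
      exact vertRatioMax_nonneg G A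
    · intro i
      have h1 : 0 < #{x | F x = i} := by exact_mod_cast hpos i
      obtain ⟨x, hx⟩ := Finset.card_pos.mp h1
      exact ⟨x, by simpa using hx⟩
    · intro i j hij
      rw [Set.disjoint_left]
      intro x hx hy
      exact hij (hx.symm.trans hy)
    · ext x; simp
  refine hle.trans ?_
  have : Nonempty (Fin N) := ⟨⟨0, hN⟩⟩
  refine ciSup_le fun i => ?_
  rw [hnc, div_le_iff₀ (hpos i)]
  have h2 : (vertBdry G {x | F x = i}).ncard ≤ #C := by
    rw [← Set.ncard_coe_finset]
    refine Set.ncard_le_ncard ?_ (Finset.finite_toSet C)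
    rintro x ⟨y, hxy, h⟩
    refine hFC x y hxy ?_
    intro h'
    apply h
    simp [h']
  have h2' : ((vertBdry G {x | F x = i}).ncard : ℝ) ≤ #C := by exact_mod_cast h2
  have hε0 : 0 ≤ ε := by
    have hA0 : (0 : ℝ) < #A.toFinset := by
      have : A.toFinset.Nonempty := by simpa using hAne
      exact_mod_cast this.card_pos
    have h0 : (0 : ℝ) ≤ ε * #A.toFinset := le_trans (by positivity) hBA
    exact nonneg_of_mul_nonneg_left h0 hA0
  calc _ ≤ (#C : ℝ) := h2'
    _ ≤ 10 * M ^ 2 * ε * Fintype.card V := hC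
    _ = 20 * N * M ^ 2 * ε * (Fintype.card V / (2 * N)) := by field_simp; ring
    _ ≤ _ := by gcongr; exact hF i

theorem exists_small {V : Type*} [Fintype V] {n : ℕ} (hn : 2 ≤ n) (A : Fin n → Set V)
    (hA : IsNPartition n A) : ∃ i, 2 * (A i).ncard ≤ Fintype.card V := by
  have hd := hA.2.1 ⟨0, by omega⟩ ⟨1, by omega⟩ (by simp)
  have h1 := Set.ncard_union_eq hd
  have h2 := Set.ncard_le_card (A ⟨0, by omega⟩ ∪ A ⟨1, by omega⟩)
  rw [Nat.card_eq_fintype_card] at h2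
  by_contra! h
  have h3 := h ⟨0, by omega⟩
  have h4 := h ⟨1, by omega⟩
  omega

theorem exists_partition {V : Type*} [Fintype V] {n : ℕ} (hn : 0 < n)
    (hc : n ≤ Fintype.card V) : ∃ A : Fin n → Set V, IsNPartition n A := by
  obtain ⟨e⟩ := Function.Embedding.nonempty_of_card_le (α := Fin n) (β := V) (by simpa using hc)
  have : Nonempty (Fin n) := ⟨⟨0, hn⟩⟩
  have hs := Function.invFun_surjective e.injective
  refine ⟨fun i => {x | Function.invFun e x = i}, ?_, ?_, ?_⟩
  · exact fun i => hs i
  · intro i j hij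
    rw [Set.disjoint_left]
    intro x hx hy
    exact hij (hx.symm.trans hy)
  · ext x; simp

end Core2

theorem iota_multiway_expanders {V : ℕ → Type*} [∀ m, Fintype (V m)]
    (Γ : ∀ m, SimpleGraph (V m))
    (hconn : ∀ m, (Γ m).Connected) (htrans : ∀ m, VertexTransitive (Γ m))
    (hgrow : Filter.Tendsto (fun m => Fintype.card (V m)) Filter.atTop Filter.atTop)
    (n : ℕ) (hn : 2 ≤ n) (hcard : ∀ m, n + 1 ≤ Fintype.card (V m))
    (hpos : 0 < ⨅ m, multiIota (Γ m) (n + 1)) :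
    0 < ⨅ m, multiIota (Γ m) n := by
  set c0 := ⨅ m, multiIota (Γ m) (n + 1) with hc0
  obtain ⟨N, hN⟩ : ∃ N, N = n + 1 := ⟨_, rfl⟩
  obtain ⟨M, hM⟩ : ∃ M, M = 8 * N ^ 2 := ⟨_, rfl⟩
  have hN0 : 0 < N := by omega
  have hM0 : 0 < M := by rw [hM]; positivity
  have hN' : (0 : ℝ) < N := by exact_mod_cast hN0
  have hM' : (0 : ℝ) < M := by exact_mod_cast hM0
  set ε : ℝ := min (1 / (2 * M)) (c0 / (40 * N * M ^ 2)) with hε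
  have hε0 : 0 < ε := lt_min (by positivity) (by positivity)
  refine lt_of_lt_of_le hε0 (le_ciInf fun m => ?_)
  obtain ⟨A0, hA0⟩ := exists_partition (V := V m) (n := n) (by omega)
    (by have := hcard m; omega)
  refine le_csInf ⟨_, A0, hA0, rfl⟩ ?_
  rintro r ⟨A, hA, rfl⟩
  by_contra! hlt
  obtain ⟨i, hi⟩ := exists_small hn A hA
  have hne := hA.1 i
  have hpos' : (0 : ℝ) < (A i).ncard := by
    exact_mod_cast (Set.ncard_pos (Set.toFinite _)).mpr hne
  have h1 : ((vertBdry (Γ m) (A i)).ncard : ℝ) / ((A i).ncard : ℝ) ≤ vertRatioMax (Γ m) A :=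
    le_ciSup (f := fun i => ((vertBdry (Γ m) (A i)).ncard : ℝ) / ((A i).ncard : ℝ))
      (Set.toFinite _).bddAbove i
  have h2 : ((vertBdry (Γ m) (A i)).ncard : ℝ) ≤ ε * (A i).ncard := by
    rw [← div_le_iff₀ hpos']
    exact h1.trans hlt.le
  have h3 := multiIota_le (Γ m) (hconn m) (htrans m) (A i) hne hi ε h2 N M hN0 hM
    (min_le_left _ _)
  have h4 : c0 ≤ multiIota (Γ m) N := by
    rw [hN]
    refine ciInf_le (f := fun m => multiIota (Γ m) (n + 1)) ⟨0, ?_⟩ m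
    rintro _ ⟨k, rfl⟩
    exact multiIota_nonneg _ _
  have h5 : 20 * N * M ^ 2 * ε ≤ 20 * N * M ^ 2 * (c0 / (40 * N * M ^ 2)) := by
    gcongr
    exact min_le_right _ _
  have h6 : 20 * N * M ^ 2 * (c0 / (40 * N * M ^ 2)) = c0 / 2 := by
    field_simp; norm_num
  linarith

end Multiway
end
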